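/- arXiv:0812.1601 — 8 statements merged into one kernel-verified Lean document; each statement's English description precedes it below -/
import Mathlib

section
/- Let m < n be positive integers, let B be an m × n real matrix such that b_{ij} = δ_{ij} for 1 ≤ i, j ≤ m, let b be a non-negative vector in ℝ^m such that the set {α ∈ ℝ₊ⁿ : Bα = b} is bounded, and let C be an m × n real matrix such that c_{ii} ≤ c_{ik} ≤ c_{ij} whenever i, j ≤ m, i ≠ j and k > m. Then there exists a subset J of [n] of size m such that: (1) Bα = b for some α ∈ ℝ₊ⁿ with α_j = 0 whenever j ∉ J, and (2) for every k ∈ [n] there exists i ∈ [m] such that c_{ik} ≤ c_{ij} for all j ∈ J. -/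
namespace Scarf

section Feasible

variable {ι κ V : Type*} [Fintype κ] [AddCommGroup V] [Module ℝ V]

/-- `α` is a non-negative solution of `B α = b` supported on `J`, where the unknowns and the
right-hand side take values in a real vector space `V`. -/
structure IsSolution [LE V] (B : Matrix ι κ ℝ) (b : ι → V) (J : Finset κ) (α : κ → V) : Prop where
  nonneg : ∀ j, 0 ≤ α j
  support : ∀ j ∉ J, α j = 0
  eq : ∀ i, ∑ j, B i j • α j = b i

/-- `B α = b` has a non-negative solution supported on `J`. -/
def Feasible [LE V] (B : Matrix ι κ ℝ) (b : ι → V) (J : Finset κ) : Prop :=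
  ∃ α, IsSolution B b J α

lemma Feasible.mono [LE V] {B : Matrix ι κ ℝ} {b : ι → V} {S T : Finset κ}
    (h : Feasible B b S) (hST : S ⊆ T) : Feasible B b T := by
  obtain ⟨α, hα⟩ := h
  exact ⟨α, hα.nonneg, fun j hj => hα.support j fun h => hj (hST h), hα.eq⟩

/-- A pivot step: move along the kernel vector until a coordinate vanishes. -/
lemma Feasible.pivot [DecidableEq κ] [LinearOrder V] [IsOrderedAddMonoid V] [PosSMulMono ℝ V]
    {B : Matrix ι κ ℝ} {b : ι → V} {S : Finset κ} {z : κ → ℝ} (hzS : ∀ j ∉ S, z j = 0)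
    (hBz : ∀ i, ∑ j, B i j • z j = 0) (hneg : ∃ j, z j < 0) (hf : Feasible B b S) :
    ∃ t ∈ S, z t < 0 ∧ Feasible B b (S.erase t) := by
  obtain ⟨α, hα⟩ := hf
  obtain ⟨j₀, hj₀⟩ := hneg
  have hmemS : ∀ j, z j < 0 → j ∈ S := fun j hj => by
    by_contra h
    exact hj.ne (hzS j h)
  obtain ⟨t, ht, hmin⟩ := Finset.exists_min_image (Finset.univ.filter fun j => z j < 0)
    (fun j => (-(z j))⁻¹ • α j) ⟨j₀, by simpa using hj₀⟩
  simp only [Finset.mem_filter, Finset.mem_univ, true_and] at ht hmin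
  set v : V := (-(z t))⁻¹ • α t with hv
  have hv0 : 0 ≤ v := smul_nonneg (inv_nonneg.2 (by linarith)) (hα.nonneg t)
  refine ⟨t, hmemS t ht, ht, fun j => α j + z j • v, fun j => ?_, fun j hj => ?_, fun i => ?_⟩
  · rcases le_or_gt 0 (z j) with h | h
    · exact add_nonneg (hα.nonneg j) (smul_nonneg h hv0)
    · have h1 := smul_le_smul_of_nonneg_left (hmin j h) (show 0 ≤ -(z j) by linarith)
      rw [smul_smul _ (-(z j))⁻¹, mul_inv_cancel₀ (by linarith), one_smul, neg_smul] at h1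
      exact neg_le_iff_add_nonneg.1 h1
  · by_cases hjt : j = t
    · rw [hjt, hv, smul_smul, inv_neg, mul_neg, mul_inv_cancel₀ ht.ne, neg_smul, one_smul,
        add_neg_cancel]
    · have hjS : j ∉ S := fun h => hj (Finset.mem_erase.2 ⟨hjt, h⟩)
      rw [hα.support j hjS, hzS j hjS, zero_smul, add_zero]
  · have : ∑ j, B i j • z j • v = 0 := by
      simp_rw [← smul_assoc, ← Finset.sum_smul, hBz, zero_smul]
    simp_rw [smul_add, Finset.sum_add_distrib, this, add_zero, hα.eq]

variable [Fintype ι]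

lemma sum_smul_sum_smul (B : Matrix ι κ ℝ) (y : ι → ℝ) (α : κ → V) :
    ∑ i, y i • ∑ j, B i j • α j = ∑ j, (∑ i, y i * B i j) • α j := by
  simp_rw [Finset.smul_sum, smul_smul, Finset.sum_smul]
  exact Finset.sum_comm

/-- The restriction to the columns in `J` of the linear map `y ↦ yᵀ B`. -/
def rowMap (B : Matrix ι κ ℝ) (J : Finset κ) : (ι → ℝ) →ₗ[ℝ] (J → ℝ) where
  toFun y j := ∑ i, y i * B i j
  map_add' x y := by ext j; simp [add_mul, Finset.sum_add_distrib]
  map_smul' r y := by ext j; simp [mul_assoc, Finset.mul_sum]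

variable [DecidableEq κ] [LinearOrder V] {B : Matrix ι κ ℝ} {b : ι → V} {J S : Finset κ}

lemma Feasible.rowMap_injective (hb : LinearIndependent ℝ b) (hJ : Feasible B b J) :
    Function.Injective (rowMap B J) := by
  obtain ⟨α, hα⟩ := hJ
  refine (injective_iff_map_eq_zero _).2 fun y hy => ?_
  refine funext (Fintype.linearIndependent_iff.1 hb y ?_)
  simp_rw [← hα.eq]
  rw [sum_smul_sum_smul]
  refine Finset.sum_eq_zero fun j _ => ?_
  by_cases hj : j ∈ J
  · have : ∑ i, y i * B i j = 0 := congrFun hy ⟨j, hj⟩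
    rw [this, zero_smul]
  · rw [hα.support j hj, smul_zero]

lemma Feasible.card_le (hb : LinearIndependent ℝ b) (hJ : Feasible B b J) :
    Fintype.card ι ≤ J.card := by
  simpa using LinearMap.finrank_le_finrank_of_injective (hJ.rowMap_injective hb)

lemma Feasible.eq_zero_of_kernel {W : Type*} [AddCommGroup W] [Module ℝ W]
    (hb : LinearIndependent ℝ b) (hJ : Feasible B b J) (hcard : J.card = Fintype.card ι)
    {w : κ → W} (hw : ∀ j ∉ J, w j = 0) (hBw : ∀ i, ∑ j, B i j • w j = 0) : w = 0 := by
  have hsurj : Function.Surjective (rowMap B J) :=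
    (LinearMap.injective_iff_surjective_of_finrank_eq_finrank (by simp [hcard])).1
      (hJ.rowMap_injective hb)
  ext k
  by_cases hk : k ∈ J
  · obtain ⟨y, hy⟩ := hsurj (Pi.single ⟨k, hk⟩ 1)
    have h := sum_smul_sum_smul B y w
    simp_rw [hBw] at h
    rw [Finset.sum_eq_single k] at h
    · have : ∑ i, y i * B i k = 1 := (congrFun hy ⟨k, hk⟩).trans (by simp)
      simpa [this] using h.symm
    · intro j _ hjk
      by_cases hj : j ∈ J
      · have : ∑ i, y i * B i j = 0 :=
          (congrFun hy ⟨j, hj⟩).trans (by simp [hjk])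
        rw [this, zero_smul]
      · rw [hw j hj, smul_zero]
    · simp
  · exact hw k hk

lemma IsSolution.ne_zero (hb : LinearIndependent ℝ b) (hcard : J.card = Fintype.card ι)
    {α : κ → V} (hα : IsSolution B b J α) {j : κ} (hj : j ∈ J) : α j ≠ 0 := by
  intro h0
  have : Feasible B b (J.erase j) := by
    refine ⟨α, hα.nonneg, fun k hk => ?_, hα.eq⟩
    by_cases hkj : k = j
    · rw [hkj, h0]
    · exact hα.support k fun h => hk (Finset.mem_erase.2 ⟨hkj, h⟩)
  have h1 := this.card_le hb
  have h2 := Finset.card_erase_lt_of_mem hj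
  omega

lemma exists_kernel_vector (B : Matrix ι κ ℝ) (hS : S.card = Fintype.card ι + 1) :
    ∃ z : κ → ℝ, z ≠ 0 ∧ (∀ j ∉ S, z j = 0) ∧ ∀ i, ∑ j, B i j • z j = 0 := by
  let f : (S → ℝ) →ₗ[ℝ] (ι → ℝ) := Matrix.mulVecLin (B.submatrix id (fun j : S => (j : κ)))
  obtain ⟨g, hg, hg0⟩ := (Submodule.ne_bot_iff _).1
    (LinearMap.ker_ne_bot_of_finrank_lt (f := f) (by simp [hS]))
  refine ⟨fun j => if h : j ∈ S then g ⟨j, h⟩ else 0, fun h => hg0 ?_, fun j hj => by simp [hj],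
    fun i => ?_⟩
  · ext ⟨j, hj⟩
    simpa [hj] using congrFun h j
  · have := congrFun (LinearMap.mem_ker.1 hg) i
    simp only [f, Matrix.mulVecLin_apply, Matrix.mulVec, dotProduct, Matrix.submatrix_apply,
      id] at this
    rw [← Finset.sum_subset (Finset.subset_univ S), ← Finset.sum_attach]
    · simpa using this
    · intro j _ hj
      simp [hj]

lemma Feasible.kernel_ne_zero (hb : LinearIndependent ℝ b) (hS : S.card = Fintype.card ι + 1)
    {z : κ → ℝ} (hz : z ≠ 0) (hzS : ∀ j ∉ S, z j = 0) (hBz : ∀ i, ∑ j, B i j • z j = 0)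
    {s : κ} (hs : s ∈ S) (h : Feasible B b (S.erase s)) : z s ≠ 0 := by
  intro h0
  refine hz (h.eq_zero_of_kernel hb (by simp [Finset.card_erase_of_mem hs, hS]) ?_ hBz)
  intro j hj
  by_cases hjs : j = s
  · rw [hjs, h0]
  · exact hzS j fun h => hj (Finset.mem_erase.2 ⟨hjs, h⟩)

variable [IsOrderedAddMonoid V] [PosSMulMono ℝ V]

/-- At most one feasible facet of `S` misses an element at which the kernel vector is positive. -/
lemma Feasible.eq_of_kernel_pos (hb : LinearIndependent ℝ b)
    (hS : S.card = Fintype.card ι + 1)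
    {z : κ → ℝ} (hzS : ∀ j ∉ S, z j = 0) (hBz : ∀ i, ∑ j, B i j • z j = 0)
    {s t : κ} (hs : s ∈ S) (ht : t ∈ S) (hfs : Feasible B b (S.erase s))
    (hft : Feasible B b (S.erase t)) (hzs : 0 < z s) (hzt : 0 < z t) : s = t := by
  have hcs : (S.erase s).card = Fintype.card ι := by simp [Finset.card_erase_of_mem hs, hS]
  obtain ⟨α, hα⟩ := id hfs
  obtain ⟨β, hβ⟩ := hft
  have hαs : α s = 0 := hα.support s (by simp)
  have hβt : β t = 0 := hβ.support t (by simp)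
  set v : V := (z s)⁻¹ • β s with hv
  have key : (fun j => β j - α j - z j • v) = 0 := by
    refine hfs.eq_zero_of_kernel hb hcs (fun j hj => ?_) fun i => ?_
    · by_cases hjs : j = s
      · rw [hjs, hαs, hv, smul_smul, mul_inv_cancel₀ hzs.ne', one_smul, sub_zero, sub_self]
      · have hjS : j ∉ S := fun h => hj (Finset.mem_erase.2 ⟨hjs, h⟩)
        rw [hα.support j hj, hβ.support j (fun h => hjS (Finset.mem_of_mem_erase h)), hzS j hjS]
        simp
    · have : ∑ j, B i j • z j • v = 0 := by
        simp_rw [← smul_assoc, ← Finset.sum_smul, hBz, zero_smul]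
      simp_rw [smul_sub, Finset.sum_sub_distrib, hα.eq, hβ.eq, this]
      simp
  have hkey : ∀ j, β j = α j + z j • v := fun j => by
    have := congrFun key j
    simp only [Pi.zero_apply, sub_sub, sub_eq_zero] at this
    exact this
  have hv0 : 0 ≤ v := smul_nonneg (inv_nonneg.2 hzs.le) (hβ.nonneg s)
  by_contra hst
  have hαt : α t ≠ 0 := hα.ne_zero hb hcs (Finset.mem_erase.2 ⟨Ne.symm hst, ht⟩)
  have h := hkey t
  rw [hβt] at h
  exact (add_pos_of_pos_of_nonneg (lt_of_le_of_ne (hα.nonneg t) hαt.symm)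
    (smul_nonneg hzt.le hv0)).ne h

open Classical in
/-- A set with one more element than `B` has rows has an even number of feasible facets. -/
lemma even_card_feasible_erase (hb : LinearIndependent ℝ b)
    (hB : ∀ z : κ → ℝ, (∀ j, 0 ≤ z j) → (∀ i, ∑ j, B i j • z j = 0) → z = 0)
    (hS : S.card = Fintype.card ι + 1) :
    Even (S.filter fun s => Feasible B b (S.erase s)).card := by
  obtain ⟨z, hz, hzS, hBz⟩ := exists_kernel_vector B hS
  have hzS' : ∀ j ∉ S, (-z) j = 0 := fun j hj => by simp [hzS j hj]
  have hBz' : ∀ i, ∑ j, B i j • (-z) j = 0 := fun i => by simpa using hBz i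
  have hneg : ∃ j, z j < 0 := by
    by_contra! h
    exact hz (hB z h hBz)
  have hpos : ∃ j, (-z) j < 0 := by
    by_contra! h
    exact hz (neg_eq_zero.1 (hB (-z) h hBz'))
  rcases (S.filter fun s => Feasible B b (S.erase s)).eq_empty_or_nonempty with h | ⟨s, hs⟩
  · simp [h]
  · have hfS : Feasible B b S := (Finset.mem_filter.1 hs).2.mono (Finset.erase_subset _ _)
    obtain ⟨t, ht, hzt, hft⟩ := hfS.pivot hzS hBz hneg
    obtain ⟨u, hu, hzu, hfu⟩ := hfS.pivot hzS' hBz' hpos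
    have htu : t ≠ u := by
      rintro rfl
      simp only [Pi.neg_apply] at hzu
      linarith
    have : (S.filter fun s => Feasible B b (S.erase s)) = {t, u} := by
      ext r
      simp only [Finset.mem_filter, Finset.mem_insert, Finset.mem_singleton]
      constructor
      · rintro ⟨hr, hfr⟩
        rcases lt_or_gt_of_ne (hfr.kernel_ne_zero hb hS hz hzS hBz hr) with h | h
        · exact Or.inl (hfr.eq_of_kernel_pos hb hS hzS' hBz' hr ht hft (by simpa using h)
            (by simpa using hzt))
        · exact Or.inr (hfr.eq_of_kernel_pos hb hS hzS hBz hr hu hfu h (by simpa using hzu))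
      · rintro (rfl | rfl)
        exacts [⟨ht, hft⟩, ⟨hu, hfu⟩]
    rw [this, Finset.card_pair htu]
    exact even_two

end Feasible

section Dominating

variable {ι κ L : Type*} [LinearOrder L]

/-- No column `k` exceeds, in every row `i`, all the entries of `c i` on `D`. -/
def Dominating (c : ι → κ → L) (D : Finset κ) : Prop :=
  ∀ k, ∃ i, ∀ j ∈ D, c i k ≤ c i j

/-- `d` maximises `c i` among the columns that beat `v` in all rows other than `i`. -/
def IsTop (c : ι → κ → L) (v : ι → κ) (i : ι) (d : κ) : Prop :=
  (∀ l ≠ i, c l (v l) < c l d) ∧ ∀ k, (∀ l ≠ i, c l (v l) < c l k) → c i k ≤ c i d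

variable {c : ι → κ → L} {v : ι → κ} {R : Finset κ}

lemma IsTop.eq (hc : ∀ i, Function.Injective (c i)) {i : ι} {d d' : κ}
    (h : IsTop c v i d) (h' : IsTop c v i d') : d = d' :=
  hc i ((h'.2 d h.1).antisymm (h.2 d' h'.1))

lemma exists_isTop [Finite κ] {i : ι} {k : κ} (hk : ∀ l ≠ i, c l (v l) < c l k) :
    ∃ d, IsTop c v i d :=
  Set.exists_max_image {k | ∀ l ≠ i, c l (v l) < c l k} (c i) (Set.toFinite _) ⟨k, hk⟩

lemma IsTop.not_isTop (hvR : ∀ i, v i ∈ R) (hdom : Dominating c R) {i i' : ι} (h : i' ≠ i)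
    {d : κ} (hd : IsTop c v i d) : ¬ IsTop c v i' d := fun hd' => by
  obtain ⟨l, hl⟩ := hdom d
  refine (hl _ (hvR l)).not_gt ?_
  by_cases hli : l = i
  · exact hd'.1 l fun h' => h (h' ▸ hli)
  · exact hd.1 l hli

variable [Fintype ι] [DecidableEq ι]

lemma surjOn_of_injOn_ne (hR : R.card + 1 = Fintype.card ι) (hvR : ∀ i, v i ∈ R)
    {i : ι} (hinj : Set.InjOn v {i}ᶜ) {r : κ} (hr : r ∈ R) : ∃ l ≠ i, v l = r := by
  have := Finset.surjOn_of_injOn_of_card_le (s := {i}ᶜ) (t := R) v (fun l _ => hvR l)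
    (by simpa using hinj) (by rw [Finset.card_compl, Finset.card_singleton]; omega)
  obtain ⟨l, hl, rfl⟩ := this hr
  exact ⟨l, by simpa using hl, rfl⟩

variable [DecidableEq κ]

lemma isTop_of_dominating_insert (hc : ∀ i, Function.Injective (c i))
    (hR : R.card + 1 = Fintype.card ι) (hvR : ∀ i, v i ∈ R)
    (hv : ∀ i, ∀ r ∈ R, c i (v i) ≤ c i r) {d : κ} (hd : d ∉ R)
    (hD : Dominating c (insert d R)) : ∃ i, Set.InjOn v {i}ᶜ ∧ IsTop c v i d := by
  choose u huD hu using fun i => Finset.exists_min_image (insert d R) (c i) ⟨d, by simp⟩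
  have hsurj : ∀ k ∈ insert d R, ∃ i, u i = k := fun k hk => by
    obtain ⟨i, hi⟩ := hD k
    exact ⟨i, hc i ((hu i k hk).antisymm (hi _ (huD i)))⟩
  have hinj : Function.Injective u := by
    have := Finset.injOn_of_surjOn_of_card_le (s := Finset.univ) (t := insert d R) u
      (fun i _ => huD i) (fun k hk => by simpa using hsurj k hk)
      (by rw [Finset.card_insert_of_notMem hd, hR, Finset.card_univ])
    simpa [Set.injOn_univ] using this
  obtain ⟨i, hi⟩ := hsurj d (by simp)
  have huv : ∀ l ≠ i, u l = v l := fun l hl => by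
    have hl' : u l ∈ R := (Finset.mem_insert.1 (huD l)).resolve_left fun h =>
      hl (hinj (h.trans hi.symm))
    exact hc l ((hu l _ (Finset.mem_insert_of_mem (hvR l))).antisymm (hv l _ hl'))
  refine ⟨i, fun l hl l' hl' h => hinj ?_, fun l hl => ?_, fun k hk => ?_⟩
  · rwa [huv l hl, huv l' hl']
  · rw [← huv l hl]
    exact lt_of_le_of_ne (hu l d (by simp)) fun h => hl (hinj ((hc l h).trans hi.symm))
  · obtain ⟨l, hl⟩ := hD k
    by_cases hli : l = i
    · exact hli ▸ hl d (by simp)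
    · exact absurd (hl _ (Finset.mem_insert_of_mem (hvR l))) (hk l hli).not_ge

lemma IsTop.dominating_insert (hR : R.card + 1 = Fintype.card ι) (hvR : ∀ i, v i ∈ R)
    (hv : ∀ i, ∀ r ∈ R, c i (v i) ≤ c i r) (hdom : Dominating c R)
    {i : ι} (hinj : Set.InjOn v {i}ᶜ) {d : κ} (hd : IsTop c v i d) :
    d ∉ R ∧ Dominating c (insert d R) := by
  refine ⟨fun h => ?_, fun k => ?_⟩
  · obtain ⟨l, hl, rfl⟩ := surjOn_of_injOn_ne hR hvR hinj h
    exact (hd.1 l hl).false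
  · by_cases hk : ∀ l ≠ i, c l (v l) < c l k
    · refine ⟨i, fun j hj => (hd.2 k hk).trans ?_⟩
      rcases Finset.mem_insert.1 hj with rfl | hj
      · rfl
      · obtain ⟨l, hl⟩ := hdom d
        by_cases hli : l = i
        · exact hli ▸ hl j hj
        · exact absurd (hl _ (hvR l)) (hd.1 l hli).not_ge
    · push Not at hk
      obtain ⟨l, hl, hlk⟩ := hk
      refine ⟨l, fun j hj => hlk.trans ?_⟩
      rcases Finset.mem_insert.1 hj with rfl | hj
      · exact (hd.1 l hl).le
      · exact hv l j hj

/-- If `v` identifies exactly the rows `i₀ ≠ i₁`, then the columns completing `R` to a dominating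
set are the top columns of these two rows. -/
lemma dominating_insert_iff (hc : ∀ i, Function.Injective (c i))
    (hR : R.card + 1 = Fintype.card ι) (hvR : ∀ i, v i ∈ R)
    (hv : ∀ i, ∀ r ∈ R, c i (v i) ≤ c i r) (hdom : Dominating c R)
    {i₀ i₁ : ι} (h₀₁ : i₁ ≠ i₀) (hv₀₁ : v i₁ = v i₀) (hinj : Set.InjOn v {i₀}ᶜ) (d : κ) :
    d ∉ R ∧ Dominating c (insert d R) ↔ IsTop c v i₀ d ∨ IsTop c v i₁ d := by
  have hinj₁ : Set.InjOn v {i₁}ᶜ := by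
    intro l hl l' hl' h
    by_cases h0 : l = i₀ <;> by_cases h0' : l' = i₀
    · rw [h0, h0']
    · exact absurd (hinj h0' h₀₁ (by rw [← h, h0, hv₀₁])) hl'
    · exact absurd (hinj h0 h₀₁ (by rw [h, h0', hv₀₁])) hl
    · exact hinj h0 h0' h
  constructor
  · rintro ⟨hd, hD⟩
    obtain ⟨i, hi, htop⟩ := isTop_of_dominating_insert hc hR hvR hv hd hD
    by_cases h0 : i = i₀
    · exact Or.inl (h0 ▸ htop)
    by_cases h1 : i = i₁
    · exact Or.inr (h1 ▸ htop)
    exact absurd (hi (Ne.symm h1) (Ne.symm h0) hv₀₁) h₀₁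
  · rintro (h | h)
    exacts [h.dominating_insert hR hvR hv hdom hinj, h.dominating_insert hR hvR hv hdom hinj₁]

variable [Fintype κ] {e : ι → κ}

open Classical in
lemma even_card_dominating_insert (hc : ∀ i, Function.Injective (c i))
    (hce : ∀ i j k, i ≠ j → k ∉ Set.range e → c i (e i) < c i k ∧ c i k < c i (e j))
    (hR : R.card + 1 = Fintype.card ι) (hRe : ¬ (R : Set κ) ⊆ Set.range e) :
    Even (Finset.univ.filter fun d => d ∉ R ∧ Dominating c (insert d R)).card := by
  obtain ⟨r, hr, hre⟩ := Set.not_subset.1 hRe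
  choose v hvR hv using fun i => Finset.exists_min_image R (c i) ⟨r, hr⟩
  rcases (Finset.univ.filter fun d => d ∉ R ∧ Dominating c (insert d R)).eq_empty_or_nonempty
    with h | ⟨d, hd⟩
  · simp [h]
  obtain ⟨hd, hD⟩ := (Finset.mem_filter.1 hd).2
  have hdom : Dominating c R := fun k =>
    (hD k).imp fun i hi j hj => hi j (Finset.mem_insert_of_mem hj)
  obtain ⟨i₀, hinj, -⟩ := isTop_of_dominating_insert hc hR hvR hv hd hD
  obtain ⟨i₁, h₀₁, hv₀₁⟩ := surjOn_of_injOn_ne hR hvR hinj (hvR i₀)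
  have htop : ∀ i, ∃ d, IsTop c v i d := fun i =>
    exists_isTop (k := e i) fun l hl => (hv l r hr).trans_lt (hce l i r hl hre).2
  obtain ⟨d₀, hd₀⟩ := htop i₀
  obtain ⟨d₁, hd₁⟩ := htop i₁
  have hne : d₀ ≠ d₁ := fun h => hd₀.not_isTop hvR hdom h₀₁ (h ▸ hd₁)
  have : (Finset.univ.filter fun d => d ∉ R ∧ Dominating c (insert d R)) = {d₀, d₁} := by
    ext d
    rw [Finset.mem_filter, dominating_insert_iff hc hR hvR hv hdom h₀₁ hv₀₁ hinj]
    simp only [Finset.mem_univ, true_and, Finset.mem_insert, Finset.mem_singleton]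
    constructor
    · exact Or.imp (fun h => h.eq hc hd₀) fun h => h.eq hc hd₁
    · rintro (rfl | rfl)
      exacts [Or.inl hd₀, Or.inr hd₁]
  rw [this, Finset.card_pair hne]
  exact even_two

open Classical in
lemma card_dominating_insert_image (hc : ∀ i, Function.Injective (c i))
    (he : Function.Injective e)
    (hce : ∀ i j k, i ≠ j → k ∉ Set.range e → c i (e i) < c i k ∧ c i k < c i (e j))
    (hcard : Fintype.card ι < Fintype.card κ) (a : ι) :
    (Finset.univ.filter fun d => d ∉ ({a}ᶜ : Finset ι).image e ∧
      Dominating c (insert d (({a}ᶜ : Finset ι).image e))).card = 1 := by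
  obtain ⟨k₀, hk₀⟩ : ∃ k, k ∉ Set.range e := by
    by_contra! h
    exact hcard.not_ge (Fintype.card_le_of_surjective e h)
  have hlow : ∀ i j, i ≠ j → c i (e i) < c i (e j) := fun i j hij =>
    (hce i j k₀ hij hk₀).1.trans (hce i j k₀ hij hk₀).2
  set R := ({a}ᶜ : Finset ι).image e with hRdef
  have hmem : ∀ i, e i ∈ R ↔ i ≠ a := fun i => by simp [hRdef, he.eq_iff]
  have hR : R.card + 1 = Fintype.card ι := by
    rw [hRdef, Finset.card_image_of_injective _ he, Finset.card_compl, Finset.card_singleton]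
    exact Nat.sub_add_cancel (Fintype.card_pos_iff.2 ⟨a⟩)
  by_cases hsub : ∀ i, i = a
  · -- a single row: the only dominating set is the maximum of that row
    have hRe : R = ∅ := by
      ext k
      simp [hRdef, hsub]
    obtain ⟨d, -, hd⟩ := Finset.exists_max_image Finset.univ (c a) ⟨k₀, Finset.mem_univ _⟩
    refine Finset.card_eq_one.2 ⟨d, ?_⟩
    ext d'
    simp only [hRe, Finset.mem_filter, Finset.mem_univ, true_and, Finset.notMem_empty,
      not_false_eq_true, Finset.mem_singleton, Dominating, insert_empty_eq, forall_eq]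
    constructor
    · intro h
      obtain ⟨i, hi⟩ := h d
      rw [hsub i] at hi
      exact hc a ((hd d' (Finset.mem_univ _)).antisymm hi)
    · rintro rfl k
      exact ⟨a, hd k (Finset.mem_univ _)⟩
  push Not at hsub
  obtain ⟨a', ha'⟩ := hsub
  choose v hvR hv using fun i =>
    Finset.exists_min_image R (c i) ⟨e a', (hmem a').2 ha'⟩
  have hve : ∀ i ≠ a, v i = e i := fun i hi => by
    obtain ⟨j, -, hj⟩ := Finset.mem_image.1 (hvR i)
    by_contra h
    have hij : i ≠ j := fun hij => h (hij ▸ hj.symm)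
    exact (hv i _ ((hmem i).2 hi)).not_gt (hj ▸ hlow i j hij)
  obtain ⟨i₁, hi₁, hvi₁⟩ : ∃ i, i ≠ a ∧ e i = v a := by
    obtain ⟨j, hj, hj'⟩ := Finset.mem_image.1 (hvR a)
    exact ⟨j, by simpa using hj, hj'⟩
  have hinj : Set.InjOn v {a}ᶜ := fun i hi j hj h => he (by rwa [hve i hi, hve j hj] at h)
  -- a column beating `v` in row `a` is `e i` for some `i ≠ a`, `i ≠ i₁`
  have hbeat : ∀ k, c a (v a) < c a k → ∃ i, i ≠ a ∧ i ≠ i₁ ∧ e i = k := by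
    intro k hk
    rw [← hvi₁] at hk
    by_cases hke : k ∈ Set.range e
    · obtain ⟨i, rfl⟩ := hke
      refine ⟨i, ?_, ?_, rfl⟩
      · rintro rfl
        exact hk.not_gt (hlow i i₁ hi₁.symm)
      · rintro rfl
        exact hk.false
    · exact absurd hk (hce a i₁ k hi₁.symm hke).2.not_gt
  have hdom : Dominating c R := by
    intro k
    by_cases hk : c a (v a) < c a k
    · obtain ⟨i, hia, -, rfl⟩ := hbeat k hk
      exact ⟨i, fun j hj => hve i hia ▸ hv i j hj⟩
    · exact ⟨a, fun j hj => (not_lt.1 hk).trans (hv a j hj)⟩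
  obtain ⟨d, hd⟩ : ∃ d, IsTop c v a d := exists_isTop (k := k₀) fun l hl => by
    rw [hve l hl]
    exact (hce l a k₀ hl hk₀).1
  have hnot : ∀ d, ¬ IsTop c v i₁ d := fun d h => by
    obtain ⟨i, hia, hi1, rfl⟩ := hbeat d (h.1 a hi₁.symm)
    have := h.1 i hi1
    rw [hve i hia] at this
    exact this.false
  refine Finset.card_eq_one.2 ⟨d, ?_⟩
  ext d'
  rw [Finset.mem_filter, dominating_insert_iff hc hR hvR hv hdom hi₁
    ((hve i₁ hi₁).trans hvi₁) hinj]
  simp only [Finset.mem_univ, true_and, Finset.mem_singleton, hnot, or_false]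
  exact ⟨fun h => h.eq hc hd, fun h => h ▸ hd⟩

end Dominating

section Parity

variable {ι κ L V : Type*} [Fintype ι] [Fintype κ] [DecidableEq ι] [DecidableEq κ]
  {e : ι → κ} {B : Matrix ι κ ℝ} {b : ι → V}

lemma isSolution_extend [AddCommGroup V] [Module ℝ V] [Preorder V] (he : Function.Injective e)
    (hBe : ∀ i j, B i (e j) = if i = j then 1 else 0) (hb : ∀ i, 0 ≤ b i) :
    IsSolution B b (Finset.univ.image e) (Function.extend e b 0) where
  nonneg k := by
    by_cases hk : ∃ i, e i = k
    · obtain ⟨i, rfl⟩ := hk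
      rw [he.extend_apply]
      exact hb i
    · rw [Function.extend_apply' _ _ _ hk, Pi.zero_apply]
  support k hk := Function.extend_apply' _ _ _ (by simpa using hk)
  eq i := by
    rw [← Fintype.sum_of_injective e he (fun j => B i (e j) • b j) _
      (fun k hk => by rw [Function.extend_apply' _ _ _ hk, Pi.zero_apply, smul_zero])
      fun j => by rw [he.extend_apply]]
    simp [hBe]

variable [LinearOrder L] [AddCommGroup V] [Module ℝ V] [LinearOrder V] [IsOrderedAddMonoid V]
  [PosSMulMono ℝ V] {c : ι → κ → L}

open Classical in
/-- Scarf's lemma for a non-degenerate system `B α = b` and injective rows of `c`. -/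
theorem exists_feasible_dominating [Nonempty ι] (he : Function.Injective e)
    (hcard : Fintype.card ι < Fintype.card κ)
    (hBe : ∀ i j, B i (e j) = if i = j then 1 else 0)
    (hb : ∀ i, 0 ≤ b i) (hbi : LinearIndependent ℝ b)
    (hB : ∀ z : κ → ℝ, (∀ j, 0 ≤ z j) → (∀ i, ∑ j, B i j • z j = 0) → z = 0)
    (hc : ∀ i, Function.Injective (c i))
    (hce : ∀ i j k, i ≠ j → k ∉ Set.range e → c i (e i) < c i k ∧ c i k < c i (e j)) :
    ∃ J : Finset κ, J.card = Fintype.card ι ∧ Feasible B b J ∧ Dominating c J := by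
  by_contra! hno
  obtain ⟨a⟩ := ‹Nonempty ι›
  set x := e a with hx
  set 𝓐 : Finset (Finset κ) :=
    Finset.univ.filter fun F => F.card = Fintype.card ι ∧ Feasible B b F ∧ x ∈ F with h𝓐
  set 𝓑 : Finset (Finset κ) :=
    Finset.univ.filter fun D => D.card = Fintype.card ι ∧ Dominating c D ∧ x ∉ D with h𝓑
  have hcount := Finset.sum_card_bipartiteAbove_eq_sum_card_bipartiteBelow
    (s := 𝓐) (t := 𝓑) (fun F D => F.erase x ⊆ D)
  have hbelow : ∀ D ∈ 𝓑, Even (𝓐.bipartiteBelow (fun F D => F.erase x ⊆ D) D).card := by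
    intro D hD
    obtain ⟨hDcard, hDdom, hxD⟩ := (Finset.mem_filter.1 hD).2
    have hS : (insert x D).card = Fintype.card ι + 1 := by
      rw [Finset.card_insert_of_notMem hxD, hDcard]
    convert even_card_feasible_erase hbi hB hS using 1
    symm
    refine Finset.card_bij (fun s _ => (insert x D).erase s) (fun s hs => ?_) (fun s hs t ht h => ?_)
      fun F hF => ?_
    · obtain ⟨hs, hf⟩ := Finset.mem_filter.1 hs
      have hcs : ((insert x D).erase s).card = Fintype.card ι := by
        rw [Finset.card_erase_of_mem hs, hS, Nat.add_sub_cancel]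
      simp only [Finset.mem_bipartiteBelow, h𝓐, Finset.mem_filter, Finset.mem_univ, true_and]
      refine ⟨⟨hcs, hf, ?_⟩, Finset.subset_insert_iff.1 (Finset.erase_subset _ _)⟩
      refine Finset.mem_erase.2 ⟨?_, Finset.mem_insert_self _ _⟩
      rintro rfl
      rw [Finset.erase_insert hxD] at hf
      exact hno D hDcard hf hDdom
    · exact Finset.erase_injOn _ (Finset.mem_filter.1 hs).1 (Finset.mem_filter.1 ht).1 h
    · simp only [Finset.mem_bipartiteBelow, h𝓐, Finset.mem_filter, Finset.mem_univ,
        true_and] at hF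
      obtain ⟨⟨hFc, hFf, -⟩, hFD⟩ := hF
      obtain ⟨s, hs, hsF⟩ := Finset.exists_eq_insert_iff.2
        ⟨Finset.subset_insert_iff.2 hFD, by rw [hFc, hS]⟩
      have : (insert x D).erase s = F := by rw [← hsF, Finset.erase_insert hs]
      refine ⟨s, Finset.mem_filter.2 ⟨hsF ▸ Finset.mem_insert_self _ _, this ▸ hFf⟩, this⟩
  have habove : ∀ F ∈ 𝓐, (𝓑.bipartiteAbove (fun F D => F.erase x ⊆ D) F).card =
      (Finset.univ.filter fun d => d ∉ F.erase x ∧ Dominating c (insert d (F.erase x))).card := by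
    intro F hF
    obtain ⟨hFc, hFf, hxF⟩ := (Finset.mem_filter.1 hF).2
    have hR : (F.erase x).card + 1 = Fintype.card ι := by rw [Finset.card_erase_add_one hxF, hFc]
    symm
    refine Finset.card_bij (fun d _ => insert d (F.erase x)) (fun d hd => ?_)
      (fun d hd d' hd' h => ?_) fun D hD => ?_
    · obtain ⟨hd, hdom⟩ := (Finset.mem_filter.1 hd).2
      simp only [Finset.mem_bipartiteAbove, h𝓑, Finset.mem_filter, Finset.mem_univ, true_and]
      refine ⟨⟨by rw [Finset.card_insert_of_notMem hd, hR], hdom, fun hxd => ?_⟩,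
        Finset.subset_insert _ _⟩
      have hdx : x = d := (Finset.mem_insert.1 hxd).resolve_right (by simp)
      rw [← hdx, Finset.insert_erase hxF] at hdom
      exact hno F hFc hFf hdom
    · exact (Finset.insert_inj (Finset.mem_filter.1 hd).2.1).1 h
    · simp only [Finset.mem_bipartiteAbove, h𝓑, Finset.mem_filter, Finset.mem_univ,
        true_and] at hD
      obtain ⟨⟨hDc, hDdom, -⟩, hFD⟩ := hD
      obtain ⟨d, hd, hdD⟩ := Finset.exists_eq_insert_iff.2 ⟨hFD, by rw [hR, hDc]⟩
      exact ⟨d, Finset.mem_filter.2 ⟨Finset.mem_univ _, hd, hdD ▸ hDdom⟩, hdD⟩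
  have hF₀ : Finset.univ.image e ∈ 𝓐 := Finset.mem_filter.2 ⟨Finset.mem_univ _,
    by rw [Finset.card_image_of_injective _ he, Finset.card_univ],
    ⟨_, isSolution_extend he hBe hb⟩, Finset.mem_image_of_mem _ (Finset.mem_univ _)⟩
  rw [← Finset.add_sum_erase _ _ hF₀, habove _ hF₀] at hcount
  have hF₀e : (Finset.univ.image e).erase x = ({a}ᶜ : Finset ι).image e := by
    ext k
    simp only [Finset.mem_erase, Finset.mem_image, Finset.mem_univ, true_and, Finset.mem_compl,
      Finset.mem_singleton]
    constructor
    · rintro ⟨hk, i, rfl⟩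
      exact ⟨i, fun h => hk (by rw [h]), rfl⟩
    · rintro ⟨i, hi, rfl⟩
      exact ⟨fun h => hi (he h), i, rfl⟩
  rw [hF₀e, card_dominating_insert_image hc he hce hcard a] at hcount
  have heven : Even (∑ F ∈ 𝓐.erase (Finset.univ.image e),
      (𝓑.bipartiteAbove (fun F D => F.erase x ⊆ D) F).card) := by
    refine Finset.even_sum _ fun F hF => ?_
    obtain ⟨hne, hF⟩ := Finset.mem_erase.1 hF
    obtain ⟨hFc, hFf, hxF⟩ := (Finset.mem_filter.1 hF).2
    rw [habove F hF]
    refine even_card_dominating_insert hc hce (by rw [Finset.card_erase_add_one hxF, hFc])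
      fun hsub => hne ?_
    refine Finset.eq_of_subset_of_card_le (fun k hk => ?_) ?_
    · by_cases hkx : k = x
      · simp [hkx, hx]
      · simpa using hsub (Finset.mem_coe.2 (Finset.mem_erase.2 ⟨hkx, hk⟩))
    · rw [Finset.card_image_of_injective _ he, Finset.card_univ, hFc]
  have hodd := heven.one_add
  rw [hcount] at hodd
  exact Nat.not_even_iff_odd.2 hodd (Finset.even_sum _ hbelow)

end Parity

section Perturbation

instance posSMulMono_lex (k : ℕ) : PosSMulMono ℝ (Lex (Fin k → ℝ)) where
  smul_le_smul_of_nonneg_left r hr v w hvw := by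
    rcases hr.eq_or_lt with rfl | hr
    · simp
    rcases hvw.eq_or_lt with rfl | ⟨i, hi, hlt⟩
    · rfl
    · exact le_of_lt ⟨i, fun j hj => congrArg (r * ·) (hi j hj), mul_lt_mul_of_pos_left hlt hr⟩

/-- The perturbation of `b` by infinitesimals of decreasing orders of magnitude. -/
def perturb {m : ℕ} (b : Fin m → ℝ) (i : Fin m) : Lex (Fin (m + 1) → ℝ) :=
  toLex (Fin.cons (b i) (Pi.single i 1))

lemma perturb_nonneg {m : ℕ} {b : Fin m → ℝ} (hb : ∀ i, 0 ≤ b i) (i : Fin m) :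
    0 ≤ perturb b i := by
  refine Pi.toLex_monotone (a := (0 : Fin (m + 1) → ℝ)) fun j => ?_
  refine Fin.cases (hb i) (fun j => ?_) j
  have : (0 : Fin m → ℝ) ≤ Pi.single i 1 := Pi.single_nonneg.2 zero_le_one
  exact this j

/-- A coordinate of a lexicographic power of `ℝ`, as a linear map. -/
def lexProj {k : ℕ} (i : Fin k) : Lex (Fin k → ℝ) →ₗ[ℝ] ℝ where
  toFun v := ofLex v i
  map_add' _ _ := rfl
  map_smul' _ _ := rfl

lemma lexProj_zero_nonneg {k : ℕ} {v : Lex (Fin (k + 1) → ℝ)} (hv : 0 ≤ v) :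
    0 ≤ lexProj 0 v := by
  by_contra! h
  exact hv.not_gt ⟨0, fun j hj => absurd hj (Fin.not_lt_zero j), h⟩

lemma linearIndependent_perturb {m : ℕ} (b : Fin m → ℝ) : LinearIndependent ℝ (perturb b) := by
  refine Fintype.linearIndependent_iff.2 fun g hg i => ?_
  have h := congrArg (lexProj i.succ) hg
  rw [map_sum, map_zero] at h
  simpa [lexProj, perturb, Pi.single_apply] using h

lemma eq_zero_of_isBounded {ι κ : Type*} [Fintype κ] {B : Matrix ι κ ℝ} {b : ι → ℝ}
    (hbdd : Bornology.IsBounded {α : κ → ℝ | (∀ j, 0 ≤ α j) ∧ B.mulVec α = b})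
    {α : κ → ℝ} (hα : ∀ j, 0 ≤ α j) (hBα : B.mulVec α = b)
    {z : κ → ℝ} (hz : ∀ j, 0 ≤ z j) (hBz : B.mulVec z = 0) : z = 0 := by
  obtain ⟨K, hK⟩ := isBounded_iff_forall_norm_le.1 hbdd
  ext j
  by_contra hj
  have hzj : 0 < z j := lt_of_le_of_ne (hz j) (Ne.symm hj)
  have hK0 : 0 ≤ K := (norm_nonneg α).trans (hK α ⟨hα, hBα⟩)
  have ht : 0 ≤ (K + 1) / z j := by positivity
  have h := hK (α + ((K + 1) / z j) • z) ⟨fun i => add_nonneg (hα i) (mul_nonneg ht (hz i)), by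
    rw [Matrix.mulVec_add, Matrix.mulVec_smul, hBz, smul_zero, add_zero, hBα]⟩
  have h' := (le_abs_self _).trans ((norm_le_pi_norm (α + ((K + 1) / z j) • z) j).trans h)
  simp only [Pi.add_apply, Pi.smul_apply, smul_eq_mul, div_mul_cancel₀ _ hzj.ne'] at h'
  linarith [hα j]

/-- The rows of `C`, with ties broken so that in row `i` the column `i` comes first, then the
columns `k ≥ m`, then the remaining columns. -/
def tieBreak {m n : ℕ} (C : Matrix (Fin m) (Fin n) ℝ) (i : Fin m) (k : Fin n) : ℝ ×ₗ ℕ ×ₗ ℕ :=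
  toLex (C i k, toLex (if (k : ℕ) = i then 0 else if m ≤ k then 1 else 2, (k : ℕ)))

lemma tieBreak_injective {m n : ℕ} (C : Matrix (Fin m) (Fin n) ℝ) (i : Fin m) :
    Function.Injective (tieBreak C i) := fun k l h => by
  have h2 := congrArg (fun p => (ofLex (ofLex p).2).2) h
  exact Fin.ext h2

lemma le_of_tieBreak_le {m n : ℕ} {C : Matrix (Fin m) (Fin n) ℝ} {i : Fin m} {k l : Fin n}
    (h : tieBreak C i k ≤ tieBreak C i l) : C i k ≤ C i l := by
  rcases Prod.Lex.le_iff.1 h with h | h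
  exacts [h.le, h.1.le]

lemma tieBreak_lt {m n : ℕ} {C : Matrix (Fin m) (Fin n) ℝ} {i : Fin m} {k l : Fin n}
    (h : C i k ≤ C i l)
    (h' : (if (k : ℕ) = i then 0 else if m ≤ k then 1 else 2) <
      if (l : ℕ) = i then 0 else if m ≤ l then 1 else 2) :
    tieBreak C i k < tieBreak C i l := by
  refine Prod.Lex.lt_iff.2 (h.lt_or_eq.imp_right fun h => ⟨h, Prod.Lex.lt_iff.2 (Or.inl h')⟩)

end Perturbation

end Scarf

/-- **Scarf's lemma.**  Let `m < n` be positive integers, let `B` be an `m × n` real matrix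
whose first `m` columns form the identity matrix, let `b` be a non-negative vector in `ℝ^m`
such that `{α ∈ ℝ₊ⁿ : Bα = b}` is bounded, and let `C` be an `m × n` real matrix with
`c_{ii} ≤ c_{ik} ≤ c_{ij}` whenever `i, j ≤ m`, `i ≠ j` and `k > m`.  Then there is a subset
`J ⊆ [n]` of size `m` such that (1) `Bα = b` for some `α ∈ ℝ₊ⁿ` supported on `J`, and
(2) for every column `k` there is a row `i` with `c_{ik} ≤ c_{ij}` for all `j ∈ J`. -/
theorem scarf_lemma {m n : ℕ} (hm : 0 < m) (hmn : m < n)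
    (B C : Matrix (Fin m) (Fin n) ℝ) (b : Fin m → ℝ)
    (hB : ∀ i j : Fin m, B i (Fin.castLE hmn.le j) = if i = j then 1 else 0)
    (hb : ∀ i, 0 ≤ b i)
    (hbdd : Bornology.IsBounded {α : Fin n → ℝ | (∀ j, 0 ≤ α j) ∧ B.mulVec α = b})
    (hC : ∀ (i j : Fin m) (k : Fin n), i ≠ j → m ≤ (k : ℕ) →
      C i (Fin.castLE hmn.le i) ≤ C i k ∧ C i k ≤ C i (Fin.castLE hmn.le j)) :
    ∃ J : Finset (Fin n), J.card = m ∧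
      (∃ α : Fin n → ℝ, (∀ j, 0 ≤ α j) ∧ (∀ j ∉ J, α j = 0) ∧ B.mulVec α = b) ∧
      (∀ k : Fin n, ∃ i : Fin m, ∀ j ∈ J, C i k ≤ C i j) := by
  have he : Function.Injective (Fin.castLE hmn.le : Fin m → Fin n) := Fin.castLE_injective _
  have : Nonempty (Fin m) := ⟨⟨0, hm⟩⟩
  have hsol : Scarf.IsSolution B b _ _ := Scarf.isSolution_extend he hB hb
  obtain ⟨J, hJ, ⟨α, hα⟩, hdom⟩ := Scarf.exists_feasible_dominating (e := Fin.castLE hmn.le)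
    (B := B) (b := Scarf.perturb b) (c := Scarf.tieBreak C) he (by simpa using hmn) hB
    (Scarf.perturb_nonneg hb) (Scarf.linearIndependent_perturb b)
    (fun z hz hBz => Scarf.eq_zero_of_isBounded hbdd hsol.nonneg (funext hsol.eq) hz (funext hBz))
    (Scarf.tieBreak_injective C) fun i j k hij hk => by
      have hk' : m ≤ (k : ℕ) := by
        by_contra! h
        exact hk ⟨⟨k, h⟩, rfl⟩
      have hji : (j : ℕ) ≠ i := fun h => hij (Fin.ext h.symm)
      have hki : (k : ℕ) ≠ i := by omega
      exact ⟨Scarf.tieBreak_lt (hC i j k hij hk').1 (by simp [hki, hk']),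
        Scarf.tieBreak_lt (hC i j k hij hk').2 (by simp [hki, hk', hji, j.2.not_ge])⟩
  refine ⟨J, by simpa using hJ, ⟨fun j => Scarf.lexProj 0 (α j),
    fun j => Scarf.lexProj_zero_nonneg (hα.nonneg j), fun j hj => ?_, funext fun i => ?_⟩,
    fun k => (hdom k).imp fun i hi j hj => Scarf.le_of_tieBreak_le (hi j hj)⟩
  · simp only [hα.support j hj, map_zero]
  · have h := congrArg (Scarf.lexProj 0) (hα.eq i)
    rw [map_sum] at h
    simp only [map_smul] at h
    exact h
end

section
/- Let m < n be positive integers, let B be an m × n real matrix such that b_{ij} = δ_{ij} for 1 ≤ i, j ≤ m, let b be a non-negative vector in ℝ^m such that the set {α ∈ ℝ₊ⁿ : Bα = b} is bounded, and let C be an m × n real matrix such that c_{ii} ≤ c_{ik} ≤ c_{ij} whenever i, j ≤ m, i ≠ j and k > m. Assume moreover that (B, b) is non-degenerate and that C is ordinal-generic. Then there exists a subset J of [n] of size m which is both a feasible basis of (B, b) and subordinating for C. -/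
/-- `J ⊆ [n]` of size `m` is a *feasible basis* of `(B, b)` if the columns `B_j`, `j ∈ J`,
are linearly independent and `b = ∑_{j ∈ J} α_j B_j` for some non-negative `α_j`. -/
def FeasibleBasis {m n : ℕ} (B : Matrix (Fin m) (Fin n) ℝ) (b : Fin m → ℝ)
    (J : Finset (Fin n)) : Prop :=
  J.card = m ∧
  LinearIndependent ℝ (fun j : J => (fun i => B i (j : Fin n))) ∧
  ∃ α : Fin n → ℝ, (∀ j, 0 ≤ α j) ∧ (∀ j ∉ J, α j = 0) ∧ B.mulVec α = b

/-- `(B, b)` is *non-degenerate* if `b` is not in the cone spanned by fewer than `m`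
columns of `B`. -/
def NonDegenerate {m n : ℕ} (B : Matrix (Fin m) (Fin n) ℝ) (b : Fin m → ℝ) : Prop :=
  ¬ ∃ J : Finset (Fin n), J.card < m ∧
      ∃ α : Fin n → ℝ, (∀ j, 0 ≤ α j) ∧ (∀ j ∉ J, α j = 0) ∧ B.mulVec α = b

/-- `J ⊆ [n]` is *subordinating* for `C` if every column `k` of `C` is `J`-subordinated,
i.e. for some row `i` we have `c_{ik} ≤ c_{ij}` for every `j ∈ J`. -/
def Subordinating {m n : ℕ} (C : Matrix (Fin m) (Fin n) ℝ) (J : Finset (Fin n)) : Prop :=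
  ∀ k : Fin n, ∃ i : Fin m, ∀ j ∈ J, C i k ≤ C i j

/-- `C` is *ordinal-generic* if all the elements in each row of `C` are distinct. -/
def OrdinalGeneric {m n : ℕ} (C : Matrix (Fin m) (Fin n) ℝ) : Prop :=
  ∀ i : Fin m, Function.Injective (C i)

/-- Moving from a non-negative vector along a direction with a negative entry, one reaches a last
non-negative vector, at which some decreasing entry vanishes. -/
lemma exists_nonneg_add_mul_eq_zero {ι : Type*} [Fintype ι] {x v : ι → ℝ} (hx : ∀ j, 0 ≤ x j)
    (hv : ∃ j, v j < 0) :
    ∃ t : ℝ, 0 ≤ t ∧ (∀ j, 0 ≤ x j + t * v j) ∧ ∃ j, v j < 0 ∧ x j + t * v j = 0 := by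
  classical
  obtain ⟨j₀, hj₀⟩ := hv
  obtain ⟨j, hj, hmin⟩ := (Finset.univ.filter fun j => v j < 0).exists_min_image
    (fun j => x j / -v j) ⟨j₀, by simp [hj₀]⟩
  simp only [Finset.mem_filter, Finset.mem_univ, true_and] at hj hmin
  have ht : 0 ≤ x j / -v j := div_nonneg (hx j) (by linarith)
  refine ⟨x j / -v j, ht, fun k => ?_, j, hj, ?_⟩
  · rcases lt_or_ge (v k) 0 with hk | hk
    · have := (le_div_iff₀ (neg_pos.2 hk)).1 (hmin k hk)
      linarith
    · have := mul_nonneg ht hk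
      linarith [hx k]
  · have : -v j ≠ 0 := by linarith
    have := div_mul_cancel₀ (x j) this
    linarith

section Feasible

variable {m n : ℕ} {B : Matrix (Fin m) (Fin n) ℝ} {b : Fin m → ℝ}

/-- `b` lies in the cone spanned by the columns `B_j`, `j ∈ J`. -/
def InCone (B : Matrix (Fin m) (Fin n) ℝ) (b : Fin m → ℝ) (J : Finset (Fin n)) : Prop :=
  ∃ α : Fin n → ℝ, (∀ j, 0 ≤ α j) ∧ (∀ j ∉ J, α j = 0) ∧ B.mulVec α = b

lemma mulVec_add_mul {x v : Fin n → ℝ} (hx : B.mulVec x = b) (hv : B.mulVec v = 0) (t : ℝ) :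
    B.mulVec (fun j => x j + t * v j) = b := by
  have : (fun j => x j + t * v j) = x + t • v := by ext; simp
  rw [this, Matrix.mulVec_add, Matrix.mulVec_smul, hx, hv, smul_zero, add_zero]

open Classical in
lemma mulVec_dite (J : Finset (Fin n)) (g : J → ℝ) :
    B.mulVec (fun k => if h : k ∈ J then g ⟨k, h⟩ else 0) =
      ∑ j, g j • fun i => B i (j : Fin n) := by
  ext i
  simp only [Finset.sum_apply, Pi.smul_apply, smul_eq_mul]
  rw [Matrix.mulVec, dotProduct, ← Finset.sum_subset J.subset_univ, ← Finset.sum_coe_sort]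
  · exact Finset.sum_congr rfl fun k _ => by simp [mul_comm]
  · intro k _ hk
    simp [hk]

lemma inCone_image {e : Fin m → Fin n} (he : Function.Injective e)
    (hB : ∀ i j, B i (e j) = if i = j then 1 else 0) (hb : ∀ i, 0 ≤ b i) :
    InCone B b (Finset.univ.image e) := by
  refine ⟨Function.extend e b 0, fun j => ?_, fun j hj => ?_, ?_⟩
  · by_cases h : ∃ i, e i = j
    · obtain ⟨i, rfl⟩ := h
      rw [he.extend_apply]
      exact hb i
    · rw [Function.extend_apply' _ _ _ h, Pi.zero_apply]
  · rw [Function.extend_apply' _ _ _ fun h => hj (by simpa using h), Pi.zero_apply]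
  · ext i
    rw [Matrix.mulVec, dotProduct, ← Finset.sum_subset (Finset.univ.image e).subset_univ,
      Finset.sum_image he.injOn]
    · simp [hB, he.extend_apply]
    · intro k _ hk
      rw [Function.extend_apply' _ _ _ fun h => hk (by simpa using h), Pi.zero_apply, mul_zero]

lemma NonDegenerate.le_card (hnd : NonDegenerate B b) {J : Finset (Fin n)} (hJ : InCone B b J) :
    m ≤ J.card :=
  not_lt.1 fun h => hnd ⟨J, h, hJ⟩

lemma NonDegenerate.pos (hnd : NonDegenerate B b) {J : Finset (Fin n)} (hJ : J.card = m)
    {x : Fin n → ℝ} (hx : ∀ j, 0 ≤ x j) (hxJ : ∀ j ∉ J, x j = 0) (hxb : B.mulVec x = b)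
    {j : Fin n} (hj : j ∈ J) : 0 < x j := by
  refine lt_of_le_of_ne (hx j) fun h => ?_
  have := hnd.le_card (J := J.erase j) ⟨x, hx, fun k hk => ?_, hxb⟩
  · have := Finset.card_erase_lt_of_mem hj
    omega
  · by_cases hkj : k = j
    · rw [hkj, h]
    · exact hxJ k fun hkJ => hk (Finset.mem_erase.2 ⟨hkj, hkJ⟩)

lemma NonDegenerate.eq_zero_of_mulVec_eq_zero (hnd : NonDegenerate B b) {J : Finset (Fin n)}
    (hJ : J.card = m) (hJb : InCone B b J) {v : Fin n → ℝ} (hvJ : ∀ j ∉ J, v j = 0)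
    (hv : B.mulVec v = 0) : v = 0 := by
  have nonneg : ∀ w : Fin n → ℝ, (∀ j ∉ J, w j = 0) → B.mulVec w = 0 → ∀ j, 0 ≤ w j := by
    intro w hwJ hw
    by_contra! hneg
    obtain ⟨x, hx, hxJ, hxb⟩ := hJb
    obtain ⟨t, -, hy, j, hj, hyj⟩ := exists_nonneg_add_mul_eq_zero hx hneg
    have hjJ : j ∈ J := by
      by_contra h
      exact hj.ne (hwJ j h)
    refine (hnd.pos hJ hy (fun k hk => ?_) (mulVec_add_mul hxb hw t) hjJ).ne' hyj
    rw [hxJ k hk, hwJ k hk, mul_zero, add_zero]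
  ext j
  have h₁ := nonneg v hvJ hv j
  have h₂ := nonneg (-v) (fun k hk => by simp [hvJ k hk]) (by simp [Matrix.mulVec_neg, hv]) j
  simp only [Pi.neg_apply, Pi.zero_apply] at *
  linarith

/-- In the non-degenerate case, `m` columns whose cone contains `b` form a feasible basis. -/
lemma NonDegenerate.feasibleBasis (hnd : NonDegenerate B b) {J : Finset (Fin n)}
    (hJ : J.card = m) (hJb : InCone B b J) : FeasibleBasis B b J := by
  classical
  refine ⟨hJ, Fintype.linearIndependent_iff.2 fun g hg j => ?_, hJb⟩
  have h := hnd.eq_zero_of_mulVec_eq_zero hJ hJb (v := fun k => if h : k ∈ J then g ⟨k, h⟩ else 0)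
    (fun k hk => by simp [hk]) ?_
  · simpa using congrFun h j
  · rw [mulVec_dite, hg]

lemma exists_neg_of_isBounded
    (hbdd : Bornology.IsBounded {α : Fin n → ℝ | (∀ j, 0 ≤ α j) ∧ B.mulVec α = b})
    {x v : Fin n → ℝ} (hx : ∀ j, 0 ≤ x j) (hxb : B.mulVec x = b) (hv : B.mulVec v = 0)
    (hv0 : v ≠ 0) : ∃ j, v j < 0 := by
  by_contra! hnn
  obtain ⟨j, hj⟩ := Function.ne_iff.1 hv0
  have hjpos : 0 < v j := lt_of_le_of_ne (hnn j) (Ne.symm hj)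
  obtain ⟨R, hR⟩ := isBounded_iff_forall_norm_le.1 hbdd
  set t := (|R| + 1) / v j with ht
  have ht0 : 0 ≤ t := by positivity
  have h := hR (fun k => x k + t * v k)
    ⟨fun k => add_nonneg (hx k) (mul_nonneg ht0 (hnn k)), mulVec_add_mul hxb hv t⟩
  have h' := (le_abs_self _).trans ((norm_le_pi_norm (fun k => x k + t * v k) j).trans h)
  have : t * v j = |R| + 1 := div_mul_cancel₀ _ hjpos.ne'
  linarith [le_abs_self R, hx j]

lemma exists_mulVec_eq_zero_of_lt_card {L : Finset (Fin n)} (hL : m < L.card) :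
    ∃ v : Fin n → ℝ, v ≠ 0 ∧ (∀ j ∉ L, v j = 0) ∧ B.mulVec v = 0 := by
  classical
  have hdep : ¬ LinearIndependent ℝ (fun j : L => fun i => B i (j : Fin n)) := by
    intro h
    have := h.fintype_card_le_finrank
    simp at this
    omega
  obtain ⟨g, hg, j, hj⟩ := Fintype.not_linearIndependent_iff.1 hdep
  refine ⟨fun k => if h : k ∈ L then g ⟨k, h⟩ else 0, fun h => hj ?_, fun k hk => by simp [hk], ?_⟩
  · simpa using congrFun h j
  · rw [mulVec_dite, hg]

open Classical in
/-- The pivoting step for feasible bases: among `m + 1` columns, an even number (zero or two) can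
be left out to obtain a feasible basis. -/
lemma NonDegenerate.even_card_filter_inCone_erase (hnd : NonDegenerate B b)
    (hbdd : Bornology.IsBounded {α : Fin n → ℝ | (∀ j, 0 ≤ α j) ∧ B.mulVec α = b})
    {L : Finset (Fin n)} (hL : L.card = m + 1) :
    Even (L.filter fun i => InCone B b (L.erase i)).card := by
  rcases (L.filter fun i => InCone B b (L.erase i)).eq_empty_or_nonempty with h | ⟨i, hi⟩
  · simp [h]
  obtain ⟨hiL, hib⟩ := Finset.mem_filter.1 hi
  have hcard : ∀ k ∈ L, (L.erase k).card = m := fun k hk => by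
    rw [Finset.card_erase_of_mem hk, hL, Nat.add_sub_cancel]
  obtain ⟨x, hx, hxL, hxb⟩ := id hib
  obtain ⟨v, hv0, hvL, hv⟩ := exists_mulVec_eq_zero_of_lt_card (B := B) (L := L) (by omega)
  have hxi : x i = 0 := hxL i (by simp)
  have hxL' : ∀ k ∉ L, x k = 0 := fun k hk => hxL k fun h => hk (Finset.mem_of_mem_erase h)
  have hvi : v i ≠ 0 := fun h => hv0 <| hnd.eq_zero_of_mulVec_eq_zero (hcard i hiL) hib
    (fun k hk => by
      by_cases hki : k = i
      · rw [hki, h]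
      · exact hvL k fun hkL => hk (Finset.mem_erase.2 ⟨hki, hkL⟩)) hv
  obtain ⟨w, hwi, hwL, hw⟩ : ∃ w : Fin n → ℝ, w i = 1 ∧ (∀ k ∉ L, w k = 0) ∧ B.mulVec w = 0 :=
    ⟨(v i)⁻¹ • v, by simp [hvi], fun k hk => by simp [hvL k hk], by
      rw [Matrix.mulVec_smul, hv, smul_zero]⟩
  have hw0 : w ≠ 0 := fun h => by simp [h] at hwi
  obtain ⟨t, ht, hy, j, hj, hyj⟩ :=
    exists_nonneg_add_mul_eq_zero hx (exists_neg_of_isBounded hbdd hx hxb hw hw0)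
  have hjL : j ∈ L := by
    by_contra h
    exact hj.ne (hwL j h)
  have hij : i ≠ j := by
    rintro rfl
    linarith
  have hyb := mulVec_add_mul hxb hw t
  have hyL : ∀ k ∉ L.erase j, x k + t * w k = 0 := fun k hk => by
    by_cases hkj : k = j
    · rw [hkj, hyj]
    · have hkL : k ∉ L := fun hkL => hk (Finset.mem_erase.2 ⟨hkj, hkL⟩)
      rw [hxL' k hkL, hwL k hkL, mul_zero, add_zero]
  have heq : (L.filter fun i => InCone B b (L.erase i)) = {i, j} := by
    ext l
    simp only [Finset.mem_filter, Finset.mem_insert, Finset.mem_singleton]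
    constructor
    · rintro ⟨hlL, y, hy', hyL', hyb'⟩
      by_contra! hl
      have hyl : y l = 0 := hyL' l (by simp)
      have hdiff := hnd.eq_zero_of_mulVec_eq_zero (hcard i hiL) hib
        (v := fun k => (y k + (-1) * x k) + (-y i) * w k) (fun k hk => by
          by_cases hki : k = i
          · subst hki
            rw [hxi, hwi]
            ring
          · have hkL : k ∉ L := fun hkL => hk (Finset.mem_erase.2 ⟨hki, hkL⟩)
            rw [hxL' k hkL, hwL k hkL, hyL' k fun h => hkL (Finset.mem_of_mem_erase h)]
            ring) (mulVec_add_mul (x := fun k => y k + (-1) * x k) (by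
              have : (fun k => y k + (-1) * x k) = y - x := by
                ext k
                simp
                ring
              rw [this, Matrix.mulVec_sub, hyb', hxb, sub_self]) hw _)
      have hyx : ∀ k, y k = x k + y i * w k := fun k => by
        have := congrFun hdiff k
        simp only [Pi.zero_apply] at this
        linarith
      have hypos : 0 < x l + t * w l :=
        hnd.pos (hcard j hjL) hy hyL hyb (Finset.mem_erase.2 ⟨hl.2, hlL⟩)
      have hxpos : 0 < x l := hnd.pos (hcard i hiL) hx hxL hxb (Finset.mem_erase.2 ⟨hl.1, hlL⟩)
      have hyi : 0 ≤ y i := hy' i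
      have h₁ := hyx l
      have h₂ := hyx j
      have h₃ := hy' j
      have hle : y i ≤ t := by nlinarith
      have hwl : w l < 0 := by
        by_contra! h
        nlinarith [mul_nonneg hyi h]
      nlinarith
    · rintro (rfl | rfl)
      · exact ⟨hiL, hib⟩
      · exact ⟨hjL, _, hy, hyL, hyb⟩
  rw [heq, Finset.card_pair hij]
  exact even_two

end Feasible

section Subordinating

variable {m n : ℕ} {C : Matrix (Fin m) (Fin n) ℝ}

lemma Subordinating.mono {J K : Finset (Fin n)} (hJ : Subordinating C J) (hKJ : K ⊆ J) :
    Subordinating C K := fun k =>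
  (hJ k).imp fun _ hi j hj => hi j (hKJ hj)

/-- In a subordinating set of size `m`, no element is the smallest one in two different rows. -/
lemma Subordinating.row_unique (hgen : OrdinalGeneric C) {J : Finset (Fin n)} (hJ : J.card = m)
    (hsub : Subordinating C J) {j : Fin n} {r s : Fin m} (hj : j ∈ J)
    (hr : ∀ k ∈ J, C r j ≤ C r k) (hs : ∀ k ∈ J, C s j ≤ C s k) : r = s := by
  classical
  choose f hf using fun j : J => hsub j
  have hinj : Function.Injective f := fun j k hjk => by
    refine Subtype.ext (hgen (f j) (le_antisymm (hf j k k.2) ?_))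
    rw [hjk]
    exact hf k j j.2
  have hbij := (Fintype.bijective_iff_injective_and_card f).2 ⟨hinj, by simp [hJ]⟩
  have key : ∀ r, (∀ k ∈ J, C r j ≤ C r k) → r = f ⟨j, hj⟩ := by
    intro r hr
    obtain ⟨k, rfl⟩ := hbij.2 r
    congr 1
    exact Subtype.ext (hgen _ (le_antisymm (hf k j hj) (hr k k.2)))
  rw [key r hr, key s hs]

/-- The columns exceeding, in every row other than `r`, the smallest entry over `K`. -/
def AboveOff (C : Matrix (Fin m) (Fin n) ℝ) (K : Finset (Fin n)) (r : Fin m) (j : Fin n) : Prop :=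
  ∀ i, i ≠ r → ∃ k ∈ K, C i k < C i j

/-- Row `r` is redundant for `K` if every element of `K` is the smallest one in some other row. -/
def RedundantRow (C : Matrix (Fin m) (Fin n) ℝ) (K : Finset (Fin n)) (r : Fin m) : Prop :=
  ∀ k ∈ K, ∃ i, i ≠ r ∧ ∀ l ∈ K, C i k ≤ C i l

lemma RedundantRow.notMem {K : Finset (Fin n)} {r : Fin m} {j : Fin n} (hr : RedundantRow C K r)
    (hj : AboveOff C K r j) : j ∉ K := fun hjK => by
  obtain ⟨i, hi, h⟩ := hr j hjK
  obtain ⟨k, hk, hlt⟩ := hj i hi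
  exact hlt.not_ge (h k hk)

lemma Subordinating.aboveOff_unique {K : Finset (Fin n)} (hK : Subordinating C K) {r s : Fin m}
    {j : Fin n} (hr : AboveOff C K r j) (hs : AboveOff C K s j) : r = s := by
  obtain ⟨i, hi⟩ := hK j
  have key : ∀ r, AboveOff C K r j → i = r := fun r hr => by
    by_contra h
    obtain ⟨k, hk, hlt⟩ := hr i h
    exact hlt.not_ge (hi k hk)
  rw [← key r hr, ← key s hs]

lemma Subordinating.insert_of_redundantRow {K : Finset (Fin n)} (hK : Subordinating C K)
    {r : Fin m} {j : Fin n} (hj : AboveOff C K r j)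
    (hmax : ∀ k, AboveOff C K r k → C r k ≤ C r j) : Subordinating C (insert j K) := by
  intro k
  by_cases hk : AboveOff C K r k
  · refine ⟨r, fun l hl => ?_⟩
    rcases Finset.mem_insert.1 hl with rfl | hl
    · exact hmax k hk
    · obtain ⟨i, hi⟩ := hK k
      by_cases hir : i = r
      · exact hir ▸ hi l hl
      · obtain ⟨p, hp, hlt⟩ := hk i hir
        exact absurd (hi p hp) hlt.not_ge
  · simp only [AboveOff] at hk
    push Not at hk
    obtain ⟨i, hir, hi⟩ := hk
    refine ⟨i, fun l hl => ?_⟩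
    rcases Finset.mem_insert.1 hl with rfl | hl
    · obtain ⟨p, hp, hlt⟩ := hj i hir
      exact (hi p hp).trans hlt.le
    · exact hi l hl

lemma Subordinating.exists_redundantRow (hgen : OrdinalGeneric C) {K : Finset (Fin n)}
    (hKm : K.card + 1 = m) {j : Fin n} (hjK : j ∉ K) (hsub : Subordinating C (insert j K)) :
    ∃ r, RedundantRow C K r ∧ AboveOff C K r j ∧ ∀ k, AboveOff C K r k → C r k ≤ C r j := by
  have hcard : (insert j K).card = m := by rw [Finset.card_insert_of_notMem hjK, hKm]
  obtain ⟨r, hr⟩ := hsub j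
  have hoff : AboveOff C K r j := by
    intro i hi
    by_contra! h
    refine hi (hsub.row_unique hgen hcard (Finset.mem_insert_self j K) (fun k hk => ?_) hr)
    rcases Finset.mem_insert.1 hk with rfl | hk
    · exact le_rfl
    · exact h k hk
  refine ⟨r, fun k hk => ?_, hoff, fun k hk => ?_⟩
  · obtain ⟨i, hi⟩ := hsub k
    refine ⟨i, ?_, fun l hl => hi l (Finset.mem_insert_of_mem hl)⟩
    rintro rfl
    have := hgen i (le_antisymm (hi j (Finset.mem_insert_self j K))
      (hr k (Finset.mem_insert_of_mem hk)))
    exact hjK (this ▸ hk)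
  · obtain ⟨i, hi⟩ := hsub k
    by_cases hir : i = r
    · exact hir ▸ hi j (Finset.mem_insert_self j K)
    · obtain ⟨p, hp, hlt⟩ := hk i hir
      exact absurd (hi p (Finset.mem_insert_of_mem hp)) hlt.not_ge

open Classical in
/-- The extensions of a subordinating set of size `m - 1` to a subordinating set of size `m`
correspond to the redundant rows with a column above the other rows. -/
lemma Subordinating.card_filter_insert (hgen : OrdinalGeneric C) {K : Finset (Fin n)}
    (hKm : K.card + 1 = m) (hK : Subordinating C K) :
    (Finset.univ.filter fun j => j ∉ K ∧ Subordinating C (insert j K)).card =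
      (Finset.univ.filter fun r => RedundantRow C K r ∧ ∃ j, AboveOff C K r j).card := by
  have hmax : ∀ r, (∃ j, AboveOff C K r j) →
      ∃ j, AboveOff C K r j ∧ ∀ k, AboveOff C K r k → C r k ≤ C r j := by
    rintro r ⟨j, hj⟩
    obtain ⟨k, hk, h⟩ := (Finset.univ.filter (AboveOff C K r)).exists_max_image (C r)
      ⟨j, by simp [hj]⟩
    exact ⟨k, by simpa using hk, fun l hl => h l (by simp [hl])⟩
  choose f hf using hmax
  symm
  refine Finset.card_bij (fun r hr => f r (Finset.mem_filter.1 hr).2.2) (fun r hr => ?_)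
    (fun r hr s hs hrs => ?_) fun j hj => ?_
  · have hr' := (Finset.mem_filter.1 hr).2
    obtain ⟨h₁, h₂⟩ := hf r hr'.2
    exact Finset.mem_filter.2 ⟨Finset.mem_univ _, hr'.1.notMem h₁, hK.insert_of_redundantRow h₁ h₂⟩
  · exact hK.aboveOff_unique (hf r (Finset.mem_filter.1 hr).2.2).1
      (hrs ▸ (hf s (Finset.mem_filter.1 hs).2.2).1)
  · simp only [Finset.mem_filter, Finset.mem_univ, true_and] at hj
    obtain ⟨r, hr, hoff, h⟩ := hj.2.exists_redundantRow hgen hKm hj.1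
    have hfr := hf r ⟨j, hoff⟩
    exact ⟨r, by simpa using ⟨hr, j, hoff⟩,
      hgen r (le_antisymm (h _ hfr.1) (hfr.2 j hoff))⟩

open Classical in
lemma Subordinating.card_redundantRow (hgen : OrdinalGeneric C) {K : Finset (Fin n)}
    (hKm : K.card + 1 = m) (hK : Subordinating C K) (hne : K.Nonempty) :
    (Finset.univ.filter fun r => RedundantRow C K r).card = 2 := by
  choose f hfK hf using fun i : Fin m => K.exists_min_image (C i) hne
  have hfeq : ∀ i, ∀ k ∈ K, (∀ l ∈ K, C i k ≤ C i l) → f i = k := fun i k hk h =>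
    hgen i (le_antisymm (hf i k hk) (h _ (hfK i)))
  have hred : ∀ r, RedundantRow C K r ↔ ∀ k ∈ K, ∃ i, i ≠ r ∧ f i = k := fun r =>
    forall₂_congr fun k hk => exists_congr fun i => and_congr_right fun _ =>
      ⟨hfeq i k hk, fun h => h ▸ hf i⟩
  have hsurj : ∀ k ∈ K, ∃ i, f i = k := fun k hk => by
    obtain ⟨i, hi⟩ := hK k
    exact ⟨i, hfeq i k hk hi⟩
  obtain ⟨p, -, q, -, hpq, hfpq⟩ := Finset.exists_ne_map_eq_of_card_lt_of_maps_to
    (s := (Finset.univ : Finset (Fin m))) (t := K) (f := f) (by simp; omega)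
    (fun i _ => hfK i)
  have heq : (Finset.univ.filter fun r => RedundantRow C K r) = {p, q} := by
    ext r
    simp only [Finset.mem_filter, Finset.mem_univ, true_and, Finset.mem_insert,
      Finset.mem_singleton, hred]
    constructor
    · intro hr
      by_contra! hne
      have hsub : K ⊆ ((Finset.univ.erase r).erase p).image f := fun k hk => by
        obtain ⟨i, hir, hi⟩ := hr k hk
        by_cases hip : i = p
        · exact Finset.mem_image.2 ⟨q, by simp [hpq.symm, hne.2.symm], by rw [← hfpq, ← hip, hi]⟩
        · exact Finset.mem_image.2 ⟨i, by simp [hip, hir], hi⟩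
      have h₁ := (Finset.card_le_card hsub).trans Finset.card_image_le
      rw [Finset.card_erase_of_mem (by simp [hne.1.symm]),
        Finset.card_erase_of_mem (Finset.mem_univ r), Finset.card_univ, Fintype.card_fin] at h₁
      have := Finset.card_pos.2 ‹K.Nonempty›
      omega
    · rintro (rfl | rfl) k hk
      · obtain ⟨i, hi⟩ := hsurj k hk
        by_cases hir : i = r
        · exact ⟨q, hpq.symm, by rw [← hfpq, ← hir, hi]⟩
        · exact ⟨i, hir, hi⟩
      · obtain ⟨i, hi⟩ := hsurj k hk
        by_cases hir : i = r
        · exact ⟨p, hpq, by rw [hfpq, ← hir, hi]⟩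
        · exact ⟨i, hir, hi⟩
  rw [heq, Finset.card_pair hpq]

variable {e : Fin m → Fin n}

open Classical in
/-- The pivoting step for subordinating sets: a set of size `m - 1` not contained in the initial
columns `e i` extends to an even number of subordinating sets of size `m`. -/
lemma even_card_filter_subordinating_insert (hgen : OrdinalGeneric C)
    (hhigh : ∀ i j k, i ≠ j → k ∉ Set.range e → C i k < C i (e j))
    {K : Finset (Fin n)} (hKm : K.card + 1 = m) (hKe : ∃ k ∈ K, k ∉ Set.range e) :
    Even (Finset.univ.filter fun j => j ∉ K ∧ Subordinating C (insert j K)).card := by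
  by_cases hK : Subordinating C K
  · obtain ⟨k, hkK, hk⟩ := hKe
    rw [hK.card_filter_insert hgen hKm]
    have : ∀ r, ∃ j, AboveOff C K r j := fun r => ⟨e r, fun i hi => ⟨k, hkK, hhigh i r k hi hk⟩⟩
    simp only [this, and_true]
    rw [hK.card_redundantRow hgen hKm ⟨k, hkK⟩]
    exact even_two
  · rw [Finset.filter_false_of_mem]
    · simp
    · rintro j - ⟨-, hj⟩
      exact hK (hj.mono (Finset.subset_insert j K))

open Classical in
/-- All initial columns but one extend to exactly one subordinating set of size `m`. -/
lemma card_filter_subordinating_insert_eq_one (hgen : OrdinalGeneric C)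
    (he : Function.Injective e)
    (hlow : Nontrivial (Fin m) → ∀ i k, k ≠ e i → C i (e i) < C i k)
    (hhigh : ∀ i j k, i ≠ j → k ∉ Set.range e → C i k < C i (e j))
    (hout : ∃ k, k ∉ Set.range e) (z : Fin m) :
    (Finset.univ.filter fun j => j ∉ (Finset.univ.erase z).image e ∧
      Subordinating C (insert j ((Finset.univ.erase z).image e))).card = 1 := by
  set K := (Finset.univ.erase z).image e with hKdef
  have hmem : ∀ k, k ∈ K ↔ ∃ s, s ≠ z ∧ e s = k := by simp [hKdef]
  have hlow' : Nontrivial (Fin m) → ∀ i k, C i (e i) ≤ C i k := fun hmt i k => by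
    by_cases h : k = e i
    · rw [h]
    · exact (hlow hmt i k h).le
  have hKm : K.card + 1 = m := by
    have := z.pos
    rw [hKdef, Finset.card_image_of_injective _ he, Finset.card_erase_of_mem (Finset.mem_univ z),
      Finset.card_univ, Fintype.card_fin]
    omega
  have hK : Subordinating C K := by
    intro k
    by_cases hk : k ∈ Set.range e
    · obtain ⟨s, rfl⟩ := hk
      refine ⟨s, fun j hj => ?_⟩
      obtain ⟨t, ht, -⟩ := (hmem j).1 hj
      exact hlow' ⟨t, z, ht⟩ s j
    · refine ⟨z, fun j hj => ?_⟩
      obtain ⟨s, hs, rfl⟩ := (hmem j).1 hj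
      exact (hhigh z s k hs.symm hk).le
  rw [hK.card_filter_insert hgen hKm, Finset.card_eq_one]
  refine ⟨z, ?_⟩
  ext r
  simp only [Finset.mem_filter, Finset.mem_univ, true_and, Finset.mem_singleton]
  constructor
  · rintro ⟨hr, j, hj⟩
    by_contra hrz
    obtain ⟨i, hir, hi⟩ := hr (e r) ((hmem _).2 ⟨r, hrz, rfl⟩)
    obtain rfl : i = z := by
      by_contra hiz
      exact (hlow ⟨r, z, hrz⟩ i (e r) fun h => hir (he h).symm).not_ge
        (hi _ ((hmem _).2 ⟨i, hiz, rfl⟩))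
    obtain ⟨k, hk, hlt⟩ := hj i hir
    have hlt' := (hi k hk).trans_lt hlt
    by_cases hje : j ∈ Set.range e
    · obtain ⟨s, rfl⟩ := hje
      by_cases hsr : s = r
      · exact (hsr ▸ hlt').false
      · obtain ⟨p, -, hp⟩ := hj s hsr
        exact hp.not_ge (hlow' ⟨r, _, hrz⟩ s p)
    · exact hlt'.not_gt (hhigh i r j hir hje)
  · rintro rfl
    refine ⟨fun k hk => ?_, ?_⟩
    · obtain ⟨s, hs, rfl⟩ := (hmem k).1 hk
      exact ⟨s, hs, fun l _ => hlow' ⟨s, _, hs⟩ s l⟩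
    · obtain ⟨k, hk⟩ := hout
      exact ⟨k, fun i hi => ⟨e i, (hmem _).2 ⟨i, hi, rfl⟩,
        hlow ⟨i, _, hi⟩ i k fun h => hk ⟨i, h.symm⟩⟩⟩

end Subordinating

/-- **Scarf's lemma, non-degenerate generic form.**  Under the hypotheses of Scarf's lemma,
if moreover `(B, b)` is non-degenerate and `C` is ordinal-generic, then there is a subset
`J ⊆ [n]` of size `m` which is both a feasible basis of `(B, b)` and subordinating for `C`. -/
theorem scarf_lemma_nondegenerate {m n : ℕ} (hm : 0 < m) (hmn : m < n)
    (B C : Matrix (Fin m) (Fin n) ℝ) (b : Fin m → ℝ)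
    (hB : ∀ i j : Fin m, B i (Fin.castLE hmn.le j) = if i = j then 1 else 0)
    (hb : ∀ i, 0 ≤ b i)
    (hbdd : Bornology.IsBounded {α : Fin n → ℝ | (∀ j, 0 ≤ α j) ∧ B.mulVec α = b})
    (hC : ∀ (i j : Fin m) (k : Fin n), i ≠ j → m ≤ (k : ℕ) →
      C i (Fin.castLE hmn.le i) ≤ C i k ∧ C i k ≤ C i (Fin.castLE hmn.le j))
    (hnd : NonDegenerate B b) (hgen : OrdinalGeneric C) :
    ∃ J : Finset (Fin n), J.card = m ∧ FeasibleBasis B b J ∧ Subordinating C J := by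
  classical
  set e : Fin m → Fin n := Fin.castLE hmn.le with he_def
  have he : Function.Injective e := Fin.castLE_injective hmn.le
  have hrange : ∀ k, k ∉ Set.range e ↔ m ≤ (k : ℕ) := fun k => by
    rw [he_def, Fin.range_castLE]
    simp
  have hout : ∃ k, k ∉ Set.range e := ⟨⟨m, hmn⟩, (hrange _).2 le_rfl⟩
  have hhigh : ∀ i j k, i ≠ j → k ∉ Set.range e → C i k < C i (e j) := fun i j k hij hk =>
    lt_of_le_of_ne (hC i j k hij ((hrange k).1 hk)).2 fun h => hk ⟨j, (hgen i h).symm⟩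
  have hlow : Nontrivial (Fin m) → ∀ i k, k ≠ e i → C i (e i) < C i k := by
    intro hmt i k hk
    refine lt_of_le_of_ne ?_ fun h => hk (hgen i h).symm
    by_cases hke : k ∈ Set.range e
    · obtain ⟨j, rfl⟩ := hke
      obtain ⟨l, hl⟩ := hout
      have := hC i j l (fun h => hk (by rw [h])) ((hrange l).1 hl)
      exact this.1.trans this.2
    · obtain ⟨j, hj⟩ := exists_ne i
      exact (hC i j k hj.symm ((hrange k).1 hke)).1
  by_contra hcon
  have hno : ∀ J : Finset (Fin n), J.card = m → InCone B b J → ¬ Subordinating C J :=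
    fun J hJ hJb hJC => hcon ⟨J, hJ, hnd.feasibleBasis hJ hJb, hJC⟩
  obtain ⟨z⟩ : Nonempty (Fin m) := ⟨⟨0, hm⟩⟩
  set S := (Finset.univ.filter fun K : Finset (Fin n) =>
    K.card + 1 = m ∧ e z ∉ K ∧ InCone B b (insert (e z) K)).sigma fun K =>
      Finset.univ.filter fun j => j ∉ K ∧ Subordinating C (insert j K) with hS
  set T := (Finset.univ.filter fun L : Finset (Fin n) =>
    L.card = m + 1 ∧ e z ∈ L ∧ Subordinating C (L.erase (e z))).sigma fun L =>
      L.filter fun i => InCone B b (L.erase i) with hT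
  have hTeven : Even T.card := by
    rw [hT, Finset.card_sigma]
    refine Finset.even_sum _ fun L hL => ?_
    exact hnd.even_card_filter_inCone_erase hbdd (Finset.mem_filter.1 hL).2.1
  have hSodd : Odd S.card := by
    have hK₀card : ((Finset.univ.erase z).image e).card + 1 = m := by
      rw [Finset.card_image_of_injective _ he, Finset.card_erase_of_mem (Finset.mem_univ z),
        Finset.card_univ, Fintype.card_fin]
      omega
    rw [hS, Finset.card_sigma, ← Finset.add_sum_erase _ _ (a := (Finset.univ.erase z).image e),
      card_filter_subordinating_insert_eq_one hgen he hlow hhigh hout z]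
    · refine Odd.add_even odd_one (Finset.even_sum _ fun K hK => ?_)
      simp only [Finset.mem_erase, Finset.mem_filter, Finset.mem_univ, true_and] at hK
      obtain ⟨hne, hKm, hzK, -⟩ := hK
      refine even_card_filter_subordinating_insert hgen hhigh hKm ?_
      by_contra! hKe
      refine hne (Finset.eq_of_subset_of_card_le (fun k hk => ?_) (by omega))
      obtain ⟨s, rfl⟩ := hKe k hk
      exact Finset.mem_image_of_mem e
        (Finset.mem_erase.2 ⟨fun h => hzK (h ▸ hk), Finset.mem_univ s⟩)
    · simp only [Finset.mem_filter, Finset.mem_univ, true_and]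
      refine ⟨hK₀card, ?_, ?_⟩
      · simp [he.eq_iff]
      · rw [← Finset.image_insert, Finset.insert_erase (Finset.mem_univ z)]
        exact inCone_image he hB hb
  have hcard : S.card = T.card := by
    refine Finset.card_bij' (fun p _ => ⟨insert (e z) (insert p.2 p.1), p.2⟩)
      (fun p _ => ⟨(p.1.erase (e z)).erase p.2, p.2⟩) ?_ ?_ ?_ ?_
    · rintro ⟨K, j⟩ hp
      simp only [hS, hT, Finset.mem_sigma, Finset.mem_filter, Finset.mem_univ, true_and] at hp ⊢
      obtain ⟨⟨hKm, hzK, hKb⟩, hjK, hKC⟩ := hp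
      have hjz : e z ≠ j := by
        rintro rfl
        exact hno _ (by rw [Finset.card_insert_of_notMem hjK, hKm]) hKb hKC
      have hz : e z ∉ insert j K := by simp [hjz, hzK]
      refine ⟨⟨?_, Finset.mem_insert_self _ _, ?_⟩, by simp, ?_⟩
      · rw [Finset.card_insert_of_notMem hz, Finset.card_insert_of_notMem hjK, hKm]
      · rwa [Finset.erase_insert hz]
      · rw [Finset.insert_comm, Finset.erase_insert (by simp [hjz.symm, hjK])]
        exact hKb
    · rintro ⟨L, i⟩ hp
      simp only [hS, hT, Finset.mem_sigma, Finset.mem_filter, Finset.mem_univ, true_and] at hp ⊢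
      obtain ⟨⟨hLm, hzL, hLC⟩, hiL, hLb⟩ := hp
      have hiz : e z ≠ i := by
        rintro rfl
        exact hno _ (by rw [Finset.card_erase_of_mem hiL, hLm, Nat.add_sub_cancel]) hLb hLC
      have hi : i ∈ L.erase (e z) := Finset.mem_erase.2 ⟨hiz.symm, hiL⟩
      refine ⟨⟨?_, by simp, ?_⟩, by simp, ?_⟩
      · rw [Finset.card_erase_of_mem hi, Finset.card_erase_of_mem hzL]
        omega
      · rwa [Finset.erase_right_comm, Finset.insert_erase (Finset.mem_erase.2 ⟨hiz, hzL⟩)]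
      · rwa [Finset.insert_erase hi]
    · rintro ⟨K, j⟩ hp
      simp only [hS, Finset.mem_sigma, Finset.mem_filter, Finset.mem_univ, true_and] at hp
      obtain ⟨⟨hKm, hzK, hKb⟩, hjK, hKC⟩ := hp
      have hjz : e z ≠ j := by
        rintro rfl
        exact hno _ (by rw [Finset.card_insert_of_notMem hjK, hKm]) hKb hKC
      simp [hjz, hzK, hjK]
    · rintro ⟨L, i⟩ hp
      simp only [hT, Finset.mem_sigma, Finset.mem_filter, Finset.mem_univ, true_and] at hp
      obtain ⟨⟨hLm, hzL, hLC⟩, hiL, hLb⟩ := hp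
      have hiz : e z ≠ i := by
        rintro rfl
        exact hno _ (by rw [Finset.card_erase_of_mem hiL, hLm, Nat.add_sub_cancel]) hLb hLC
      simp [Finset.insert_erase, Finset.mem_erase, hiz.symm, hzL, hiL]
  exact (Nat.not_even_iff_odd.2 (hcard ▸ hSodd)) hTeven
end

section
/- Let m < n be positive integers, let B be an m × n real matrix such that b_{ij} = δ_{ij} for 1 ≤ i, j ≤ m, and let b be a non-negative vector in ℝ^m such that the set {α ∈ ℝ₊ⁿ : Bα = b} is bounded and such that (B, b) is non-degenerate. Let J be a feasible basis for (B, b) and let k ∈ [n] \ J. Then there exists a unique j ∈ J such that J + k − j (i.e., J ∪ {k} \ {j}) is a feasible basis for (B, b). -/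
theorem mulVec_eq_sum_of_support {m n : ℕ} (B : Matrix (Fin m) (Fin n) ℝ) {J : Finset (Fin n)}
    {z : Fin n → ℝ} (hz : ∀ j ∉ J, z j = 0) :
    B.mulVec z = ∑ j ∈ J, z j • (fun i => B i j) := by
  ext i
  rw [Finset.sum_apply, Matrix.mulVec, dotProduct]
  symm
  refine (Finset.sum_subset (Finset.subset_univ J) fun j _ hj => ?_).trans ?_
  · simp [hz j hj]
  · simp [mul_comm]

theorem linearIndependent_columns_iff {m n : ℕ} (B : Matrix (Fin m) (Fin n) ℝ)
    (J : Finset (Fin n)) :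
    LinearIndependent ℝ (fun j : J => (fun i => B i (j : Fin n))) ↔
      ∀ z : Fin n → ℝ, (∀ j ∉ J, z j = 0) → B.mulVec z = 0 → z = 0 := by
  have key := linearIndepOn_finset_iff (R := ℝ) (s := J) (v := fun j : Fin n => fun i => B i j)
  refine Iff.trans key ⟨fun h z hz hBz => ?_, fun h f hf j hj => ?_⟩
  · rw [mulVec_eq_sum_of_support B hz] at hBz
    ext j
    by_cases hj : j ∈ J
    · exact h z hBz j hj
    · exact hz j hj
  · have hz : ∀ j ∉ J, (fun j => if j ∈ J then f j else 0) j = 0 := fun j hj => if_neg hj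
    have h0 := h _ hz (by
      rw [mulVec_eq_sum_of_support B hz, ← hf]
      exact Finset.sum_congr rfl fun j hj => by simp [hj])
    simpa [hj] using congrFun h0 j

/-- In the non-degenerate case, all basic coefficients of a feasible solution are positive. -/
theorem NonDegenerate.pos_of_mem {m n : ℕ} {B : Matrix (Fin m) (Fin n) ℝ} {b : Fin m → ℝ}
    (hnd : NonDegenerate B b) {J : Finset (Fin n)} (hJ : J.card = m) {α : Fin n → ℝ}
    (h0 : ∀ j, 0 ≤ α j) (hs : ∀ j ∉ J, α j = 0) (hα : B.mulVec α = b) {j : Fin n}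
    (hj : j ∈ J) : 0 < α j := by
  refine (h0 j).lt_of_ne' fun hj0 => hnd ⟨J.erase j, ?_, α, h0, fun i hi => ?_, hα⟩
  · exact hJ ▸ Finset.card_erase_lt_of_mem hj
  · by_cases hij : i = j
    · exact hij ▸ hj0
    · exact hs i fun h => hi (Finset.mem_erase.2 ⟨hij, h⟩)

/-- The edge direction obtained by letting the column `k` enter the basis `J`. -/
theorem exists_edge_direction {m n : ℕ} {B : Matrix (Fin m) (Fin n) ℝ} {J : Finset (Fin n)}
    (hJ : J.card = m)
    (hli : LinearIndependent ℝ (fun j : J => (fun i => B i (j : Fin n))))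
    {k : Fin n} (hk : k ∉ J) :
    ∃ d : Fin n → ℝ, d k = 1 ∧ (∀ j ∉ insert k J, d j = 0) ∧ B.mulVec d = 0 := by
  have hspan := hli.span_eq_top_of_card_eq_finrank' (by simp [hJ])
  have hmem : -(fun i => B i k) ∈
      Submodule.span ℝ (Set.range fun j : J => (fun i => B i (j : Fin n))) :=
    hspan ▸ Submodule.mem_top
  obtain ⟨c, hc⟩ := (Submodule.mem_span_range_iff_exists_fun ℝ).1 hmem
  let d : Fin n → ℝ := fun j => if h : j ∈ J then c ⟨j, h⟩ else if j = k then 1 else 0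
  have hd : ∀ j ∉ insert k J, d j = 0 := fun j hj => by
    rw [Finset.mem_insert, not_or] at hj
    simp [d, hj.1, hj.2]
  have hdk : d k = 1 := by simp [d, hk]
  refine ⟨d, hdk, hd, ?_⟩
  have hsum : ∑ j ∈ J, d j • (fun i => B i j) = -(fun i => B i k) := by
    rw [← hc, ← Finset.sum_coe_sort]
    exact Finset.sum_congr rfl fun j _ => by simp [d]
  rw [mulVec_eq_sum_of_support B hd, Finset.sum_insert hk, hsum, hdk, one_smul, add_neg_cancel]

/-- Kernel vectors supported on `J + k` are multiples of the edge direction. -/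
theorem eq_smul_edge_direction {m n : ℕ} {B : Matrix (Fin m) (Fin n) ℝ} {J : Finset (Fin n)}
    (hli : LinearIndependent ℝ (fun j : J => (fun i => B i (j : Fin n))))
    {k : Fin n} {d : Fin n → ℝ} (hdk : d k = 1) (hd : ∀ j ∉ insert k J, d j = 0)
    (hBd : B.mulVec d = 0) {z : Fin n → ℝ} (hz : ∀ j ∉ insert k J, z j = 0)
    (hBz : B.mulVec z = 0) : z = z k • d := by
  refine sub_eq_zero.1 ((linearIndependent_columns_iff B J).1 hli _ (fun j hj => ?_) ?_)
  · by_cases hjk : j = k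
    · simp [hjk, hdk]
    · have hj' : j ∉ insert k J := by simp [hjk, hj]
      simp [hz j hj', hd j hj']
  · rw [Matrix.mulVec_sub, Matrix.mulVec_smul, hBz, hBd, smul_zero, sub_zero]

/-- **The pivoting step of the simplex algorithm.**  If `(B, b)` is non-degenerate with
bounded feasible region, `J` is a feasible basis for `(B, b)` and `k ∈ [n] \ J`, then there
is a unique `j ∈ J` such that `J + k - j` is a feasible basis. -/
theorem feasibleBasis_pivot {m n : ℕ} (hm : 0 < m) (hmn : m < n)
    (B : Matrix (Fin m) (Fin n) ℝ) (b : Fin m → ℝ)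
    (hB : ∀ i j : Fin m, B i (Fin.castLE hmn.le j) = if i = j then 1 else 0)
    (hb : ∀ i, 0 ≤ b i)
    (hbdd : Bornology.IsBounded {α : Fin n → ℝ | (∀ j, 0 ≤ α j) ∧ B.mulVec α = b})
    (hnd : NonDegenerate B b)
    (J : Finset (Fin n)) (hJ : FeasibleBasis B b J)
    (k : Fin n) (hk : k ∉ J) :
    ∃! j : Fin n, j ∈ J ∧ FeasibleBasis B b ((insert k J).erase j) := by
  obtain ⟨hcard, hli, α, hα0, hαs, hα⟩ := hJ
  obtain ⟨d, hdk, hd, hBd⟩ := exists_edge_direction hcard hli hk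
  have hαpos : ∀ j ∈ J, 0 < α j := fun j hj => hnd.pos_of_mem hcard hα0 hαs hα hj
  have hαk : α k = 0 := hαs k hk
  have hcard' : ∀ j ∈ J, ((insert k J).erase j).card = m := fun j hj => by
    rw [Finset.card_erase_of_mem (Finset.mem_insert_of_mem hj), Finset.card_insert_of_notMem hk,
      hcard, Nat.add_sub_cancel]
  have hneg : ∃ j ∈ J, d j < 0 := by
    by_contra! hcon
    have hd0 : ∀ j, 0 ≤ d j := fun j => by
      by_cases hj : j ∈ J
      · exact hcon j hj
      · by_cases hjk : j = k
        · rw [hjk, hdk]; exact zero_le_one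
        · exact (hd j (by simp [hj, hjk])).ge
    obtain ⟨R, hR⟩ := hbdd.exists_norm_le
    have hmem := hR (α + (|R| + 1) • d) ⟨fun j => add_nonneg (hα0 j)
      (mul_nonneg (by positivity) (hd0 j)), by
        rw [Matrix.mulVec_add, Matrix.mulVec_smul, hBd, hα, smul_zero, add_zero]⟩
    have hcoord := (norm_le_pi_norm (α + (|R| + 1) • d) k).trans hmem
    simp only [Pi.add_apply, Pi.smul_apply, hαk, hdk, smul_eq_mul, mul_one, zero_add,
      Real.norm_eq_abs] at hcoord
    linarith [le_abs_self R, le_abs_self (|R| + 1)]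
  obtain ⟨p, hp, hmin⟩ := (J.filter fun j => d j < 0).exists_min_image (fun j => α j / -d j)
    (by obtain ⟨j, hj, hdj⟩ := hneg; exact ⟨j, Finset.mem_filter.2 ⟨hj, hdj⟩⟩)
  obtain ⟨hpJ, hdp⟩ := Finset.mem_filter.1 hp
  refine ⟨p, ⟨hpJ, hcard' p hpJ, ?_, α + (α p / -d p) • d, fun j => ?_, fun j hj => ?_, ?_⟩, ?_⟩
  · refine (linearIndependent_columns_iff B _).2 fun z hz hBz => ?_
    have hzd := eq_smul_edge_direction hli hdk hd hBd
      (fun j hj => hz j fun h => hj (Finset.mem_of_mem_erase h)) hBz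
    have hzp : z k * d p = 0 := by
      rw [← smul_eq_mul, ← Pi.smul_apply, ← hzd]
      exact hz p (Finset.notMem_erase p _)
    rw [hzd, (mul_eq_zero.1 hzp).resolve_right hdp.ne, zero_smul]
  · have ht : 0 ≤ α p / -d p := div_nonneg (hα0 p) (neg_nonneg.2 hdp.le)
    simp only [Pi.add_apply, Pi.smul_apply, smul_eq_mul]
    rcases le_or_gt 0 (d j) with hdj | hdj
    · exact add_nonneg (hα0 j) (mul_nonneg ht hdj)
    · have hj : j ∈ J := by
        by_contra hj
        by_cases hjk : j = k
        · rw [hjk, hdk] at hdj; linarith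
        · exact hdj.ne (hd j (by simp [hj, hjk]))
      have h := (le_div_iff₀ (neg_pos.2 hdj)).1 (hmin j (Finset.mem_filter.2 ⟨hj, hdj⟩))
      linarith
  · simp only [Pi.add_apply, Pi.smul_apply, smul_eq_mul]
    by_cases hjp : j = p
    · have := hdp.ne
      rw [hjp]
      field_simp
      ring
    · have hj' : j ∉ insert k J := fun h => hj (Finset.mem_erase.2 ⟨hjp, h⟩)
      rw [hd j hj', hαs j fun h => hj' (Finset.mem_insert_of_mem h)]
      simp
  · rw [Matrix.mulVec_add, Matrix.mulVec_smul, hBd, hα, smul_zero, add_zero]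
  · rintro q ⟨hqJ, -, -, β, hβ0, hβs, hβ⟩
    by_contra hqp
    have hβk : 0 < β k := hnd.pos_of_mem (hcard' q hqJ) hβ0 hβs hβ
      (Finset.mem_erase.2 ⟨fun h => hk (h ▸ hqJ), Finset.mem_insert_self k J⟩)
    have hβp : 0 < β p := hnd.pos_of_mem (hcard' q hqJ) hβ0 hβs hβ
      (Finset.mem_erase.2 ⟨Ne.symm hqp, Finset.mem_insert_of_mem hpJ⟩)
    have hβq : β q = 0 := hβs q (Finset.notMem_erase q _)
    have hβd : β - α = (β - α) k • d := eq_smul_edge_direction hli hdk hd hBd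
      (fun j hj => by
        rw [Pi.sub_apply, hβs j fun h => hj (Finset.mem_of_mem_erase h),
          hαs j fun h => hj (Finset.mem_insert_of_mem h), sub_zero])
      (by rw [Matrix.mulVec_sub, hβ, hα, sub_self])
    have hcoord : ∀ j, β j - α j = β k * d j := fun j => by
      simpa [hαk] using congrFun hβd j
    have hdq : d q < 0 := by
      by_contra! hdq
      linarith [hcoord q, hαpos q hqJ, mul_nonneg hβk.le hdq]
    have hratio : α q / -d q = β k := by
      rw [div_eq_iff (neg_pos.2 hdq).ne']
      linarith [hcoord q]
    have h := (div_le_iff₀ (neg_pos.2 hdp)).1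
      ((hmin q (Finset.mem_filter.2 ⟨hqJ, hdq⟩)).trans_eq hratio)
    linarith [hcoord p]
end

section
/- Let m < n be positive integers and let C be an m × n real matrix such that c_{ii} ≤ c_{ik} ≤ c_{ij} whenever i, j ≤ m, i ≠ j and k > m, and assume C is ordinal-generic. Let K ⊆ [n] be a subordinating set for C of size m − 1. Then there are precisely two elements j ∈ [n] \ K such that K + j (i.e., K ∪ {j}) is subordinating for C, unless K ⊆ [m], in which case there exists precisely one such j. -/
/-- The columns lying strictly above column `r i` in each row `i ≠ x`. -/
def columnsAboveOff {m n : ℕ} (C : Matrix (Fin m) (Fin n) ℝ) (r : Fin m → Fin n) (x : Fin m) :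
    Set (Fin n) :=
  {k | ∀ i, i ≠ x → C i (r i) < C i k}

/-- The columns of `columnsAboveOff C r x` whose entry in row `x` is largest. -/
def topColumnsAboveOff {m n : ℕ} (C : Matrix (Fin m) (Fin n) ℝ) (r : Fin m → Fin n)
    (x : Fin m) : Set (Fin n) :=
  {j | j ∈ columnsAboveOff C r x ∧ ∀ k ∈ columnsAboveOff C r x, C x k ≤ C x j}

section

variable {m n : ℕ} {C : Matrix (Fin m) (Fin n) ℝ} {r : Fin m → Fin n} {K : Finset (Fin n)}

theorem ncard_topColumnsAboveOff (hgen : OrdinalGeneric C) {x : Fin m}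
    (h : (columnsAboveOff C r x).Nonempty) : (topColumnsAboveOff C r x).ncard = 1 := by
  obtain ⟨j, hj, hmax⟩ := Set.exists_max_image _ (C x) (Set.toFinite _) h
  refine Set.ncard_eq_one.2 ⟨j, Set.eq_singleton_iff_unique_mem.2 ⟨⟨hj, hmax⟩, ?_⟩⟩
  rintro k ⟨hk, hkmax⟩
  exact hgen x (le_antisymm (hmax k hk) (hkmax j hj))

theorem ncard_topColumnsAboveOff_of_empty {x : Fin m} (h : ¬ (columnsAboveOff C r x).Nonempty) :
    (topColumnsAboveOff C r x).ncard = 0 := by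
  have : topColumnsAboveOff C r x = ∅ :=
    Set.eq_empty_iff_forall_notMem.2 fun j hj => h ⟨j, hj.1⟩
  simp [this]

theorem exists_rowMin_eq (hgen : OrdinalGeneric C)
    (hr : ∀ i, r i ∈ K ∧ ∀ j ∈ K, C i (r i) ≤ C i j) (hK : Subordinating C K)
    {k : Fin n} (hk : k ∈ K) : ∃ i, r i = k := by
  obtain ⟨i, hi⟩ := hK k
  exact ⟨i, hgen i (le_antisymm ((hr i).2 k hk) (hi _ (hr i).1))⟩

theorem notMem_of_mem_columnsAboveOff (hgen : OrdinalGeneric C)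
    (hr : ∀ i, r i ∈ K ∧ ∀ j ∈ K, C i (r i) ≤ C i j) (hK : Subordinating C K)
    {x y : Fin m} (hxy : x ≠ y) (hrxy : r x = r y) {j : Fin n}
    (hj : j ∈ columnsAboveOff C r x) : j ∉ K := by
  intro hjK
  obtain ⟨i, rfl⟩ := exists_rowMin_eq hgen hr hK hjK
  by_cases hi : i = x
  · subst hi
    exact (hj y hxy.symm).ne (by rw [hrxy])
  · exact (hj i hi).false

theorem subordinating_insert_of_mem_topColumnsAboveOff
    (hr : ∀ i, r i ∈ K ∧ ∀ j ∈ K, C i (r i) ≤ C i j) (hK : Subordinating C K)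
    {x : Fin m} {j : Fin n} (hj : j ∈ topColumnsAboveOff C r x) :
    Subordinating C (insert j K) := by
  intro k
  by_cases hk : k ∈ columnsAboveOff C r x
  · have hjx : C x j ≤ C x (r x) := by
      obtain ⟨i, hi⟩ := hK j
      have h := hi _ (hr i).1
      by_cases hix : i = x
      · rwa [hix] at h
      · exact absurd h (hj.1 i hix).not_ge
    refine ⟨x, fun l hl => ?_⟩
    rcases Finset.mem_insert.1 hl with rfl | hl
    · exact hj.2 k hk
    · exact (hj.2 k hk).trans (hjx.trans ((hr x).2 l hl))
  · simp only [columnsAboveOff, Set.mem_ofPred_eq, not_forall, not_lt] at hk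
    obtain ⟨i, hix, hi⟩ := hk
    refine ⟨i, fun l hl => ?_⟩
    rcases Finset.mem_insert.1 hl with rfl | hl
    · exact hi.trans (hj.1 i hix).le
    · exact hi.trans ((hr i).2 l hl)

theorem mem_topColumnsAboveOff_of_subordinating_insert (hgen : OrdinalGeneric C)
    (hr : ∀ i, r i ∈ K ∧ ∀ j ∈ K, C i (r i) ≤ C i j) (hcard : K.card = m - 1)
    {p q : Fin m} (hpq : p ≠ q) (hrpq : r p = r q) {j : Fin n} (hjK : j ∉ K)
    (hj : Subordinating C (insert j K)) :
    j ∈ topColumnsAboveOff C r p ∨ j ∈ topColumnsAboveOff C r q := by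
  obtain ⟨x, hx⟩ := hj j
  have hsurj : ∀ k ∈ K, ∃ i, C i (r i) < C i j ∧ r i = k := by
    intro k hk
    obtain ⟨i, hi⟩ := hj k
    have hrk : r i = k := hgen i
      (le_antisymm ((hr i).2 k hk) (hi _ (Finset.mem_insert_of_mem (hr i).1)))
    refine ⟨i, lt_of_le_of_ne ?_ fun h => hjK (hgen i h ▸ (hr i).1), hrk⟩
    rw [hrk]
    exact hi _ (Finset.mem_insert_self _ _)
  have hxj : ¬ C x (r x) < C x j := (hx _ (Finset.mem_insert_of_mem (hr x).1)).not_gt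
  set A : Finset (Fin m) := Finset.univ.filter fun i => C i (r i) < C i j with hA
  have hAsub : A ⊆ Finset.univ.erase x := by
    intro i hi
    simp only [hA, Finset.mem_filter, Finset.mem_univ, true_and] at hi
    exact Finset.mem_erase.2 ⟨fun h => hxj (h ▸ hi), Finset.mem_univ _⟩
  have hKimage : K ⊆ A.image r := by
    intro k hk
    obtain ⟨i, hi, rfl⟩ := hsurj k hk
    exact Finset.mem_image_of_mem _ (by simpa [hA] using hi)
  have hcardE : (Finset.univ.erase x).card = m - 1 := by simp
  have hle := Finset.card_le_card hKimage
  have himage : (A.image r).card ≤ A.card := Finset.card_image_le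
  have hAle := Finset.card_le_card hAsub
  have hAeq : A = Finset.univ.erase x := Finset.eq_of_subset_of_card_le hAsub (by omega)
  have hinj : Set.InjOn r A := Finset.card_image_iff.1 (by omega)
  have hmem : j ∈ topColumnsAboveOff C r x := by
    have hlt : j ∈ columnsAboveOff C r x := by
      intro i hi
      have : i ∈ A := by simp [hAeq, hi]
      simpa [hA] using this
    refine ⟨hlt, fun k hk => ?_⟩
    obtain ⟨i, hi⟩ := hj k
    have h := hi _ (Finset.mem_insert_of_mem (hr i).1)
    by_cases hix : i = x
    · subst hix
      exact hi _ (Finset.mem_insert_self _ _)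
    · exact absurd h (hk i hix).not_ge
  by_cases hp : p = x
  · exact Or.inl (hp ▸ hmem)
  by_cases hq : q = x
  · exact Or.inr (hq ▸ hmem)
  exact absurd (hinj (by simp [hAeq, hp]) (by simp [hAeq, hq]) hrpq) hpq

theorem ncard_subordinating_insert (hgen : OrdinalGeneric C)
    (hr : ∀ i, r i ∈ K ∧ ∀ j ∈ K, C i (r i) ≤ C i j) (hK : Subordinating C K)
    (hcard : K.card = m - 1) {p q : Fin m} (hpq : p ≠ q) (hrpq : r p = r q) :
    {j : Fin n | j ∉ K ∧ Subordinating C (insert j K)}.ncard =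
      (topColumnsAboveOff C r p).ncard + (topColumnsAboveOff C r q).ncard := by
  have hdisj : Disjoint (topColumnsAboveOff C r p) (topColumnsAboveOff C r q) := by
    refine Set.disjoint_left.2 fun j hjp hjq => ?_
    obtain ⟨i, hi⟩ := hK j
    have h := hi _ (hr i).1
    by_cases hip : i = p
    · exact absurd h (hjq.1 i (hip ▸ hpq)).not_ge
    · exact absurd h (hjp.1 i hip).not_ge
  rw [← Set.ncard_union_eq hdisj (Set.toFinite _) (Set.toFinite _)]
  congr 1
  ext j
  constructor
  · rintro ⟨hjK, hj⟩
    exact mem_topColumnsAboveOff_of_subordinating_insert hgen hr hcard hpq hrpq hjK hj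
  · rintro (hj | hj)
    · exact ⟨notMem_of_mem_columnsAboveOff hgen hr hK hpq hrpq hj.1,
        subordinating_insert_of_mem_topColumnsAboveOff hr hK hj⟩
    · exact ⟨notMem_of_mem_columnsAboveOff hgen hr hK hpq.symm hrpq.symm hj.1,
        subordinating_insert_of_mem_topColumnsAboveOff hr hK hj⟩

/-- The strict form of the Scarf condition, with its consequence for the diagonal. -/
theorem scarf_strict (hmn : m < n)
    (hC : ∀ (i j : Fin m) (k : Fin n), i ≠ j → m ≤ (k : ℕ) →
      C i (Fin.castLE hmn.le i) ≤ C i k ∧ C i k ≤ C i (Fin.castLE hmn.le j))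
    (hgen : OrdinalGeneric C) {i j : Fin m} (hij : i ≠ j) :
    C i (Fin.castLE hmn.le i) < C i (Fin.castLE hmn.le j) ∧
      ∀ k : Fin n, m ≤ (k : ℕ) →
        C i (Fin.castLE hmn.le i) < C i k ∧ C i k < C i (Fin.castLE hmn.le j) := by
  have hstrict : ∀ k : Fin n, m ≤ (k : ℕ) →
      C i (Fin.castLE hmn.le i) < C i k ∧ C i k < C i (Fin.castLE hmn.le j) := by
    intro k hk
    have hne : ∀ l : Fin m, Fin.castLE hmn.le l ≠ k := by
      rintro l rfl
      have := l.2
      simp only [Fin.val_castLE] at hk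
      omega
    obtain ⟨h₁, h₂⟩ := hC i j k hij hk
    exact ⟨h₁.lt_of_ne fun h => hne i (hgen i h), h₂.lt_of_ne fun h => hne j (hgen i h).symm⟩
  have h := hstrict ⟨m, hmn⟩ le_rfl
  exact ⟨h.1.trans h.2, hstrict⟩

theorem columnsAboveOff_nonempty_of_not_subset (hmn : m < n)
    (hC : ∀ (i j : Fin m) (k : Fin n), i ≠ j → m ≤ (k : ℕ) →
      C i (Fin.castLE hmn.le i) ≤ C i k ∧ C i k ≤ C i (Fin.castLE hmn.le j))
    (hgen : OrdinalGeneric C) (hr : ∀ i, r i ∈ K ∧ ∀ j ∈ K, C i (r i) ≤ C i j)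
    {k : Fin n} (hkK : k ∈ K) (hk : m ≤ (k : ℕ)) (x : Fin m) :
    (columnsAboveOff C r x).Nonempty :=
  ⟨Fin.castLE hmn.le x, fun i hi =>
    ((hr i).2 k hkK).trans_lt ((scarf_strict hmn hC hgen hi).2 k hk).2⟩

/-- If `K` consists of the first `m` columns except column `s`, then exactly one column extends
it, because only one of the two colliding rows contributes. -/
theorem ncard_top_add_ncard_top (hmn : m < n)
    (hC : ∀ (i j : Fin m) (k : Fin n), i ≠ j → m ≤ (k : ℕ) →
      C i (Fin.castLE hmn.le i) ≤ C i k ∧ C i k ≤ C i (Fin.castLE hmn.le j))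
    (hgen : OrdinalGeneric C) (hr : ∀ i, r i ∈ K ∧ ∀ j ∈ K, C i (r i) ≤ C i j)
    (hK : Subordinating C K) {s y : Fin m} (hsy : s ≠ y) (hrsy : r s = r y)
    (hdiag : ∀ i, i ≠ s → r i = Fin.castLE hmn.le i)
    (hs : ∀ i, i ≠ s → Fin.castLE hmn.le i ∈ K) :
    (topColumnsAboveOff C r s).ncard + (topColumnsAboveOff C r y).ncard = 1 := by
  rw [ncard_topColumnsAboveOff hgen, ncard_topColumnsAboveOff_of_empty]
  · rintro ⟨k, hk⟩
    have hkK := notMem_of_mem_columnsAboveOff hgen hr hK hsy.symm hrsy.symm hk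
    have hlt := hk s hsy
    rw [hrsy, hdiag y hsy.symm] at hlt
    have hstrict := scarf_strict hmn hC hgen hsy
    rcases lt_or_ge (k : ℕ) m with hkm | hkm
    · have hks : k = Fin.castLE hmn.le s := by
        by_contra hne
        exact hkK (hs ⟨k, hkm⟩ fun h => hne (by rw [← h]; rfl))
      rw [hks] at hlt
      exact lt_asymm hlt hstrict.1
    · exact lt_asymm hlt (hstrict.2 k hkm).2
  · refine ⟨⟨m, hmn⟩, fun i hi => ?_⟩
    rw [hdiag i hi]
    exact ((scarf_strict hmn hC hgen hi).2 _ le_rfl).1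

theorem exists_forall_castLE_mem (hm : 0 < m) (hmn : m ≤ n) (hcard : K.card = m - 1)
    (hsub : ∀ k ∈ K, (k : ℕ) < m) :
    ∃ s : Fin m, Fin.castLE hmn s ∉ K ∧ ∀ i, i ≠ s → Fin.castLE hmn i ∈ K := by
  set L : Finset (Fin n) := Finset.univ.map (Fin.castLEEmb hmn) with hL
  have hKL : K ⊆ L := fun k hk =>
    Finset.mem_map.2 ⟨⟨k, hsub k hk⟩, Finset.mem_univ _, rfl⟩
  have hLcard : L.card = m := by simp [hL]
  have hone : (L \ K).card = 1 := by
    rw [Finset.card_sdiff_of_subset hKL]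
    omega
  obtain ⟨t, ht⟩ := Finset.card_eq_one.1 hone
  have htmem : t ∈ L \ K := by simp [ht]
  obtain ⟨htL, htK⟩ := Finset.mem_sdiff.1 htmem
  obtain ⟨s, -, rfl⟩ := Finset.mem_map.1 htL
  refine ⟨s, htK, fun i hi => ?_⟩
  by_contra hiK
  have : Fin.castLE hmn i ∈ L \ K :=
    Finset.mem_sdiff.2 ⟨Finset.mem_map.2 ⟨i, Finset.mem_univ _, rfl⟩, hiK⟩
  rw [ht, Finset.mem_singleton] at this
  exact hi (Fin.castLE_injective hmn this)

theorem ncard_subordinating_insert_of_one {C : Matrix (Fin 1) (Fin n) ℝ} (hn : 0 < n)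
    (hgen : OrdinalGeneric C) : {j : Fin n | Subordinating C {j}}.ncard = 1 := by
  have : Nonempty (Fin n) := ⟨⟨0, hn⟩⟩
  obtain ⟨j, hj⟩ := Finite.exists_max (C 0)
  refine Set.ncard_eq_one.2 ⟨j, Set.eq_singleton_iff_unique_mem.2 ⟨?_, ?_⟩⟩
  · intro k
    exact ⟨0, by simpa using hj k⟩
  · intro k hk
    obtain ⟨i, hi⟩ := hk j
    obtain rfl := Subsingleton.elim i 0
    exact hgen 0 (le_antisymm (hj k) (hi k (Finset.mem_singleton_self k)))

end

/-- **Scarf's cartwheel lemma.**  If `C` is ordinal-generic and satisfies the Scarf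
condition, and `K ⊆ [n]` is a subordinating set of size `m - 1`, then there are precisely
two elements `j ∈ [n] \ K` with `K + j` subordinating, unless `K ⊆ [m]`, in which case
there is precisely one such `j`. -/
theorem subordinating_extension_count {m n : ℕ} (hm : 0 < m) (hmn : m < n)
    (C : Matrix (Fin m) (Fin n) ℝ)
    (hC : ∀ (i j : Fin m) (k : Fin n), i ≠ j → m ≤ (k : ℕ) →
      C i (Fin.castLE hmn.le i) ≤ C i k ∧ C i k ≤ C i (Fin.castLE hmn.le j))
    (hgen : OrdinalGeneric C)
    (K : Finset (Fin n)) (hKcard : K.card = m - 1) (hKsub : Subordinating C K) :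
    {j : Fin n | j ∉ K ∧ Subordinating C (insert j K)}.ncard =
      if K ⊆ Finset.univ.filter (fun j : Fin n => (j : ℕ) < m) then 1 else 2 := by
  obtain rfl | hm1 : m = 1 ∨ 1 < m := by omega
  · obtain rfl : K = ∅ := Finset.card_eq_zero.1 hKcard
    simpa using ncard_subordinating_insert_of_one (by omega) hgen
  have hKne : K.Nonempty := Finset.card_pos.1 (by omega)
  choose r hr using fun i : Fin m => K.exists_min_image (C i) hKne
  obtain ⟨p, -, q, -, hpq, hrpq⟩ := Finset.exists_ne_map_eq_of_card_lt_of_maps_to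
    (s := Finset.univ) (t := K) (f := r) (by simp; omega) (fun i _ => (hr i).1)
  rw [ncard_subordinating_insert hgen hr hKsub hKcard hpq hrpq]
  split_ifs with hsub
  · obtain ⟨s, hsK, hs⟩ := exists_forall_castLE_mem hm hmn.le hKcard
      fun k hk => (Finset.mem_filter.1 (hsub hk)).2
    have hdiag : ∀ i, i ≠ s → r i = Fin.castLE hmn.le i := by
      intro i hi
      have hlt := (Finset.mem_filter.1 (hsub (hr i).1)).2
      by_contra hne
      have hne' : i ≠ ⟨r i, hlt⟩ := fun h => hne (by rw [Fin.ext_iff] at h ⊢; exact h.symm)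
      exact ((scarf_strict hmn hC hgen hne').1.trans_le
        ((hr i).2 _ (hs i hi))).false
    by_cases hp : p = s
    · subst hp
      exact ncard_top_add_ncard_top hmn hC hgen hr hKsub hpq hrpq hdiag hs
    by_cases hq : q = s
    · subst hq
      rw [add_comm]
      exact ncard_top_add_ncard_top hmn hC hgen hr hKsub hpq.symm hrpq.symm hdiag hs
    · rw [hdiag p hp, hdiag q hq] at hrpq
      exact absurd (Fin.castLE_injective hmn.le hrpq) hpq
  · obtain ⟨k, hkK, hk⟩ := Finset.not_subset.1 hsub
    have hkm : m ≤ (k : ℕ) := by simpa using hk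
    have hne := columnsAboveOff_nonempty_of_not_subset hmn hC hgen hr hkK hkm
    rw [ncard_topColumnsAboveOff hgen (hne p), ncard_topColumnsAboveOff hgen (hne q)]
end

section
/- Let m < n be positive integers, let B be an m × n real matrix such that b_{ij} = δ_{ij} for 1 ≤ i, j ≤ m, and let b be a non-negative vector in ℝ^m such that the set {α ∈ ℝ₊ⁿ : Bα = b} is bounded. Then for every ε > 0 there exists a non-negative vector b′ ∈ ℝ^m with ‖b′ − b‖ < ε such that the pair (B, b′) is non-degenerate and every feasible basis for (B, b′) is also a feasible basis for (B, b). -/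
theorem Matrix.mulVec_eq_sum_finset_col {m n : ℕ} (B : Matrix (Fin m) (Fin n) ℝ)
    {J : Finset (Fin n)} {α : Fin n → ℝ} (hα : ∀ j ∉ J, α j = 0) :
    B.mulVec α = ∑ j ∈ J, α j • fun i => B i j := by
  ext i
  simp only [Matrix.mulVec, dotProduct, Finset.sum_apply, Pi.smul_apply, smul_eq_mul]
  rw [← Finset.sum_subset (Finset.subset_univ J)]
  · exact Finset.sum_congr rfl fun j _ => mul_comm _ _
  · intro j _ hj
    simp [hα j hj]

theorem isClosed_setOf_feasibleBasis {m n : ℕ} (B : Matrix (Fin m) (Fin n) ℝ)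
    (J : Finset (Fin n)) : IsClosed {b : Fin m → ℝ | FeasibleBasis B b J} := by
  classical
  by_cases h : J.card = m ∧ LinearIndependent ℝ (fun j : J => (fun i => B i (j : Fin n)))
  · obtain ⟨hc, hli⟩ := h
    have hcone : IsClosed {β : J → ℝ | ∀ j, 0 ≤ β j} := isClosed_Ici
    have hclosed := (LinearMap.isClosedEmbedding_of_injective
      (LinearMap.ker_eq_bot.2 hli.fintypeLinearCombination_injective)).isClosedMap _ hcone
    convert hclosed using 1
    ext b
    constructor
    · rintro ⟨-, -, α, h0, hα, rfl⟩
      refine ⟨fun j => α j, fun j => h0 j, ?_⟩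
      rw [B.mulVec_eq_sum_finset_col hα, Fintype.linearCombination_apply]
      exact Finset.sum_coe_sort J fun j => α j • fun i => B i j
    · rintro ⟨β, hβ, rfl⟩
      have hα : ∀ j ∉ J, (if h : j ∈ J then β ⟨j, h⟩ else 0) = 0 := fun j hj => dif_neg hj
      refine ⟨hc, hli, fun j => if h : j ∈ J then β ⟨j, h⟩ else 0, fun j => ?_, hα, ?_⟩
      · dsimp only
        split_ifs with h
        exacts [hβ _, le_rfl]
      · rw [B.mulVec_eq_sum_finset_col hα, Fintype.linearCombination_apply, ← Finset.sum_coe_sort]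
        simp
  · convert isClosed_empty
    exact Set.eq_empty_of_forall_notMem fun b hb => h ⟨hb.1, hb.2.1⟩

theorem volume_setOf_not_nonDegenerate {m n : ℕ} (B : Matrix (Fin m) (Fin n) ℝ) :
    MeasureTheory.volume {b : Fin m → ℝ | ¬ NonDegenerate B b} = 0 := by
  classical
  let V : Finset (Fin n) → Submodule ℝ (Fin m → ℝ) := fun J =>
    Submodule.span ℝ (J.image fun j i => B i j : Finset (Fin m → ℝ))
  have hV : ∀ J : {J : Finset (Fin n) // J.card < m},
      MeasureTheory.volume (V J : Set (Fin m → ℝ)) = 0 := by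
    rintro ⟨J, hJ⟩
    refine MeasureTheory.Measure.addHaar_submodule _ _ fun htop => ?_
    have hrank : Module.finrank ℝ (V J) ≤ J.card :=
      (finrank_span_finset_le_card _).trans Finset.card_image_le
    dsimp only at htop
    rw [htop, finrank_top, Module.finrank_fin_fun] at hrank
    omega
  refine MeasureTheory.measure_mono_null ?_ (MeasureTheory.measure_iUnion_null hV)
  intro b hb
  obtain ⟨J, hJ, α, -, hα, rfl⟩ := not_not.1 hb
  refine Set.mem_iUnion.2 ⟨⟨J, hJ⟩, ?_⟩
  rw [B.mulVec_eq_sum_finset_col hα]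
  exact Submodule.sum_mem _ fun j hj => Submodule.smul_mem _ _
    (Submodule.subset_span (Finset.mem_coe.2 (Finset.mem_image_of_mem _ hj)))

/-- **Perturbation to non-degeneracy.**  Given `B` with identity leading block and a
non-negative `b` with bounded feasible region, for every `ε > 0` there is a non-negative
`b'` with `‖b' - b‖ < ε` such that `(B, b')` is non-degenerate and every feasible basis
for `(B, b')` is also a feasible basis for `(B, b)`. -/
theorem exists_nondegenerate_perturbation {m n : ℕ} (hm : 0 < m) (hmn : m < n)
    (B : Matrix (Fin m) (Fin n) ℝ) (b : Fin m → ℝ)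
    (hB : ∀ i j : Fin m, B i (Fin.castLE hmn.le j) = if i = j then 1 else 0)
    (hb : ∀ i, 0 ≤ b i)
    (hbdd : Bornology.IsBounded {α : Fin n → ℝ | (∀ j, 0 ≤ α j) ∧ B.mulVec α = b}) :
    ∀ ε : ℝ, 0 < ε → ∃ b' : Fin m → ℝ, (∀ i, 0 ≤ b' i) ∧ ‖b' - b‖ < ε ∧
      NonDegenerate B b' ∧
      ∀ J : Finset (Fin n), FeasibleBasis B b' J → FeasibleBasis B b J := by
  intro ε hε
  let F : Set (Fin m → ℝ) :=
    ⋃ J : {J : Finset (Fin n) // ¬ FeasibleBasis B b J}, {x | FeasibleBasis B x J}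
  have hF : IsClosed F := isClosed_iUnion_of_finite fun J => isClosed_setOf_feasibleBasis B J
  have hbF : b ∉ F := by
    rintro h
    obtain ⟨J, hJ⟩ := Set.mem_iUnion.1 h
    exact J.2 hJ
  have hopen : IsOpen (Fᶜ ∩ Metric.ball b ε) := hF.isOpen_compl.inter Metric.isOpen_ball
  obtain ⟨δ, hδ, hball⟩ := Metric.isOpen_iff.1 hopen b ⟨hbF, Metric.mem_ball_self hε⟩
  let c : Fin m → ℝ := fun i => b i + δ / 2
  have hc : c ∈ Metric.ball b δ := by
    refine (dist_pi_lt_iff hδ).2 fun i => ?_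
    simp only [c, dist_self_add_left, Real.norm_eq_abs]
    rw [abs_of_pos (half_pos hδ)]
    exact half_lt_self hδ
  let U : Set (Fin m → ℝ) := Metric.ball b δ ∩ ⋂ i, {x | 0 < x i}
  have hU : IsOpen U := Metric.isOpen_ball.inter
    (isOpen_iInter_of_finite fun i => isOpen_lt continuous_const (continuous_apply i))
  have hcU : c ∈ U := ⟨hc, Set.mem_iInter.2 fun i => add_pos_of_nonneg_of_pos (hb i) (half_pos hδ)⟩
  have hnull : ¬ U ⊆ {x | ¬ NonDegenerate B x} := fun hsub =>
    (hU.measure_pos MeasureTheory.volume ⟨c, hcU⟩).ne'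
      (MeasureTheory.measure_mono_null hsub (volume_setOf_not_nonDegenerate B))
  obtain ⟨b', ⟨hb'ball, hb'pos⟩, hb'nd⟩ := Set.not_subset.1 hnull
  obtain ⟨hb'F, hb'ε⟩ := hball hb'ball
  refine ⟨b', fun i => (Set.mem_iInter.1 hb'pos i).le, mem_ball_iff_norm.1 hb'ε,
    not_not.1 hb'nd, fun J hJ => ?_⟩
  by_contra hJb
  exact hb'F (Set.mem_iUnion.2 ⟨⟨J, hJb⟩, hJ⟩)
end

section
/- Let m < n be positive integers and let C be an m × n real matrix such that c_{ii} ≤ c_{ik} ≤ c_{ij} whenever i, j ≤ m, i ≠ j and k > m. Then for every ε > 0 there exists an m × n matrix C′ with |c′_{ij} − c_{ij}| < ε for all i, j, such that C′ is ordinal-generic, C′ satisfies c′_{ii} ≤ c′_{ik} ≤ c′_{ij} whenever i, j ≤ m, i ≠ j and k > m, and every subordinating set for C′ is also subordinating for C. -/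
/-- A rank function for the columns in row `i`: column `i` comes first, then the columns
beyond the first `m`, then the remaining columns among the first `m`. -/
def scarfRank {m n : ℕ} (i : Fin m) (k : Fin n) : ℤ :=
  if (k : ℕ) = i then -1 else if (k : ℕ) < m then n + k else k

theorem scarfRank_injective {m n : ℕ} (i : Fin m) :
    Function.Injective (scarfRank (n := n) i) := by
  intro j k h
  have hj := j.isLt
  have hk := k.isLt
  unfold scarfRank at h
  ext
  split_ifs at h <;> omega

/-- **Perturbation to ordinal genericity.**  Given `C` satisfying the Scarf condition,
for every `ε > 0` there is a matrix `C'` entrywise within `ε` of `C` which is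
ordinal-generic, still satisfies the Scarf condition, and such that every subordinating
set for `C'` is also subordinating for `C`. -/
theorem exists_ordinalGeneric_perturbation {m n : ℕ} (hm : 0 < m) (hmn : m < n)
    (C : Matrix (Fin m) (Fin n) ℝ)
    (hC : ∀ (i j : Fin m) (k : Fin n), i ≠ j → m ≤ (k : ℕ) →
      C i (Fin.castLE hmn.le i) ≤ C i k ∧ C i k ≤ C i (Fin.castLE hmn.le j)) :
    ∀ ε : ℝ, 0 < ε → ∃ C' : Matrix (Fin m) (Fin n) ℝ,
      (∀ (i : Fin m) (j : Fin n), |C' i j - C i j| < ε) ∧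
      OrdinalGeneric C' ∧
      (∀ (i j : Fin m) (k : Fin n), i ≠ j → m ≤ (k : ℕ) →
        C' i (Fin.castLE hmn.le i) ≤ C' i k ∧ C' i k ≤ C' i (Fin.castLE hmn.le j)) ∧
      ∀ J : Finset (Fin n), Subordinating C' J → Subordinating C J := by
  intro ε hε
  have tendsto_perturbed (i : Fin m) (k : Fin n) :
      Filter.Tendsto (fun δ : ℝ => C i k + δ * scarfRank i k) (nhdsWithin 0 (Set.Ioi 0))
        (nhds (C i k)) := by
    have hcont : Continuous fun δ : ℝ => C i k + δ * scarfRank i k := by fun_prop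
    simpa using (hcont.tendsto 0).mono_left nhdsWithin_le_nhds
  have hclose : ∀ᶠ δ : ℝ in nhdsWithin 0 (Set.Ioi 0),
      ∀ i k, |C i k + δ * scarfRank i k - C i k| < ε := by
    simp only [Filter.eventually_all]
    intro i k
    simpa [Real.dist_eq] using Metric.tendsto_nhds.1 (tendsto_perturbed i k) ε hε
  have hlt : ∀ᶠ δ : ℝ in nhdsWithin 0 (Set.Ioi 0), ∀ i j k,
      C i j < C i k → C i j + δ * scarfRank i j < C i k + δ * scarfRank i k := by
    simp only [Filter.eventually_all]
    intro i j k h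
    exact (tendsto_perturbed i j).eventually_lt (tendsto_perturbed i k) h
  obtain ⟨δ, ⟨hδε, hδlt⟩, hδ⟩ := ((hclose.and hlt).and self_mem_nhdsWithin).exists
  have hδ : 0 < δ := hδ
  have add_le {i : Fin m} {j k : Fin n} (h : C i j ≤ C i k)
      (hr : scarfRank i j ≤ scarfRank i k) :
      C i j + δ * scarfRank i j ≤ C i k + δ * scarfRank i k := by
    have hr' : (scarfRank i j : ℝ) ≤ scarfRank i k := by exact_mod_cast hr
    gcongr
  refine ⟨fun i k => C i k + δ * scarfRank i k, hδε, ?_, ?_, ?_⟩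
  · intro i j k h
    dsimp only at h
    rcases lt_trichotomy (C i j) (C i k) with hjk | hjk | hjk
    · exact absurd h (hδlt i j k hjk).ne
    · rw [hjk, add_right_inj, mul_right_inj' hδ.ne', Int.cast_inj] at h
      exact scarfRank_injective i h
    · exact absurd h (hδlt i k j hjk).ne'
  · intro i j k hij hk
    have hi := i.isLt
    have hj := j.isLt
    have hkn := k.isLt
    have hij' : (j : ℕ) ≠ i := fun h => hij (Fin.ext h.symm)
    refine ⟨add_le (hC i j k hij hk).1 ?_, add_le (hC i j k hij hk).2 ?_⟩ <;>
    · simp only [scarfRank, Fin.val_castLE]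
      split_ifs <;> omega
  · intro J hJ k
    obtain ⟨i, hi⟩ := hJ k
    refine ⟨i, fun j hj => ?_⟩
    by_contra! h
    exact (hi j hj).not_gt (hδlt i j k h)
end

section
/- Let m < n be positive integers and let C be an m × n ordinal-generic real matrix such that c_{ii} ≤ c_{ik} ≤ c_{ij} whenever i, j ≤ m, i ≠ j and k > m. Let F ⊆ [n] be a set of size m with 1 ∈ F that is not subordinating for C and such that K = F \ {1} is subordinating for C. Then the number of sets S ⊆ [n] of size m with 1 ∉ S, S subordinating for C, and F \ S = {1} is exactly 2 if F ≠ [m], and exactly 1 if F = [m]. -/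
/-- The columns that are not `K`-subordinated at any row other than `r`. -/
def freeColumns {m n : ℕ} (C : Matrix (Fin m) (Fin n) ℝ) (K : Finset (Fin n)) (r : Fin m) :
    Set (Fin n) :=
  {k | ∀ i, i ≠ r → ∃ j ∈ K, C i j < C i k}

/-- `s` is a free column for row `r` whose entry in row `r` is maximal. -/
def IsTopFree {m n : ℕ} (C : Matrix (Fin m) (Fin n) ℝ) (K : Finset (Fin n)) (r : Fin m)
    (s : Fin n) : Prop :=
  s ∈ freeColumns C K r ∧ ∀ k ∈ freeColumns C K r, C r k ≤ C r s

theorem IsTopFree.eq {m n : ℕ} {C : Matrix (Fin m) (Fin n) ℝ} (hgen : OrdinalGeneric C)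
    {K : Finset (Fin n)} {r : Fin m} {s t : Fin n} (hs : IsTopFree C K r s)
    (ht : IsTopFree C K r t) : s = t :=
  hgen r (le_antisymm (ht.2 s hs.1) (hs.2 t ht.1))

theorem exists_isTopFree {m n : ℕ} {C : Matrix (Fin m) (Fin n) ℝ} {K : Finset (Fin n)}
    {r : Fin m} (h : (freeColumns C K r).Nonempty) : ∃ s, IsTopFree C K r s := by
  obtain ⟨s, hs, hmax⟩ := Set.exists_max_image _ (C r) (Set.toFinite _) h
  exact ⟨s, hs, hmax⟩

theorem Subordinating.le_of_mem_freeColumns {m n : ℕ} {C : Matrix (Fin m) (Fin n) ℝ}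
    {K : Finset (Fin n)} (hK : Subordinating C K) {r : Fin m} {k : Fin n}
    (hk : k ∈ freeColumns C K r) : ∀ j ∈ K, C r k ≤ C r j := by
  obtain ⟨i, hi⟩ := hK k
  by_cases hir : i = r
  · exact hir ▸ hi
  · obtain ⟨j, hj, hlt⟩ := hk i hir
    exact absurd (hi j hj) hlt.not_ge

theorem IsTopFree.subordinating_insert {m n : ℕ} {C : Matrix (Fin m) (Fin n) ℝ}
    {K : Finset (Fin n)} (hK : Subordinating C K) {r : Fin m} {s : Fin n}
    (hs : IsTopFree C K r s) : Subordinating C (insert s K) := by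
  intro k
  by_cases hk : k ∈ freeColumns C K r
  · refine ⟨r, fun j hj => ?_⟩
    rcases Finset.mem_insert.1 hj with rfl | hj
    · exact hs.2 k hk
    · exact hK.le_of_mem_freeColumns hk j hj
  · simp only [freeColumns, Set.mem_ofPred_eq, not_forall, not_exists, not_and, not_lt] at hk
    obtain ⟨i, hir, hi⟩ := hk
    refine ⟨i, fun j hj => ?_⟩
    rcases Finset.mem_insert.1 hj with rfl | hj
    · obtain ⟨l, hl, hlt⟩ := hs.1 i hir
      exact (hi l hl).trans hlt.le
    · exact hi j hj

/-- A subordinating set admits an injective choice of rows in which its elements are minimal. -/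
theorem Subordinating.exists_rows {m n : ℕ} {C : Matrix (Fin m) (Fin n) ℝ}
    (hgen : OrdinalGeneric C) {J : Finset (Fin n)} (hJ : Subordinating C J) :
    ∃ ρ : Fin n → Fin m, Set.InjOn ρ J ∧ ∀ k, ∀ j ∈ J, C (ρ k) k ≤ C (ρ k) j := by
  choose ρ hρ using hJ
  refine ⟨ρ, fun a ha b hb hab => hgen (ρ a) (le_antisymm (hρ a b hb) ?_), hρ⟩
  rw [hab]
  exact hρ b a ha

theorem exists_isTopFree_of_subordinating_insert {m n : ℕ} {C : Matrix (Fin m) (Fin n) ℝ}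
    (hgen : OrdinalGeneric C) {K : Finset (Fin n)} (hcard : K.card + 1 = m) {s : Fin n}
    (hsK : s ∉ K) (hS : Subordinating C (insert s K)) : ∃ r, IsTopFree C K r s := by
  obtain ⟨ρ, hinj, hρ⟩ := hS.exists_rows hgen
  have himg : (insert s K).image ρ = Finset.univ := by
    rw [← Finset.card_eq_iff_eq_univ, Finset.card_image_of_injOn hinj,
      Finset.card_insert_of_notMem hsK, hcard, Fintype.card_fin]
  refine ⟨ρ s, fun i hi => ?_, fun k hk => ?_⟩
  · obtain ⟨j, hj, rfl⟩ := Finset.mem_image.1 (himg ▸ Finset.mem_univ i)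
    have hjs : j ≠ s := fun h => hi (h ▸ rfl)
    refine ⟨j, Finset.mem_of_mem_insert_of_ne hj hjs, ?_⟩
    exact (hρ j s (Finset.mem_insert_self s K)).lt_of_ne fun h => hjs (hgen _ h)
  · obtain ⟨i, hi⟩ := hS k
    by_cases hir : i = ρ s
    · exact hir ▸ hi s (Finset.mem_insert_self s K)
    · obtain ⟨j, hj, hlt⟩ := hk i hir
      exact absurd (hi j (Finset.mem_insert_of_mem hj)) hlt.not_ge

/-- A top free column outside `K` rules out free columns inside `K`. -/
theorem IsTopFree.notMem_freeColumns {m n : ℕ} {C : Matrix (Fin m) (Fin n) ℝ}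
    (hgen : OrdinalGeneric C) {K : Finset (Fin n)} (hK : Subordinating C K) {r : Fin m}
    {s k : Fin n} (hs : IsTopFree C K r s) (hsK : s ∉ K) (hk : k ∈ K) :
    k ∉ freeColumns C K r := fun hkM =>
  hsK (hgen r (le_antisymm (hK.le_of_mem_freeColumns hs.1 k hk) (hs.2 k hkM)) ▸ hk)

theorem notMem_freeColumns_of_forall_le {m n : ℕ} {C : Matrix (Fin m) (Fin n) ℝ}
    {K : Finset (Fin n)} {r i : Fin m} {k : Fin n} (hir : i ≠ r)
    (h : ∀ j ∈ K, C i k ≤ C i j) : k ∉ freeColumns C K r := fun hk => by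
  obtain ⟨j, hj, hlt⟩ := hk i hir
  exact (h j hj).not_gt hlt

/-- A subordinating set one element short of full size, for which every row has a free column,
has exactly two subordinating extensions by one element. -/
theorem ncard_extensions_eq_two {m n : ℕ} {C : Matrix (Fin m) (Fin n) ℝ}
    (hgen : OrdinalGeneric C) {K : Finset (Fin n)} (hcard : K.card + 1 = m)
    (hK : Subordinating C K) (hne : K.Nonempty)
    (hfree : ∀ r, (freeColumns C K r).Nonempty) :
    {s | s ∉ K ∧ Subordinating C (insert s K)}.ncard = 2 := by
  obtain ⟨ρ, hinj, hρ⟩ := hK.exists_rows hgen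
  obtain ⟨r₀, hr₀⟩ : ∃ r, r ∉ K.image ρ := by
    by_contra! h
    have := Finset.card_le_card (fun i _ => h i : Finset.univ ⊆ K.image ρ)
    have := Finset.card_image_le (s := K) (f := ρ)
    simp at *
    omega
  have hcover : ∀ i, i ≠ r₀ → ∃ k ∈ K, ρ k = i := by
    have himg : insert r₀ (K.image ρ) = Finset.univ := by
      rw [← Finset.card_eq_iff_eq_univ, Finset.card_insert_of_notMem hr₀,
        Finset.card_image_of_injOn hinj, hcard, Fintype.card_fin]
    intro i hi
    exact Finset.mem_image.1
      (Finset.mem_of_mem_insert_of_ne (himg ▸ Finset.mem_univ i) hi)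
  have hρr₀ : ∀ k ∈ K, ρ k ≠ r₀ := fun k hk h => hr₀ (h ▸ Finset.mem_image_of_mem ρ hk)
  obtain ⟨k₀, hk₀, hmin⟩ := K.exists_min_image (C r₀) hne
  have hdisj₀ : ∀ k ∈ K, k ∉ freeColumns C K r₀ := fun k hk =>
    notMem_freeColumns_of_forall_le (hρr₀ k hk) (hρ k)
  have hdisj₁ : ∀ k ∈ K, k ∉ freeColumns C K (ρ k₀) := by
    intro k hk
    by_cases h : k = k₀
    · subst h
      exact notMem_freeColumns_of_forall_le (hρr₀ k hk).symm hmin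
    · exact notMem_freeColumns_of_forall_le (fun h' => h (hinj hk hk₀ h')) (hρ k)
  obtain ⟨s₀, hs₀⟩ := exists_isTopFree (hfree r₀)
  obtain ⟨s₁, hs₁⟩ := exists_isTopFree (hfree (ρ k₀))
  have hs₀₁ : s₀ ≠ s₁ := by
    rintro rfl
    obtain ⟨i, hi⟩ := hK s₀
    by_cases hir : i = r₀
    · exact notMem_freeColumns_of_forall_le (hir ▸ (hρr₀ k₀ hk₀).symm) hi hs₁.1
    · exact notMem_freeColumns_of_forall_le hir hi hs₀.1
  rw [Set.ncard_eq_two]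
  refine ⟨s₀, s₁, hs₀₁, Set.ext fun s => ⟨fun ⟨hsK, hS⟩ => ?_, ?_⟩⟩
  · obtain ⟨r, hr⟩ := exists_isTopFree_of_subordinating_insert hgen hcard hsK hS
    by_cases h₀ : r = r₀
    · subst h₀
      exact Or.inl (hr.eq hgen hs₀)
    by_cases h₁ : r = ρ k₀
    · subst h₁
      exact Or.inr (hr.eq hgen hs₁)
    obtain ⟨k, hk, rfl⟩ := hcover r h₀
    refine absurd (fun i hi => ?_) (hr.notMem_freeColumns hgen hK hsK hk)
    by_cases hi₀ : i = r₀
    · subst hi₀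
      exact ⟨k₀, hk₀, (hmin k hk).lt_of_ne fun h => h₁ (hgen _ h ▸ rfl)⟩
    · obtain ⟨j, hj, rfl⟩ := hcover i hi₀
      exact ⟨j, hj, (hρ j k hk).lt_of_ne fun h => hi (hgen _ h ▸ rfl)⟩
  · rintro (rfl | rfl)
    · exact ⟨fun h => hdisj₀ _ h hs₀.1, hs₀.subordinating_insert hK⟩
    · exact ⟨fun h => hdisj₁ _ h hs₁.1, hs₁.subordinating_insert hK⟩

/-- A subordinating set one element short of full size, for which the entries in row `r₀` are
smaller outside `K` than inside, has exactly one subordinating extension by one element. -/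
theorem ncard_extensions_eq_one {m n : ℕ} {C : Matrix (Fin m) (Fin n) ℝ}
    (hgen : OrdinalGeneric C) {K : Finset (Fin n)} (hcard : K.card + 1 = m)
    (hK : Subordinating C K) (r₀ : Fin m) (hfree : (freeColumns C K r₀).Nonempty)
    (hdisj : ∀ k ∈ K, k ∉ freeColumns C K r₀)
    (hmin : ∀ s ∉ K, ∀ j ∈ K, C r₀ s ≤ C r₀ j) :
    {s | s ∉ K ∧ Subordinating C (insert s K)}.ncard = 1 := by
  obtain ⟨s₀, hs₀⟩ := exists_isTopFree hfree
  rw [Set.ncard_eq_one]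
  refine ⟨s₀, Set.ext fun s => ⟨fun ⟨hsK, hS⟩ => ?_, ?_⟩⟩
  · obtain ⟨r, hr⟩ := exists_isTopFree_of_subordinating_insert hgen hcard hsK hS
    by_cases h₀ : r = r₀
    · subst h₀
      exact hr.eq hgen hs₀
    · exact absurd hr.1 (notMem_freeColumns_of_forall_le (Ne.symm h₀) (hmin s hsK))
  · rintro rfl
    exact ⟨fun h => hdisj _ h hs₀.1, hs₀.subordinating_insert hK⟩

/-- Exchanging an element `a` of `F` corresponds to extending `F.erase a`. -/
theorem ncard_exchange_eq_ncard_extensions {m n : ℕ} {C : Matrix (Fin m) (Fin n) ℝ}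
    {F : Finset (Fin n)} {a : Fin n} (hF : F.card = m) (ha : a ∈ F)
    (hFnot : ¬ Subordinating C F) :
    {S : Finset (Fin n) | S.card = m ∧ a ∉ S ∧ Subordinating C S ∧ F \ S = {a}}.ncard =
      {s | s ∉ F.erase a ∧ Subordinating C (insert s (F.erase a))}.ncard := by
  have hcard : (F.erase a).card + 1 = m := hF ▸ Finset.card_erase_add_one ha
  have himg : {S : Finset (Fin n) | S.card = m ∧ a ∉ S ∧ Subordinating C S ∧ F \ S = {a}} =
      (fun s => insert s (F.erase a)) ''
        {s | s ∉ F.erase a ∧ Subordinating C (insert s (F.erase a))} := by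
    ext S
    constructor
    · rintro ⟨hS, haS, hsub, hdiff⟩
      have hKS : F.erase a ⊆ S := by
        intro x hx
        by_contra hxS
        have : x ∈ F \ S := Finset.mem_sdiff.2 ⟨Finset.mem_of_mem_erase hx, hxS⟩
        rw [hdiff, Finset.mem_singleton] at this
        exact Finset.ne_of_mem_erase hx this
      obtain ⟨s, hs, rfl⟩ :=
        (Finset.exists_eq_insert_iff (s := F.erase a) (t := S)).2 ⟨hKS, hcard.trans hS.symm⟩
      exact ⟨s, ⟨hs, hsub⟩, rfl⟩
    · rintro ⟨s, ⟨hs, hsub⟩, rfl⟩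
      have hsa : s ≠ a := by
        rintro rfl
        exact hFnot (Finset.insert_erase ha ▸ hsub)
      refine ⟨by rw [Finset.card_insert_of_notMem hs, hcard], by simp [hsa.symm], hsub, ?_⟩
      ext x
      simp only [Finset.mem_sdiff, Finset.mem_insert, Finset.mem_erase,
        Finset.mem_singleton] at hs ⊢
      grind
  rw [himg, Set.InjOn.ncard_image]
  intro s hs t _ hst
  have : s ∈ insert t (F.erase a) := by
    rw [← show insert s (F.erase a) = insert t (F.erase a) from hst]
    exact Finset.mem_insert_self s (F.erase a)
  exact (Finset.mem_insert.1 this).resolve_right hs.1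

/-- **Degree claim for feasible-basis-side vertices of positive degree.**  Let `C` be
ordinal-generic satisfying the Scarf condition.  Let `F ⊆ [n]` with `|F| = m` and `1 ∈ F`
be not subordinating for `C` but with `F \ {1}` subordinating for `C`.  Then the number of
sets `S ⊆ [n]` of size `m` with `1 ∉ S`, `S` subordinating for `C` and `F \ S = {1}` is
exactly `2` if `F ≠ [m]`, and exactly `1` if `F = [m]`. -/
theorem feasible_side_degree {m n : ℕ} (hm : 0 < m) (hmn : m < n)
    (C : Matrix (Fin m) (Fin n) ℝ)
    (hC : ∀ (i j : Fin m) (k : Fin n), i ≠ j → m ≤ (k : ℕ) →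
      C i (Fin.castLE hmn.le i) ≤ C i k ∧ C i k ≤ C i (Fin.castLE hmn.le j))
    (hgen : OrdinalGeneric C)
    (F : Finset (Fin n)) (hFcard : F.card = m)
    (h1F : (⟨0, by omega⟩ : Fin n) ∈ F)
    (hFnotsub : ¬ Subordinating C F)
    (hKsub : Subordinating C (F.erase (⟨0, by omega⟩ : Fin n))) :
    {S : Finset (Fin n) | S.card = m ∧ (⟨0, by omega⟩ : Fin n) ∉ S ∧
        Subordinating C S ∧ F \ S = {(⟨0, by omega⟩ : Fin n)}}.ncard =
      if F = Finset.univ.filter (fun j : Fin n => (j : ℕ) < m) then 1 else 2 := by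
  rw [ncard_exchange_eq_ncard_extensions hFcard h1F hFnotsub]
  have hcard : (F.erase (⟨0, by omega⟩ : Fin n)).card + 1 = m :=
    (Finset.card_erase_add_one h1F).trans hFcard
  split_ifs with hF
  · have hmem : ∀ j : Fin n, j ∈ F.erase (⟨0, by omega⟩ : Fin n) ↔
        (j : ℕ) ≠ 0 ∧ (j : ℕ) < m := by
      intro j
      simp [hF, Fin.ext_iff]
    have hrow : ∀ i j : Fin m, C i (Fin.castLE hmn.le i) ≤ C i (Fin.castLE hmn.le j) := by
      intro i j
      by_cases hij : i = j
      · rw [hij]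
      · obtain ⟨h₁, h₂⟩ := hC i j ⟨m, hmn⟩ hij le_rfl
        exact h₁.trans h₂
    have hdiag : ∀ i : Fin m, (i : ℕ) ≠ 0 →
        Fin.castLE hmn.le i ∈ F.erase (⟨0, by omega⟩ : Fin n) := fun i hi =>
      (hmem _).2 ⟨hi, i.2⟩
    refine ncard_extensions_eq_one hgen hcard hKsub ⟨0, hm⟩ ⟨⟨m, hmn⟩, fun i hi => ?_⟩
      (fun k hk => ?_) fun s hs j hj => ?_
    · have hi' : (i : ℕ) ≠ 0 := fun h => hi (Fin.ext h)
      refine ⟨_, hdiag i hi', ((hC i ⟨0, hm⟩ ⟨m, hmn⟩ hi le_rfl).1).lt_of_ne fun h => ?_⟩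
      have := congrArg Fin.val (hgen i h)
      have := i.2
      simp at *
      omega
    · obtain ⟨hk0, hkm⟩ := (hmem k).1 hk
      refine notMem_freeColumns_of_forall_le (i := ⟨k, hkm⟩)
        (fun h => hk0 (congrArg Fin.val h)) fun j hj => ?_
      exact hrow ⟨k, hkm⟩ ⟨j, ((hmem j).1 hj).2⟩
    · obtain ⟨hj0, hjm⟩ := (hmem j).1 hj
      by_cases hsm : (s : ℕ) < m
      · have hs0 : (s : ℕ) = 0 := by
          by_contra h
          exact hs ((hmem s).2 ⟨h, hsm⟩)
        have := hrow ⟨0, hm⟩ ⟨j, hjm⟩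
        rwa [show s = Fin.castLE hmn.le ⟨0, hm⟩ from Fin.ext hs0]
      · exact (hC ⟨0, hm⟩ ⟨j, hjm⟩ s (fun h => hj0 (congrArg Fin.val h).symm)
          (not_lt.1 hsm)).2
  · obtain ⟨k, hkF, hk⟩ : ∃ k ∈ F, m ≤ (k : ℕ) := by
      by_contra! h
      refine hF (Finset.eq_of_subset_of_card_le (fun j hj => by simpa using h j hj) ?_)
      rw [hFcard, Fin.card_filter_val_lt]
      exact min_le_right _ _
    have hkK : k ∈ F.erase (⟨0, by omega⟩ : Fin n) :=
      Finset.mem_erase.2 ⟨fun h => by simp [h] at hk; omega, hkF⟩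
    refine ncard_extensions_eq_two hgen hcard hKsub ⟨k, hkK⟩ fun r =>
      ⟨Fin.castLE hmn.le r, fun i hi => ⟨k, hkK, ?_⟩⟩
    refine (hC i r k hi hk).2.lt_of_ne fun h => ?_
    have := congrArg Fin.val (hgen i h)
    have := r.2
    simp at *
    omega
end

section
/- Every finite clique-acyclic digraph has a strong fractional kernel. -/
/-- `K` is a clique in the digraph with arc relation `A`: every two distinct vertices
of `K` are connected by at least one arc. -/
def IsDigraphClique {V : Type} (A : V → V → Prop) (K : Set V) : Prop :=
  ∀ u ∈ K, ∀ v ∈ K, u ≠ v → A u v ∨ A v u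

/-- The digraph with arc relation `A` is *clique-acyclic*: no clique contains a proper
cycle, i.e. a (nonempty, injective) cyclic sequence of vertices each of whose arcs is
irreversible. -/
def CliqueAcyclic {V : Type} (A : V → V → Prop) : Prop :=
  ∀ K : Set V, IsDigraphClique A K →
    ¬ ∃ k : ℕ, 0 < k ∧ ∃ c : ZMod k → V, Function.Injective c ∧ (∀ i, c i ∈ K) ∧
      ∀ i : ZMod k, A (c i) (c (i + 1)) ∧ ¬ A (c (i + 1)) (c i)

open Finset

section Parity

/-- Modulo two, the pairing of a cocycle `f` with a cycle `o` on the `(n + 1)`-subsets of a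
nonempty finite type vanishes. -/
theorem sum_powersetCard_mul_eq_zero {α R : Type*} [Fintype α] [DecidableEq α] [CommRing R]
    [CharP R 2] {n : ℕ} (a : α) (f o : Finset α → R)
    (hf : ∀ S : Finset α, #S = n + 2 → ∑ j ∈ S, f (S.erase j) = 0)
    (ho : ∀ E : Finset α, #E = n → ∑ k ∈ Eᶜ, o (insert k E) = 0) :
    ∑ D ∈ powersetCard (n + 1) univ, f D * o D = 0 := by
  have huniv : (univ : Finset α) = insert a (univ.erase a) := by simp
  have hdisj : Disjoint (powersetCard (n + 1) (univ.erase a))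
      ((powersetCard n (univ.erase a)).image (insert a)) := by
    rw [Finset.disjoint_left]
    intro D hD hD'
    obtain ⟨E, -, rfl⟩ := mem_image.1 hD'
    have := (mem_powersetCard.1 hD).1 (mem_insert_self a E)
    simp at this
  have hnot : ∀ {k : ℕ} {D : Finset α}, D ∈ powersetCard k (univ.erase a) → a ∉ D := by
    intro k D hD h
    have := (mem_powersetCard.1 hD).1 h
    simp at this
  have hmem : ∀ {k : ℕ} {D : Finset α}, a ∉ D → #D = k → D ∈ powersetCard k (univ.erase a) := by
    intro k D hD h
    refine mem_powersetCard.2 ⟨fun x hx => ?_, h⟩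
    simp only [mem_erase, mem_univ, and_true]
    rintro rfl
    exact hD hx
  rw [huniv, powersetCard_succ_insert (by simp), sum_union hdisj, sum_image]
  swap
  · intro D hD D' hD' h
    rw [← erase_insert (hnot hD), ← erase_insert (hnot hD')]
    exact congrArg (fun S => S.erase a) h
  have h1 : ∀ D ∈ powersetCard (n + 1) (univ.erase a),
      f D * o D = ∑ j ∈ D, f ((insert a D).erase j) * o D := by
    intro D hD
    have h := hf (insert a D) (by rw [card_insert_of_notMem (hnot hD), (mem_powersetCard.1 hD).2])
    rw [sum_insert (hnot hD), erase_insert (hnot hD)] at h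
    rw [← sum_mul, CharTwo.add_eq_zero.1 h]
  have h2 : ∀ E ∈ powersetCard n (univ.erase a),
      f (insert a E) * o (insert a E) = ∑ k ∈ (insert a E)ᶜ, f (insert a E) * o (insert k E) := by
    intro E hE
    have h := ho E (mem_powersetCard.1 hE).2
    have hc : Eᶜ = insert a (insert a E)ᶜ := by
      rw [compl_insert, insert_erase (by simpa using hnot hE)]
    rw [hc, sum_insert (by simp)] at h
    rw [← mul_sum, CharTwo.add_eq_zero.1 h]
  rw [sum_congr rfl h1, sum_congr rfl h2, sum_sigma', sum_sigma', CharTwo.add_eq_zero]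
  refine sum_bij' (fun p _ => ⟨p.1.erase p.2, p.2⟩)
    (fun p _ => ⟨insert p.2 p.1, p.2⟩) ?_ ?_ ?_ ?_ ?_
  · rintro ⟨D, j⟩ h
    obtain ⟨hD, hj⟩ := mem_sigma.1 h
    dsimp only at hD hj
    refine mem_sigma.2 ⟨hmem (fun h => hnot hD (mem_of_mem_erase h)) ?_, ?_⟩
    · rw [card_erase_of_mem hj, (mem_powersetCard.1 hD).2]; rfl
    · have : j ≠ a := by rintro rfl; exact hnot hD hj
      simp [this]
  · rintro ⟨E, k⟩ h
    obtain ⟨hE, hk⟩ := mem_sigma.1 h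
    simp only [mem_compl, mem_insert, not_or] at hE hk
    refine mem_sigma.2 ⟨hmem ?_ ?_, mem_insert_self _ _⟩
    · simpa [mem_insert, not_or] using ⟨Ne.symm hk.1, hnot hE⟩
    · rw [card_insert_of_notMem hk.2, (mem_powersetCard.1 hE).2]
  · rintro ⟨D, j⟩ h
    obtain ⟨hD, hj⟩ := mem_sigma.1 h
    simp [insert_erase hj]
  · rintro ⟨E, k⟩ h
    obtain ⟨hE, hk⟩ := mem_sigma.1 h
    simp only [mem_compl, mem_insert, not_or] at hE hk
    simp [erase_insert hk.2]
  · rintro ⟨D, j⟩ h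
    obtain ⟨hD, hj⟩ := mem_sigma.1 h
    dsimp only at hD hj ⊢
    have : a ≠ j := by rintro rfl; exact hnot hD hj
    rw [insert_erase hj, erase_insert_of_ne this]

theorem even_card_powersetCard_filter {α : Type*} [Fintype α] [DecidableEq α] {n : ℕ} (a : α)
    (F O : Finset α → Prop) [DecidablePred F] [DecidablePred O]
    (hF : ∀ S : Finset α, #S = n + 2 → Even #{j ∈ S | F (S.erase j)})
    (hO : ∀ E : Finset α, #E = n → Even #{k ∈ Eᶜ | O (insert k E)}) :
    Even #{D ∈ powersetCard (n + 1) univ | F D ∧ O D} := by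
  have h := sum_powersetCard_mul_eq_zero (R := ZMod 2) (n := n) a (fun D => if F D then 1 else 0)
    (fun D => if O D then 1 else 0)
    (fun S hS => by rw [sum_boole]; exact (ZMod.natCast_eq_zero_iff_even).2 (hF S hS))
    (fun E hE => by rw [sum_boole]; exact (ZMod.natCast_eq_zero_iff_even).2 (hO E hE))
  rw [← ZMod.natCast_eq_zero_iff_even, ← sum_boole]
  refine (sum_congr rfl fun D _ => ?_).trans h
  by_cases h1 : F D <;> by_cases h2 : O D <;> simp [h1, h2]

/-- A finite set in which every element has a companion, and which contains no three distinct
elements, has even cardinality. -/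
theorem even_card_of_exists_ne_of_no_three {α : Type*} (s : Finset α)
    (hex : ∀ a ∈ s, ∃ b ∈ s, b ≠ a)
    (hthree : ∀ a ∈ s, ∀ b ∈ s, ∀ c ∈ s, a ≠ b → a ≠ c → b ≠ c → False) : Even #s := by
  have h2 : #s ≤ 2 := by
    by_contra! h
    obtain ⟨a, b, c, ha, hb, hc, h⟩ := Finset.two_lt_card_iff.1 h
    exact hthree a ha b hb c hc h.1 h.2.1 h.2.2
  have h1 : #s ≠ 1 := by
    intro h
    obtain ⟨a, rfl⟩ := card_eq_one.1 h
    obtain ⟨b, hb, hne⟩ := hex a (mem_singleton_self a)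
    exact hne (mem_singleton.1 hb)
  have : #s = 0 ∨ #s = 2 := by omega
  rcases this with h | h <;> simp [h]

end Parity

section Ordinal

/-- `D` is dominating for the row rankings `c`: every column `a` is, in some row, ranked no
higher than all columns of `D`. -/
def RowDominating {ι α : Type*} (c : ι → α → ℕ) (D : Finset α) : Prop :=
  ∀ a, ∃ i, ∀ d ∈ D, c i a ≤ c i d

variable {ι κ α : Type*}

theorem RowDominating.exists_row [Fintype ι] [DecidableEq α] {c : ι → α → ℕ}
    (hc : ∀ i, Function.Injective (c i)) {E : Finset α} (hE : #E + 1 = Fintype.card ι)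
    {μ : ι → α} (hμE : ∀ i, μ i ∈ E) (hμ : ∀ i, ∀ e ∈ E, c i (μ i) ≤ c i e) {k : α} (hk : k ∉ E)
    (hD : RowDominating c (insert k E)) :
    ∃ r, c r k < c r (μ r) ∧ (∀ i, i ≠ r → c i (μ i) < c i k) ∧ Set.InjOn μ {r}ᶜ := by
  classical
  choose ρ hρ using hD
  have hμρ : ∀ e ∈ E, μ (ρ e) = e := fun e he =>
    hc (ρ e) (le_antisymm (hμ _ e he) (hρ e _ (mem_insert_of_mem (hμE _))))
  have hinj : Set.InjOn ρ (insert k E : Finset α) := fun x hx y hy hxy =>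
    hc (ρ x) (le_antisymm (hρ x y hy) (hxy ▸ hρ y x hx))
  have hsurj : (insert k E).image ρ = univ := by
    rw [← card_eq_iff_eq_univ, card_image_of_injOn hinj, card_insert_of_notMem hk, hE]
  have hrow : ∀ i, i ≠ ρ k → ∃ d ∈ E, ρ d = i := by
    intro i hi
    obtain ⟨d, hd, rfl⟩ := mem_image.1 (hsurj ▸ mem_univ i)
    rcases mem_insert.1 hd with rfl | hd
    · exact absurd rfl hi
    · exact ⟨d, hd, rfl⟩
  refine ⟨ρ k, lt_of_le_of_ne (hρ k _ (mem_insert_of_mem (hμE _))) ?_, ?_, ?_⟩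
  · intro h
    exact hk (hc _ h ▸ hμE _)
  · intro i hi
    obtain ⟨d, hd, rfl⟩ := hrow i hi
    rw [hμρ d hd]
    refine lt_of_le_of_ne (hρ d k (mem_insert_self _ _)) fun h => hk (hc _ h ▸ hd)
  · intro i hi j hj hij
    obtain ⟨d, hd, rfl⟩ := hrow i hi
    obtain ⟨d', hd', rfl⟩ := hrow j hj
    rw [hμρ d hd, hμρ d' hd'] at hij
    rw [hij]

theorem RowDominating.eq_of_same_row [DecidableEq α] {c : ι → α → ℕ}
    (hc : ∀ i, Function.Injective (c i)) {E : Finset α} {μ : ι → α} (hμE : ∀ i, μ i ∈ E)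
    {k l : α} (hk : RowDominating c (insert k E)) (hl : RowDominating c (insert l E)) {r : ι}
    (hkr : ∀ i, i ≠ r → c i (μ i) < c i k) (hlr : ∀ i, i ≠ r → c i (μ i) < c i l) : k = l := by
  have key : ∀ {k l : α}, RowDominating c (insert k E) → (∀ i, i ≠ r → c i (μ i) < c i l) →
      c r l ≤ c r k := by
    intro k l hk hlr
    obtain ⟨i, hi⟩ := hk l
    by_cases hir : i = r
    · subst hir
      exact hi k (mem_insert_self _ _)
    · exact absurd (hi (μ i) (mem_insert_of_mem (hμE i))) (not_le.2 (hlr i hir))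
  exact hc r (le_antisymm (key hl hkr) (key hk hlr))

theorem RowDominating.exists_exchange [Fintype ι] [Finite α] [DecidableEq α] {c : ι → α → ℕ}
    (hc : ∀ i, Function.Injective (c i)) {E : Finset α} (hE : #E + 1 = Fintype.card ι)
    {μ : ι → α} (hμE : ∀ i, μ i ∈ E) (hμ : ∀ i, ∀ e ∈ E, c i (μ i) ≤ c i e)
    (htop : ∀ r, ∃ a, ∀ i, i ≠ r → c i (μ i) < c i a) {k : α} (hk : k ∉ E)
    (hD : RowDominating c (insert k E)) :
    ∃ l, l ∉ E ∧ RowDominating c (insert l E) ∧ l ≠ k := by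
  classical
  have := Fintype.ofFinite α
  obtain ⟨r, hrk, -, hinj⟩ := hD.exists_row hc hE hμE hμ hk
  have himage : ({r}ᶜ : Finset ι).image μ = E := by
    refine eq_of_subset_of_card_le (fun x hx => ?_) ?_
    · obtain ⟨i, -, rfl⟩ := mem_image.1 hx
      exact hμE i
    · rw [card_image_of_injOn (by simpa using hinj), card_compl, card_singleton]
      omega
  obtain ⟨r', hr', hμr'⟩ := mem_image.1 (himage ▸ hμE r)
  simp only [mem_compl, mem_singleton] at hr'
  obtain ⟨l, hl, hmax⟩ := exists_max_image
    ({a | ∀ i, i ≠ r' → c i (μ i) < c i a} : Finset α) (c r')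
    (by obtain ⟨a, ha⟩ := htop r'; exact ⟨a, by simpa using ha⟩)
  simp only [mem_filter, mem_univ, true_and] at hl hmax
  refine ⟨l, fun hlE => ?_, fun a => ?_, ?_⟩
  · obtain ⟨i, -, rfl⟩ := mem_image.1 (himage ▸ hlE)
    by_cases hi : i = r'
    · subst hi
      exact absurd (hl r (Ne.symm hr')) (by rw [hμr']; exact lt_irrefl _)
    · exact lt_irrefl _ (hl i hi)
  · by_cases ha : ∀ i, i ≠ r' → c i (μ i) < c i a
    · refine ⟨r', fun d hd => ?_⟩
      rcases mem_insert.1 hd with rfl | hd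
      · exact hmax a ha
      · obtain ⟨i, hi⟩ := hD a
        by_cases hir : i = r'
        · subst hir
          exact hi d (mem_insert_of_mem hd)
        · exact absurd (hi (μ i) (mem_insert_of_mem (hμE i))) (not_le.2 (ha i hir))
    · push Not at ha
      obtain ⟨i, hi, hle⟩ := ha
      refine ⟨i, fun d hd => ?_⟩
      rcases mem_insert.1 hd with rfl | hd
      · exact hle.trans (hl i hi).le
      · exact hle.trans (hμ i d hd)
  · rintro rfl
    exact lt_asymm hrk (hl r (Ne.symm hr'))

open Classical in
/-- The sets obtained from dominating sets by adding the set of all slack columns form a cycle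
modulo two. -/
theorem even_card_rowDominating_insert [Fintype ι] [Fintype κ] [Nonempty κ] {c : ι → ι ⊕ κ → ℕ}
    (hc : ∀ i, Function.Injective (c i)) (hlow : ∀ i k, c i (.inl i) < c i (.inr k))
    (hhigh : ∀ i j k, j ≠ i → c i (.inr k) < c i (.inl j))
    {E : Finset (ι ⊕ κ)} (hE : #E + 1 = Fintype.card ι) :
    Even #{k ∈ Eᶜ | RowDominating c (insert k E) ∨ insert k E = univ.map .inl} := by
  by_cases hET : E ⊆ univ.map .inl
  · obtain ⟨i₀, hi₀⟩ : ∃ i₀ : ι, Sum.inl i₀ ∉ E := by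
      by_contra! h
      have := card_le_card (show (univ.map .inl : Finset (ι ⊕ κ)) ⊆ E by
        intro x hx
        obtain ⟨i, -, rfl⟩ := mem_map.1 hx
        exact h i)
      rw [card_map, card_univ] at this
      omega
    have hT : insert (Sum.inl i₀) E = univ.map .inl := by
      refine eq_of_subset_of_card_le (insert_subset (by simp) hET) ?_
      rw [card_map, card_univ, card_insert_of_notMem hi₀, hE]
    have hmemE : ∀ j, j ≠ i₀ → Sum.inl j ∈ E := by
      intro j hj
      have : (Sum.inl j : ι ⊕ κ) ∈ insert (Sum.inl i₀) E := by rw [hT]; simp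
      simpa [hj] using this
    have hnotE : ∀ k : κ, Sum.inr k ∉ E := fun k hk => by simpa using hET hk
    have hEne : ∀ e ∈ E, ∃ j, j ≠ i₀ ∧ e = Sum.inl j := by
      intro e he
      obtain ⟨j, -, rfl⟩ := mem_map.1 (hET he)
      refine ⟨j, ?_, rfl⟩
      rintro rfl
      exact hi₀ he
    obtain ⟨k₀, -, hk₀⟩ := exists_max_image (univ : Finset κ) (fun k => c i₀ (.inr k))
      univ_nonempty
    have hset : ({k ∈ Eᶜ | RowDominating c (insert k E) ∨ insert k E = univ.map .inl} :
        Finset (ι ⊕ κ)) = {.inl i₀, .inr k₀} := by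
      ext x
      simp only [mem_filter, mem_compl, mem_insert, mem_singleton]
      constructor
      · rintro ⟨hxE, hx⟩
        rcases x with j | k
        · left
          by_contra hj
          exact hxE (hmemE j fun h => hj (h ▸ rfl))
        · right
          rcases hx with hx | hx
          · obtain ⟨i, hi⟩ := hx (.inr k₀)
            by_cases hii : i = i₀
            · subst hii
              exact hc i (le_antisymm (hk₀ k (mem_univ _)) (hi _ (mem_insert_self _ _)))
            · exact absurd (hi _ (mem_insert_of_mem (hmemE i hii))) (not_le.2 (hlow i k₀))
          · have : (Sum.inr k : ι ⊕ κ) ∈ univ.map Function.Embedding.inl :=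
              hx ▸ mem_insert_self _ _
            simp at this
      · rintro (rfl | rfl)
        · exact ⟨hi₀, Or.inr hT⟩
        · refine ⟨hnotE k₀, Or.inl fun a => ?_⟩
          have hslack : ∀ i d, c i (.inl i) ≤ c i d := by
            rintro i (j | k)
            · by_cases hj : j = i
              · rw [hj]
              · exact ((hlow i k₀).trans (hhigh i j k₀ hj)).le
            · exact (hlow i k).le
          rcases a with j | k
          · exact ⟨j, fun d _ => hslack j d⟩
          · refine ⟨i₀, fun d hd => ?_⟩
            rcases mem_insert.1 hd with rfl | hd
            · exact hk₀ k (mem_univ _)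
            · obtain ⟨j, hj, rfl⟩ := hEne d hd
              exact (hhigh i₀ j k hj).le
    rw [hset, card_pair (by simp)]
    exact even_two
  · obtain ⟨x, hxE, hx⟩ := not_subset.1 hET
    obtain ⟨k₁, rfl⟩ : ∃ k, x = .inr k := by
      rcases x with j | k
      · simp at hx
      · exact ⟨k, rfl⟩
    choose μ hμE hμ using fun i => exists_min_image E (c i) ⟨_, hxE⟩
    have htop : ∀ r, ∃ a, ∀ i, i ≠ r → c i (μ i) < c i a := fun r =>
      ⟨.inl r, fun i hi => (hμ i _ hxE).trans_lt (hhigh i r k₁ hi.symm)⟩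
    have hT : ∀ k, insert k E ≠ univ.map .inl := by
      intro k h
      exact hET (h ▸ subset_insert k E)
    simp only [hT, or_false]
    apply even_card_of_exists_ne_of_no_three
    · intro k hk
      simp only [mem_filter, mem_compl] at hk
      obtain ⟨l, hlE, hl, hlk⟩ := hk.2.exists_exchange hc hE hμE hμ htop hk.1
      exact ⟨l, by simp [hlE, hl], hlk⟩
    · intro k₁ h₁ k₂ h₂ k₃ h₃ h₁₂ h₁₃ h₂₃
      simp only [mem_filter, mem_compl] at h₁ h₂ h₃
      obtain ⟨r₁, -, hr₁, hi₁⟩ := h₁.2.exists_row hc hE hμE hμ h₁.1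
      obtain ⟨r₂, -, hr₂, hi₂⟩ := h₂.2.exists_row hc hE hμE hμ h₂.1
      obtain ⟨r₃, -, hr₃, hi₃⟩ := h₃.2.exists_row hc hE hμE hμ h₃.1
      have hr₁₂ : r₁ ≠ r₂ := by
        rintro rfl
        exact h₁₂ (h₁.2.eq_of_same_row hc hμE h₂.2 hr₁ hr₂)
      have hr₁₃ : r₁ ≠ r₃ := by
        rintro rfl
        exact h₁₃ (h₁.2.eq_of_same_row hc hμE h₃.2 hr₁ hr₃)
      have hr₂₃ : r₂ ≠ r₃ := by
        rintro rfl
        exact h₂₃ (h₂.2.eq_of_same_row hc hμE h₃.2 hr₂ hr₃)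
      have hinj : Function.Injective μ := by
        intro i j hij
        by_cases h1 : i ≠ r₁ ∧ j ≠ r₁
        · exact hi₁ h1.1 h1.2 hij
        by_cases h2 : i ≠ r₂ ∧ j ≠ r₂
        · exact hi₂ h2.1 h2.2 hij
        by_cases h3 : i ≠ r₃ ∧ j ≠ r₃
        · exact hi₃ h3.1 h3.2 hij
        grind
      have := card_le_card_of_injOn (s := univ) (t := E) μ (fun i _ => hμE i) hinj.injOn
      rw [card_univ] at this
      omega

end Ordinal

section Feasible

variable {ι α : Type*} [Fintype α] {B : α → ι → ℝ} {b : ι → ℝ}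

/-- `b` is a non-negative combination of the columns of `B` indexed by `J`. -/
def IsFeasible (B : α → ι → ℝ) (b : ι → ℝ) (J : Finset α) : Prop :=
  ∃ x : α → ℝ, 0 ≤ x ∧ (∀ a ∉ J, x a = 0) ∧ Fintype.linearCombination ℝ B x = b

theorem exists_neg_of_linearCombination_eq_zero (hB : ∀ a i, 0 ≤ B a i)
    (hB1 : ∀ a, ∃ i, 1 ≤ B a i) {d : α → ℝ} (hd : d ≠ 0)
    (hker : Fintype.linearCombination ℝ B d = 0) : ∃ a, d a < 0 := by
  by_contra! h
  refine hd (funext fun a => ?_)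
  obtain ⟨i, hi⟩ := hB1 a
  have hsum : ∑ a, d a * B a i = 0 := by
    simpa [Fintype.linearCombination_apply] using congrFun hker i
  have h0 := (sum_eq_zero_iff_of_nonneg fun a _ => mul_nonneg (h a) (hB a i)).1 hsum a (mem_univ a)
  rcases mul_eq_zero.1 h0 with h0 | h0
  · exact h0
  · linarith

theorem le_of_linearCombination_eq (hB : ∀ a i, 0 ≤ B a i) (hB1 : ∀ a, ∃ i, 1 ≤ B a i)
    {x : α → ℝ} (hx : 0 ≤ x) {M : ℝ} (hM : ∀ i, b i ≤ M)
    (hxb : Fintype.linearCombination ℝ B x = b) (a : α) : x a ≤ M := by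
  obtain ⟨i, hi⟩ := hB1 a
  have hsum : ∑ a, x a * B a i = b i := by
    simpa [Fintype.linearCombination_apply] using congrFun hxb i
  have := single_le_sum (fun a _ => mul_nonneg (hx a) (hB a i)) (mem_univ a)
  have := le_mul_of_one_le_right (hx a) hi
  linarith [hM i]

/-- Moving from a non-negative vector in a direction with a negative coordinate, one stays
non-negative until a coordinate vanishes. -/
theorem exists_add_smul_nonneg_eq_zero {p d : α → ℝ} (hp : 0 ≤ p) (hd : ∃ a, d a < 0) :
    ∃ t : ℝ, 0 ≤ p + t • d ∧ ∃ a, d a < 0 ∧ (p + t • d) a = 0 := by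
  obtain ⟨a, ha, hmin⟩ := exists_min_image ({a | d a < 0} : Finset α) (fun a => p a / -d a)
    (by obtain ⟨a, ha⟩ := hd; exact ⟨a, by simpa using ha⟩)
  simp only [mem_filter, mem_univ, true_and] at ha hmin
  refine ⟨p a / -d a, fun x => ?_, a, ha, ?_⟩
  · simp only [Pi.zero_apply, Pi.add_apply, Pi.smul_apply, smul_eq_mul]
    by_cases hx : d x < 0
    · have h1 := (le_div_iff₀ (neg_pos.2 hx)).1 (hmin x hx)
      linarith
    · have : 0 ≤ p a / -d a := div_nonneg (hp a) (by linarith)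
      have := mul_nonneg this (not_lt.1 hx)
      have := hp x
      simp only [Pi.zero_apply] at this
      linarith
  · simp only [Pi.add_apply, Pi.smul_apply, smul_eq_mul]
    have := ha.ne
    field_simp
    ring

/-- A linear system with more unknowns than equations has a nonzero solution supported on a given
set of unknowns. -/
theorem exists_ne_zero_linearCombination_eq_zero [Fintype ι] (B : α → ι → ℝ) {S : Finset α}
    (hS : Fintype.card ι < #S) :
    ∃ d : α → ℝ, d ≠ 0 ∧ (∀ a ∉ S, d a = 0) ∧ Fintype.linearCombination ℝ B d = 0 := by
  classical
  have hrank : Module.finrank ℝ (ι → ℝ) < Module.finrank ℝ (S → ℝ) := by simpa using hS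
  obtain ⟨d, hd, hne⟩ := (Submodule.ne_bot_iff _).1 (LinearMap.ker_ne_bot_of_finrank_lt
    (f := Fintype.linearCombination ℝ (fun a : S => B a)) hrank)
  refine ⟨fun a => if h : a ∈ S then d ⟨a, h⟩ else 0, fun h => hne (funext fun a => ?_),
    fun a ha => by simp [ha], ?_⟩
  · simpa using congrFun h a
  · rw [LinearMap.mem_ker, Fintype.linearCombination_apply] at hd
    rw [Fintype.linearCombination_apply, ← hd, ← sum_subset (subset_univ S), ← sum_coe_sort S]
    · exact sum_congr rfl fun a _ => by simp
    · intro a _ ha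
      simp [ha]

open Classical in
/-- For a right-hand side outside all spans of few columns, the feasible bases form a cocycle
modulo two. -/
theorem even_card_isFeasible_erase [Fintype ι] (hB : ∀ a i, 0 ≤ B a i)
    (hB1 : ∀ a, ∃ i, 1 ≤ B a i)
    (hb : ∀ J : Finset α, #J < Fintype.card ι → b ∉ Submodule.span ℝ (B '' J))
    {S : Finset α} (hS : #S = Fintype.card ι + 1) : Even #{j ∈ S | IsFeasible B b (S.erase j)} := by
  have hunique : ∀ x : α → ℝ, (∀ a ∉ S, x a = 0) → Fintype.linearCombination ℝ B x = b →
      ∀ j ∈ S, ∀ k ∈ S, x j = 0 → x k = 0 → j = k := by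
    intro x hxS hxb j hj k hk hxj hxk
    by_contra hjk
    have hcard := one_lt_card.2 ⟨j, hj, k, hk, hjk⟩
    refine hb ((S.erase j).erase k) ?_ ?_
    · rw [card_erase_of_mem (mem_erase.2 ⟨Ne.symm hjk, hk⟩), card_erase_of_mem hj]
      omega
    · rw [← hxb, Fintype.linearCombination_apply]
      refine Submodule.sum_mem _ fun a _ => ?_
      by_cases ha : a ∈ (S.erase j).erase k
      · exact Submodule.smul_mem _ _ (Submodule.subset_span ⟨a, ha, rfl⟩)
      · have : x a = 0 := by
          simp only [mem_erase, not_and_or, not_not] at ha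
          rcases ha with rfl | rfl | ha
          · exact hxk
          · exact hxj
          · exact hxS a ha
        simp [this]
  have hmove : ∀ p d : α → ℝ, 0 ≤ p → (∀ a ∉ S, p a = 0) → (∀ a ∉ S, d a = 0) →
      Fintype.linearCombination ℝ B p = b → Fintype.linearCombination ℝ B d = 0 → d ≠ 0 →
      ∃ q : α → ℝ, 0 ≤ q ∧ (∀ a ∉ S, q a = 0) ∧ Fintype.linearCombination ℝ B q = b ∧
        (∃ a ∈ S, d a < 0 ∧ q a = 0) ∧ ∀ k, p k = 0 → d k = 0 → q k = 0 := by
    intro p d hp hpS hdS hpb hdb hd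
    obtain ⟨t, ht, a, hda, ha⟩ := exists_add_smul_nonneg_eq_zero hp
      (exists_neg_of_linearCombination_eq_zero hB hB1 hd hdb)
    refine ⟨p + t • d, ht, fun a ha => by simp [hpS a ha, hdS a ha], by simp [hpb, hdb],
      ⟨a, ?_, hda, ha⟩, fun k h1 h2 => by simp [h1, h2]⟩
    by_contra haS
    exact hda.ne (hdS a haS)
  apply even_card_of_exists_ne_of_no_three
  · intro k hk
    obtain ⟨hkS, p, hp, hpS, hpb⟩ := mem_filter.1 hk
    obtain ⟨d, hd, hdS, hdb, hdk⟩ : ∃ d : α → ℝ, d ≠ 0 ∧ (∀ a ∉ S, d a = 0) ∧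
        Fintype.linearCombination ℝ B d = 0 ∧ 0 ≤ d k := by
      obtain ⟨d, hd, hdS, hdb⟩ := exists_ne_zero_linearCombination_eq_zero B (S := S) (by omega)
      rcases le_total 0 (d k) with h | h
      · exact ⟨d, hd, hdS, hdb, h⟩
      · exact ⟨-d, neg_ne_zero.2 hd, fun a ha => by simp [hdS a ha], by simp [hdb], by simpa⟩
    obtain ⟨q, hq, hqS, hqb, ⟨j, hjS, hdj, hqj⟩, -⟩ :=
      hmove p d hp (fun a ha => hpS a fun h => ha (mem_of_mem_erase h)) hdS hpb hdb hd
    refine ⟨j, mem_filter.2 ⟨hjS, q, hq, fun a ha => ?_, hqb⟩, ?_⟩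
    · by_cases haj : a = j
      · rw [haj, hqj]
      · exact hqS a fun h => ha (mem_erase.2 ⟨haj, h⟩)
    · rintro rfl
      exact absurd hdj (not_lt.2 hdk)
  · intro k hk j hj l hl hkj hkl hjl
    obtain ⟨hkS, p, hp, hpS, hpb⟩ := mem_filter.1 hk
    obtain ⟨hjS, q, hq, hqS, hqb⟩ := mem_filter.1 hj
    obtain ⟨hlS, r, hr, hrS, hrb⟩ := mem_filter.1 hl
    have hpk := hpS k (notMem_erase _ _)
    have hqj := hqS j (notMem_erase _ _)
    have hrl := hrS l (notMem_erase _ _)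
    replace hpS : ∀ a ∉ S, p a = 0 := fun a ha => hpS a fun h => ha (mem_of_mem_erase h)
    replace hqS : ∀ a ∉ S, q a = 0 := fun a ha => hqS a fun h => ha (mem_of_mem_erase h)
    replace hrS : ∀ a ∉ S, r a = 0 := fun a ha => hrS a fun h => ha (mem_of_mem_erase h)
    have pos : ∀ x : α → ℝ, 0 ≤ x → (∀ a ∉ S, x a = 0) → Fintype.linearCombination ℝ B x = b →
        ∀ u ∈ S, x u = 0 → ∀ v ∈ S, u ≠ v → 0 < x v := by
      intro x hx hxS hxb u hu hxu v hv huv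
      exact lt_of_le_of_ne (hx v) fun h => huv (hunique x hxS hxb u hu v hv hxu h.symm)
    have hpj := pos p hp hpS hpb k hkS hpk j hjS hkj
    have hpl := pos p hp hpS hpb k hkS hpk l hlS hkl
    have hqk := pos q hq hqS hqb j hjS hqj k hkS hkj.symm
    have hql := pos q hq hqS hqb j hjS hqj l hlS hjl
    have hrk := pos r hr hrS hrb l hlS hrl k hkS hkl.symm
    have hrj := pos r hr hrS hrb l hlS hrl j hjS hjl.symm
    have hzero : r k • (q - p) - q k • (r - p) = 0 := by
      by_contra hne
      obtain ⟨x, -, hxS, hxb, ⟨a, haS, hda, hxa⟩, hfix⟩ := hmove p _ hp hpS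
        (fun a ha => by simp [hpS a ha, hqS a ha, hrS a ha]) hpb (by simp [hpb, hqb, hrb]) hne
      have hdk : (r k • (q - p) - q k • (r - p)) k = 0 := by
        simp [hpk, mul_comm]
      have := hunique x hxS hxb a haS k hkS hxa (hfix k hpk hdk)
      rw [this, hdk] at hda
      exact lt_irrefl _ hda
    have h1 := congrFun hzero j
    have h2 := congrFun hzero l
    simp only [Pi.sub_apply, Pi.smul_apply, smul_eq_mul, Pi.zero_apply, hqj, hrl] at h1 h2
    rcases le_total (q k) (r k) with h | h
    · nlinarith [mul_pos hqk hrj, mul_nonneg (sub_nonneg.2 h) hpj.le]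
    · nlinarith [mul_pos hrk hql, mul_nonneg (sub_nonneg.2 h) hpl.le]

end Feasible

section Scarf

variable {ι κ : Type*} [Fintype ι] [Fintype κ]

/-- Scarf's lemma for a generic non-negative right-hand side. -/
theorem exists_rowDominating_isFeasible_of_generic [Nonempty ι] [Nonempty κ]
    {c : ι → ι ⊕ κ → ℕ} (hc : ∀ i, Function.Injective (c i))
    (hlow : ∀ i k, c i (.inl i) < c i (.inr k))
    (hhigh : ∀ i j k, j ≠ i → c i (.inr k) < c i (.inl j))
    {B : ι ⊕ κ → ι → ℝ} (hB : ∀ a i, 0 ≤ B a i) (hB1 : ∀ a, ∃ i, 1 ≤ B a i)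
    (hBinl : ∀ (x : ι → ℝ) (i : ι), ∑ j, x j * B (.inl j) i = x i)
    {b : ι → ℝ} (hb0 : 0 ≤ b)
    (hb : ∀ J : Finset (ι ⊕ κ), #J < Fintype.card ι → b ∉ Submodule.span ℝ (B '' J)) :
    ∃ D, RowDominating c D ∧ IsFeasible B b D := by
  classical
  obtain ⟨n, hn⟩ := Nat.exists_eq_succ_of_ne_zero (Fintype.card_ne_zero (α := ι))
  set T : Finset (ι ⊕ κ) := univ.map .inl with hT
  have hO : ∀ E : Finset (ι ⊕ κ), #E = n →
      Even #{k ∈ Eᶜ | RowDominating c (insert k E) ∨ insert k E = T} := by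
    intro E hE
    have h := even_card_rowDominating_insert hc hlow hhigh (E := E) (by omega)
    convert h
  have hF : ∀ S : Finset (ι ⊕ κ), #S = n + 2 → Even #{j ∈ S | IsFeasible B b (S.erase j)} := by
    intro S hS
    have h := even_card_isFeasible_erase hB hB1 hb (S := S) (by omega)
    convert h
  have heven := even_card_powersetCard_filter (Sum.inl (Classical.arbitrary ι))
    (IsFeasible B b) (fun D => RowDominating c D ∨ D = T) hF hO
  have hTmem : T ∈ ({D ∈ powersetCard (n + 1) univ | IsFeasible B b D ∧
      (RowDominating c D ∨ D = T)} : Finset (Finset (ι ⊕ κ))) := by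
    refine mem_filter.2 ⟨mem_powersetCard.2 ⟨subset_univ _, ?_⟩, ?_, Or.inr rfl⟩
    · rw [hT, card_map, card_univ, hn]
    · refine ⟨Sum.elim b 0, ?_, ?_, ?_⟩
      · rintro (i | k)
        · exact hb0 i
        · exact le_rfl
      · rintro (i | k) h
        · simp [hT] at h
        · rfl
      · ext i
        simp [Fintype.linearCombination_apply, hBinl]
  obtain ⟨D, hD, hDT⟩ : ∃ D ∈ ({D ∈ powersetCard (n + 1) univ | IsFeasible B b D ∧
      (RowDominating c D ∨ D = T)} : Finset (Finset (ι ⊕ κ))), D ≠ T := by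
    by_contra! h
    have : ({D ∈ powersetCard (n + 1) univ | IsFeasible B b D ∧
      (RowDominating c D ∨ D = T)} : Finset (Finset (ι ⊕ κ))) = {T} :=
      eq_singleton_iff_unique_mem.2 ⟨hTmem, h⟩
    rw [this, card_singleton] at heven
    exact absurd heven (by decide)
  obtain ⟨-, hF, hO⟩ := mem_filter.1 hD
  exact ⟨D, hO.resolve_right hDT, hF⟩

/-- The vectors outside all spans of few columns are dense. -/
theorem dense_notMem_span_image {α : Type*} [Finite α] (B : α → ι → ℝ) :
    Dense {b : ι → ℝ | ∀ J : Finset α, #J < Fintype.card ι →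
      b ∉ Submodule.span ℝ (B '' J)} := by
  classical
  have hset : {b : ι → ℝ | ∀ J : Finset α, #J < Fintype.card ι → b ∉ Submodule.span ℝ (B '' J)} =
      ⋂ J : {J : Finset α // #J < Fintype.card ι},
        ((Submodule.span ℝ (B '' (J : Finset α)) : Submodule ℝ (ι → ℝ)) : Set (ι → ℝ))ᶜ := by
    ext b
    simp
  rw [hset]
  refine dense_iInter_of_isOpen (fun J => (Submodule.closed_of_finiteDimensional _).isOpen_compl)
    fun J => ?_
  rw [← interior_eq_empty_iff_dense_compl]
  by_contra hne
  have htop := Submodule.eq_top_of_nonempty_interior' _ (Set.nonempty_iff_ne_empty.2 hne)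
  have h1 : Module.finrank ℝ (Submodule.span ℝ (B '' (J : Finset α))) ≤ #(J : Finset α) := by
    rw [← coe_image]
    exact (finrank_span_finset_le_card _).trans card_image_le
  rw [htop, finrank_top, Module.finrank_fintype_fun_eq_card] at h1
  exact absurd J.2 (not_lt.2 h1)

/-- **Scarf's lemma** for the right-hand side `1`. -/
theorem exists_rowDominating_isFeasible_one [Nonempty ι] [Nonempty κ]
    {c : ι → ι ⊕ κ → ℕ} (hc : ∀ i, Function.Injective (c i))
    (hlow : ∀ i k, c i (.inl i) < c i (.inr k))
    (hhigh : ∀ i j k, j ≠ i → c i (.inr k) < c i (.inl j))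
    {B : ι ⊕ κ → ι → ℝ} (hB : ∀ a i, 0 ≤ B a i) (hB1 : ∀ a, ∃ i, 1 ≤ B a i)
    (hBinl : ∀ (x : ι → ℝ) (i : ι), ∑ j, x j * B (.inl j) i = x i) :
    ∃ D, RowDominating c D ∧ IsFeasible B 1 D := by
  let P : Set (ι ⊕ κ → ℝ) := ⋃ D : {D : Finset (ι ⊕ κ) // RowDominating c D},
    Set.Icc 0 2 ∩ {x | ∀ a ∉ (D : Finset (ι ⊕ κ)), x a = 0}
  have hP : IsCompact P := by
    refine isCompact_iUnion fun D => isCompact_Icc.inter_right ?_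
    simp only [Set.ofPred_forall]
    exact isClosed_iInter fun a => isClosed_iInter fun _ =>
      isClosed_eq (continuous_apply a) continuous_const
  have hclosed : IsClosed (Fintype.linearCombination ℝ B '' P) :=
    (hP.image (LinearMap.continuous_of_finiteDimensional _)).isClosed
  let U : Set (ι → ℝ) := Set.univ.pi fun _ => Set.Ioo 0 2
  have hU : IsOpen U := isOpen_set_pi Set.finite_univ fun _ _ => isOpen_Ioo
  have hsub : U ∩ {b : ι → ℝ | ∀ J : Finset (ι ⊕ κ), #J < Fintype.card ι →
      b ∉ Submodule.span ℝ (B '' J)} ⊆ Fintype.linearCombination ℝ B '' P := by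
    rintro b ⟨hbU, hb⟩
    obtain ⟨D, hD, x, hx, hxD, hxb⟩ := exists_rowDominating_isFeasible_of_generic hc hlow hhigh
      hB hB1 hBinl (fun i => (hbU i trivial).1.le) hb
    refine ⟨x, Set.mem_iUnion.2 ⟨⟨D, hD⟩, ⟨hx, ?_⟩, hxD⟩, hxb⟩
    exact le_of_linearCombination_eq hB hB1 hx (fun i => (hbU i trivial).2.le) hxb
  have hone : (1 : ι → ℝ) ∈ Fintype.linearCombination ℝ B '' P :=
    hclosed.closure_subset_iff.2 hsub ((dense_notMem_span_image B).open_subset_closure_inter hU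
      (fun i _ => by simp))
  obtain ⟨x, hx, hx1⟩ := hone
  obtain ⟨⟨D, hD⟩, hx, hxD⟩ := Set.mem_iUnion.1 hx
  exact ⟨D, hD, x, hx.1, hxD, hx1⟩

end Scarf

section Ranking

/-- A relation on a finite type for which every nonempty set has a sink admits an injective
ranking that decreases along the relation. -/
theorem exists_injective_ranking {α : Type*} [Finite α] (R : α → α → Prop)
    (hR : ∀ S : Finset α, S.Nonempty → ∃ v ∈ S, ∀ u ∈ S, ¬ R v u) :
    ∃ g : α → ℕ, Function.Injective g ∧ ∀ u v, R u v → g v < g u := by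
  classical
  have := Fintype.ofFinite α
  suffices h : ∀ S : Finset α, ∃ g : α → ℕ, Set.InjOn g S ∧
      ∀ u ∈ S, ∀ v ∈ S, R u v → g v < g u by
    obtain ⟨g, hg, hgR⟩ := h univ
    exact ⟨g, by simpa using hg, fun u v => hgR u (mem_univ u) v (mem_univ v)⟩
  intro S
  induction S using Finset.strongInduction with
  | H S ih =>
    rcases S.eq_empty_or_nonempty with rfl | hS
    · exact ⟨fun _ => 0, by simp, by simp⟩
    obtain ⟨w, hw, hsink⟩ := hR S hS
    obtain ⟨g, hg, hgR⟩ := ih (S.erase w) (erase_ssubset hw)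
    refine ⟨fun x => if x = w then 0 else g x + 1, fun x hx y hy hxy => ?_,
      fun u hu v hv huv => ?_⟩
    · by_cases h1 : x = w <;> by_cases h2 : y = w
      · rw [h1, h2]
      · simp [h1, h2] at hxy
      · simp [h1, h2] at hxy
      · simp only [h1, h2, if_false, add_left_inj] at hxy
        exact hg (by simpa [h1] using hx) (by simpa [h2] using hy) hxy
    · have h1 : u ≠ w := by
        rintro rfl
        exact hsink v hv huv
      by_cases h2 : v = w
      · simp [h1, h2]
      · simpa [h1, h2] using hgR u (mem_erase.2 ⟨h1, hu⟩) v (mem_erase.2 ⟨h2, hv⟩) huv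

theorem CliqueAcyclic.exists_sink {V : Type} {A : V → V → Prop} (h : CliqueAcyclic A)
    {S : Finset V} (hS : S.Nonempty) (hK : IsDigraphClique A ↑S) :
    ∃ v ∈ S, ∀ u ∈ S, ¬ (A v u ∧ ¬ A u v) := by
  by_contra! hno
  choose! f hfS hf using hno
  let F : S → S := fun v => ⟨f v, hfS v v.2⟩
  obtain ⟨v, hv⟩ := hS
  obtain ⟨m, n, hmn, heq⟩ := Finite.exists_ne_map_eq_of_infinite fun n : ℕ => F^[n] ⟨v, hv⟩
  obtain ⟨x, hx⟩ : ∃ x, x ∈ Function.periodicPts F := by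
    wlog hlt : m < n generalizing m n
    · exact this n m hmn.symm heq.symm (by omega)
    refine ⟨F^[m] ⟨v, hv⟩, n - m, by omega, ?_⟩
    rw [Function.IsPeriodicPt, Function.IsFixedPt, ← Function.iterate_add_apply,
      Nat.sub_add_cancel hlt.le]
    exact heq.symm
  set k := Function.minimalPeriod F x with hk
  have hkpos : 0 < k := Function.minimalPeriod_pos_of_mem_periodicPts hx
  have : NeZero k := ⟨hkpos.ne'⟩
  have hstep : ∀ i : ZMod k, F^[(i + 1).val] x = F (F^[i.val] x) := by
    intro i
    rw [← Function.iterate_succ_apply' F, ← Function.iterate_mod_minimalPeriod_eq (n := i.val + 1),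
      ZMod.val_add, ZMod.val_one_eq_one_mod, Nat.add_mod_mod]
  refine h S hK ⟨k, hkpos, fun i => (F^[i.val] x : S), ?_, fun i => (F^[i.val] x).2, fun i => ?_⟩
  · intro i j hij
    exact ZMod.val_injective k (Function.iterate_injOn_Iio_minimalPeriod (ZMod.val_lt i)
      (ZMod.val_lt j) (Subtype.ext hij))
  · simp only [hstep]
    exact hf _ (F^[i.val] x).2

end Ranking

open Classical in
/-- The height of a column in the row of the clique `K`: first the slack of `K`, then the vertices
of `K`, the other vertices, and the other slacks. -/
noncomputable def columnLevel {ι V : Type*} (s : ι → Finset V) (i : ι) : ι ⊕ V → ℕ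
  | .inl j => if j = i then 0 else 3
  | .inr v => if v ∈ s i then 1 else 2

theorem CliqueAcyclic.exists_row_ranking {V ι : Type} [Finite V] [Finite ι] {A : V → V → Prop}
    (h : CliqueAcyclic A) (s : ι → Finset V) (i : ι) (hs : IsDigraphClique A ↑(s i)) :
    ∃ g : ι ⊕ V → ℕ, Function.Injective g ∧
      (∀ a b, columnLevel s i a < columnLevel s i b → g a < g b) ∧
      ∀ u ∈ s i, ∀ v ∈ s i, A u v → ¬ A v u → g (.inr v) < g (.inr u) := by
  classical
  let R : ι ⊕ V → ι ⊕ V → Prop := fun a b => columnLevel s i b < columnLevel s i a ∨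
    ∃ u ∈ s i, ∃ v ∈ s i, a = .inr u ∧ b = .inr v ∧ A u v ∧ ¬ A v u
  have hR : ∀ S : Finset (ι ⊕ V), S.Nonempty → ∃ v ∈ S, ∀ u ∈ S, ¬ R v u := by
    intro S hS
    obtain ⟨a, haS, ha⟩ := exists_min_image S (columnLevel s i) hS
    by_cases hcase : ∃ u ∈ s i, a = .inr u
    · obtain ⟨u, hu, rfl⟩ := hcase
      obtain ⟨w, hw, hsink⟩ := h.exists_sink (S := {v ∈ s i | Sum.inr v ∈ S})
        ⟨u, mem_filter.2 ⟨hu, haS⟩⟩ fun x hx y hy =>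
          hs x (mem_filter.1 hx).1 y (mem_filter.1 hy).1
      obtain ⟨hws, hwS⟩ := mem_filter.1 hw
      refine ⟨.inr w, hwS, fun b hb => ?_⟩
      rintro (hlt | ⟨u', hu', v', hv', h1, rfl, h2⟩)
      · have := ha b hb
        simp only [columnLevel, hu, hws, if_true] at this hlt
        omega
      · obtain rfl := Sum.inr_injective h1
        exact hsink v' (mem_filter.2 ⟨hv', hb⟩) h2
    · refine ⟨a, haS, fun b hb => ?_⟩
      rintro (hlt | ⟨u', hu', -, -, rfl, -⟩)
      · exact absurd (ha b hb) (not_le.2 hlt)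
      · exact hcase ⟨u', hu', rfl⟩
  obtain ⟨g, hg, hgR⟩ := exists_injective_ranking R hR
  exact ⟨g, hg, fun a b hab => hgR b a (Or.inl hab),
    fun u hu v hv h1 h2 => hgR _ _ (Or.inr ⟨u, hu, v, hv, rfl, rfl, h1, h2⟩)⟩

/-- Scarf's lemma applied to a family of cliques covering the vertices. -/
theorem CliqueAcyclic.exists_fractional_kernel {V ι : Type} [Fintype V] [Nonempty V]
    [DecidableEq V] [Fintype ι] {A : V → V → Prop} [DecidableRel A] (hacyc : CliqueAcyclic A)
    (s : ι → Finset V) (hs : ∀ i, IsDigraphClique A ↑(s i)) (hcover : ∀ v, ∃ i, v ∈ s i) :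
    ∃ f : V → ℝ, (∀ v, 0 ≤ f v) ∧ (∀ i, ∑ u ∈ s i, f u ≤ 1) ∧
      ∀ v : V, ∃ K : Finset V, IsDigraphClique A ↑K ∧
        K ⊆ insert v (univ.filter (fun u => A u v)) ∧ 1 ≤ ∑ u ∈ K, f u := by
  classical
  have : Nonempty ι := ⟨(hcover (Classical.arbitrary V)).choose⟩
  choose c hc hlevel harc using fun i => hacyc.exists_row_ranking s i (hs i)
  let B : ι ⊕ V → ι → ℝ := Sum.elim (fun j i => if j = i then 1 else 0)
    (fun v i => if v ∈ s i then 1 else 0)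
  obtain ⟨D, hD, x, hx, hxD, hx1⟩ := exists_rowDominating_isFeasible_one (B := B) hc
    (fun i k => hlevel i _ _ (by simp only [columnLevel]; split_ifs <;> simp_all))
    (fun i j k hj => hlevel i _ _ (by simp only [columnLevel]; split_ifs <;> simp_all))
    (by rintro (j | v) i <;> simp only [B, Sum.elim_inl, Sum.elim_inr] <;> split_ifs <;> simp)
    (by
      rintro (j | v)
      · exact ⟨j, by simp [B]⟩
      · obtain ⟨i, hi⟩ := hcover v
        exact ⟨i, by simp [B, hi]⟩)
    (by intro x i; simp [B])
  have hrow : ∀ i : ι, x (.inl i) + ∑ u ∈ s i, x (.inr u) = 1 := by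
    intro i
    have := congrFun hx1 i
    simpa [Fintype.linearCombination_apply, B, sum_ite_mem] using this
  refine ⟨fun v => x (.inr v), fun v => hx _, fun i => ?_, fun v => ?_⟩
  · have : 0 ≤ x (.inl i) := hx _
    linarith [hrow i]
  · obtain ⟨i, hi⟩ := hD (.inr v)
    have hlow : ∀ a ∈ D, columnLevel s i (.inr v) ≤ columnLevel s i a := fun a ha =>
      not_lt.1 fun h => absurd (hi a ha) (not_le.2 (hlevel i _ _ h))
    have hslack : x (.inl i) = 0 := by
      refine hxD _ fun h => ?_
      have := hlow _ h
      simp only [columnLevel, if_true] at this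
      split_ifs at this <;> omega
    have hsum := hrow i
    rw [hslack, zero_add] at hsum
    have hv : v ∈ s i := by
      obtain ⟨u, hu, hne⟩ := exists_ne_zero_of_sum_ne_zero (hsum ▸ one_ne_zero)
      have hle := hlow (.inr u) (by by_contra h; exact hne (hxD _ h))
      by_contra hv
      simp [columnLevel, hu, hv] at hle
    refine ⟨{u ∈ s i | Sum.inr u ∈ D}, fun u hu w hw =>
      hs i u (mem_filter.1 hu).1 w (mem_filter.1 hw).1, fun u hu => ?_, ?_⟩
    · obtain ⟨hus, huD⟩ := mem_filter.1 hu
      rw [mem_insert, mem_filter, or_iff_not_imp_left]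
      refine fun huv => ⟨mem_univ u, ?_⟩
      by_contra hA
      exact absurd (hi _ huD)
        (not_le.2 (harc i v hv u hus ((hs i u hus v hv huv).resolve_left hA) hA))
    · rw [sum_filter_of_ne fun u _ hne => by by_contra h; exact hne (hxD _ h), hsum]

/-- **Aharoni–Holzman.**  Every finite clique-acyclic digraph has a strong fractional
kernel: a non-negative function `f` on the vertices which is fractionally independent
(`∑_{u ∈ K} f u ≤ 1` for every clique `K`), fractionally dominating
(`∑_{u ∈ I(v)} f u ≥ 1` for every `v`, where `I(v) = {v} ∪ {u : (u,v) ∈ A}`), and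
strongly dominating (for every `v` some clique `K ⊆ I(v)` has `∑_{u ∈ K} f u ≥ 1`). -/
theorem strong_fractional_kernel_exists {V : Type} [Fintype V] [DecidableEq V]
    (A : V → V → Prop) [DecidableRel A] (hacyc : CliqueAcyclic A) :
    ∃ f : V → ℝ, (∀ v, 0 ≤ f v) ∧
      (∀ K : Finset V, IsDigraphClique A ↑K → ∑ u ∈ K, f u ≤ 1) ∧
      (∀ v : V, 1 ≤ ∑ u ∈ insert v (Finset.univ.filter (fun u => A u v)), f u) ∧
      (∀ v : V, ∃ K : Finset V, IsDigraphClique A ↑K ∧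
        K ⊆ insert v (Finset.univ.filter (fun u => A u v)) ∧ 1 ≤ ∑ u ∈ K, f u) := by
  classical
  rcases isEmpty_or_nonempty V with hV | hV
  · exact ⟨fun _ => 0, by simp, by simp, fun v => hV.elim v, fun v => hV.elim v⟩
  obtain ⟨f, hf, hind, hstrong⟩ := hacyc.exists_fractional_kernel
    (fun K : {K : Finset V // IsDigraphClique A ↑K} => K.1) (fun K => K.2)
    (fun v => ⟨⟨{v}, by simp [IsDigraphClique]⟩, mem_singleton_self v⟩)
  refine ⟨f, hf, fun K hK => hind ⟨K, hK⟩, fun v => ?_, hstrong⟩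
  obtain ⟨K, -, hKsub, hK⟩ := hstrong v
  exact hK.trans (sum_le_sum_of_subset_of_nonneg hKsub fun _ _ _ => hf _)
end
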